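/- For all integers m, n with m > n ≥ 5, the bipartite Ramsey number br(C_{2m}, C_{2n}) equals m+n-1; that is, every red-blue edge-coloring of K_{m+n-1, m+n-1} contains a red cycle of length 2m or a blue cycle of length 2n, and this fails for K_{m+n-2, m+n-2}. -/

import Mathlib

open SimpleGraph Set

/-- A symmetric relation whose restriction to `A ∪ B` only joins `A` to `B`. -/
structure Bip {V : Type} (r : V → V → Prop) (A B : Finset V) : Prop where
  disj : Disjoint A B
  symm : ∀ {u v}, r u v → r v u
  lr : ∀ {u v}, r u v → u ∈ A → v ∈ B
  rl : ∀ {u v}, r u v → u ∈ B → v ∈ A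

/-- `l` lists the vertices of a cycle of `r` in cyclic order. -/
structure IsCyc {V : Type} (r : V → V → Prop) (l : List V) : Prop where
  nodup : l.Nodup
  chain : l.IsChain r
  close : ∀ u ∈ l.getLast?, ∀ v ∈ l.head?, r u v

def HasCyc {V : Type} (r : V → V → Prop) (len : ℕ) : Prop :=
  ∃ l : List V, IsCyc r l ∧ l.length = len

/-- `l` lists the vertices of a path of `r` from `u` to `v`. -/
structure IsPth {V : Type} (r : V → V → Prop) (u v : V) (l : List V) : Prop where
  nodup : l.Nodup
  chain : l.IsChain r
  head : l.head? = some u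
  last : l.getLast? = some v

/-- A path from `u` to `v` inside `Y ∪ T` with `2 * p - 1` vertices. -/
def PathIn {V : Type} [DecidableEq V] (r : V → V → Prop) (Y T : Finset V) (u v : V) (p : ℕ) :
    Prop :=
  ∃ l, IsPth r u v l ∧ l.length + 1 = 2 * p ∧ ∀ w ∈ l, w ∈ Y ∪ T

section Basic

variable {V : Type} {r : V → V → Prop}

lemma Bip.swap {A B : Finset V} (h : Bip r A B) : Bip r B A :=
  ⟨h.disj.symm, h.symm, h.rl, h.lr⟩

lemma Bip.ne {A B : Finset V} (h : Bip r A B) {u v : V} (hu : u ∈ A) (hv : v ∈ B) :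
    u ≠ v := fun e => Finset.disjoint_left.1 h.disj hu (e ▸ hv)

lemma IsPth.reverse {u v : V} {l : List V} (hs : ∀ {a b}, r a b → r b a) (h : IsPth r u v l) :
    IsPth r v u l.reverse := by
  refine ⟨List.nodup_reverse.2 h.nodup, ?_, by simp [h.last], by simp [h.head]⟩
  rw [List.isChain_reverse]
  exact h.chain.imp fun _ _ e => hs e

lemma PathIn.symm [DecidableEq V] {Y T : Finset V} {u v : V} {p : ℕ}
    (hs : ∀ {a b}, r a b → r b a) (h : PathIn r Y T u v p) : PathIn r Y T v u p := by
  obtain ⟨l, h1, h2, h3⟩ := h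
  exact ⟨l.reverse, h1.reverse hs, by simpa using h2, by simpa using h3⟩

/-- Two vertex-disjoint paths whose ends are joined crosswise form a cycle. -/
lemma IsPth.join {u v u' v' : V} {l l' : List V} (h : IsPth r u v l) (h' : IsPth r u' v' l')
    (hd : l.Disjoint l') (h1 : r v u') (h2 : r v' u) : IsCyc r (l ++ l') := by
  have hl : l ≠ [] := by rintro rfl; simpa using h.head
  have hl' : l' ≠ [] := by rintro rfl; simpa using h'.head
  refine ⟨List.nodup_append'.2 ⟨h.nodup, h'.nodup, hd⟩, ?_, ?_⟩
  · rw [List.isChain_append]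
    refine ⟨h.chain, h'.chain, ?_⟩
    intro x hx y hy
    rw [h.last] at hx
    rw [h'.head] at hy
    simp at hx hy
    subst hx hy
    exact h1
  · intro x hx y hy
    rw [List.getLast?_append_of_ne_nil _ hl', h'.last] at hx
    rw [List.head?_append_of_ne_nil _ hl, h.head] at hy
    simp at hx hy
    subst hx hy
    exact h2

lemma IsCyc.rotate {l l' : List V} (h : IsCyc r (l ++ l')) : IsCyc r (l' ++ l) := by
  rcases eq_or_ne l [] with rfl | hl
  · simpa using h
  rcases eq_or_ne l' [] with rfl | hl'
  · simpa using h
  obtain ⟨h1, h2, h3⟩ := h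
  rw [List.isChain_append] at h2
  refine ⟨List.nodup_append_comm.1 h1, ?_, ?_⟩
  · rw [List.isChain_append]
    refine ⟨h2.2.1, h2.1, ?_⟩
    intro x hx y hy
    apply h3
    · rwa [List.getLast?_append_of_ne_nil _ hl']
    · rwa [List.head?_append_of_ne_nil _ hl]
  · intro x hx y hy
    apply h2.2.2
    · rwa [List.getLast?_append_of_ne_nil _ hl] at hx
    · rwa [List.head?_append_of_ne_nil _ hl'] at hy

lemma IsCyc.mono {r' : V → V → Prop} {l : List V} (h : IsCyc r l) (hr : ∀ u v, r u v → r' u v) :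
    IsCyc r' l :=
  ⟨h.nodup, h.chain.imp hr, fun u hu v hv => hr _ _ (h.close u hu v hv)⟩

/-- In a path that starts in `Y`, half of the vertices are in `T`. -/
lemma Bip.length_filter [DecidableEq V] {Y T : Finset V} (h : Bip r Y T) :
    ∀ l : List V, l.IsChain r → (∀ w ∈ l, w ∈ Y ∪ T) → (∀ w ∈ l.head?, w ∈ Y) →
      (l.filter (· ∈ T)).length = l.length / 2
  | [], _, _, _ => by simp
  | [a], _, _, h3 => by
      have : a ∉ T := Finset.disjoint_left.1 h.disj (h3 a (by simp))
      simp [this]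
  | a :: b :: l, h1, h2, h3 => by
      have ha : a ∈ Y := h3 a (by simp)
      have ha' : a ∉ T := Finset.disjoint_left.1 h.disj ha
      rw [List.isChain_cons_cons] at h1
      have hb : b ∈ T := h.lr h1.1 ha
      have := Bip.length_filter h l h1.2.tail (fun w hw => h2 w (by simp [hw])) (by
        intro w hw
        cases l with
        | nil => simp at hw
        | cons c l =>
          have h4 := h1.2
          rw [List.isChain_cons_cons] at h4
          simp at hw
          subst hw
          exact h.rl h4.1 hb)
      simp [ha', hb, this]
      omega

lemma Bip.card_inter [DecidableEq V] {Y T : Finset V} (h : Bip r Y T) {l : List V} {u v : V}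
    {p : ℕ} (hl : IsPth r u v l) (hw : ∀ w ∈ l, w ∈ Y ∪ T) (hu : u ∈ Y)
    (hp : l.length + 1 = 2 * p) :
    (T ∩ l.toFinset).card + 1 = p ∧ (Y ∩ l.toFinset).card = p := by
  have h1 := h.length_filter l hl.chain hw (by intro w; rw [hl.head]; simp; rintro rfl; exact hu)
  have h2 : (T ∩ l.toFinset).card = (l.filter (· ∈ T)).length := by
    rw [← List.toFinset_card_of_nodup (hl.nodup.filter _)]
    congr 1
    ext w
    simp [and_comm]
  have h3 : (Y ∩ l.toFinset).card + (T ∩ l.toFinset).card = l.length := by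
    rw [← List.toFinset_card_of_nodup hl.nodup, ← Finset.card_union_of_disjoint]
    · congr 1
      ext w
      have := hw w
      simp at this ⊢
      tauto
    · exact Finset.disjoint_of_subset_left Finset.inter_subset_left
        (Finset.disjoint_of_subset_right Finset.inter_subset_left h.disj)
  omega

end Basic

section Growth

variable {V : Type} {r : V → V → Prop}

lemma IsPth.ne_nil {u v : V} {l : List V} (h : IsPth r u v l) : l ≠ [] := by
  rintro rfl; simpa using h.head

lemma IsPth.head_mem {u v : V} {l : List V} (h : IsPth r u v l) : u ∈ l :=
  List.mem_of_mem_head? h.head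

lemma IsPth.single (v : V) : IsPth r v v [v] := ⟨by simp, by simp, by simp, by simp⟩

lemma IsPth.append {u v a b : V} {l l' : List V} (h : IsPth r u a l) (h' : IsPth r b v l')
    (hd : l.Disjoint l') (e : r a b) : IsPth r u v (l ++ l') := by
  refine ⟨List.nodup_append'.2 ⟨h.nodup, h'.nodup, hd⟩, ?_, ?_, ?_⟩
  · rw [List.isChain_append]
    refine ⟨h.chain, h'.chain, ?_⟩
    intro x hx y hy
    rw [h.last] at hx
    rw [h'.head] at hy
    simp at hx hy
    subst hx hy
    exact e
  · rw [List.head?_append_of_ne_nil _ h.ne_nil, h.head]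
  · rw [List.getLast?_append_of_ne_nil _ h'.ne_nil, h'.last]

lemma IsPth.cons {u v w : V} {l : List V} (h : IsPth r u v l) (hw : w ∉ l) (e : r w u) :
    IsPth r w v (w :: l) :=
  (IsPth.single w).append h (by simpa using hw) e

lemma IsPth.of_append {u v : V} {l l' : List V} (h : IsPth r u v (l ++ l')) (hl : l ≠ [])
    (hl' : l' ≠ []) : ∃ a b, IsPth r u a l ∧ IsPth r b v l' ∧ r a b ∧ l.Disjoint l' := by
  obtain ⟨h1, h2, h3, h4⟩ := h
  rw [List.nodup_append'] at h1
  rw [List.isChain_append] at h2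
  rw [List.head?_append_of_ne_nil _ hl] at h3
  rw [List.getLast?_append_of_ne_nil _ hl'] at h4
  obtain ⟨a, ha⟩ := Option.ne_none_iff_exists'.1 (mt List.getLast?_eq_none_iff.1 hl)
  obtain ⟨b, hb⟩ := Option.ne_none_iff_exists'.1 (mt List.head?_eq_none_iff.1 hl')
  exact ⟨a, b, ⟨h1.1, h2.1, h3, ha⟩, ⟨h1.2.1, h2.2.1, hb, h4⟩, h2.2.2 a ha b hb, h1.2.2⟩

/-- The vertex following `t` in `l`. -/
def List.nextOf [DecidableEq V] (l : List V) (t : V) : V := (l[l.idxOf t + 1]?).getD t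

lemma List.nextOf_eq [DecidableEq V] {P Q : List V} {t y : V} (hn : (P ++ Q).Nodup)
    (hP : P.getLast? = some t) (hQ : Q.head? = some y) : (P ++ Q).nextOf t = y := by
  obtain ⟨P', rfl⟩ := List.getLast?_eq_some_iff.1 hP
  obtain ⟨Q', rfl⟩ := List.head?_eq_some_iff.1 hQ
  have ht : t ∉ P' := by
    intro h
    simp [List.nodup_append'] at hn
    grind
  have h1 : (P' ++ [t] ++ y :: Q').idxOf t = P'.length := by
    simp [List.idxOf_append_of_notMem ht]
  rw [List.nextOf, h1]
  simp

lemma IsPth.split_at [DecidableEq V] {u v t : V} {l : List V} (h : IsPth r u v l) (ht : t ∈ l)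
    (hv : t ≠ v) : ∃ P Q, l = P ++ Q ∧ IsPth r u t P ∧ IsPth r (l.nextOf t) v Q ∧
      r t (l.nextOf t) ∧ P.Disjoint Q := by
  obtain ⟨s, w, rfl⟩ := List.append_of_mem ht
  have hw : w ≠ [] := by
    rintro rfl
    have := h.last
    simp at this
    exact hv this
  have e : s ++ t :: w = (s ++ [t]) ++ w := by simp
  rw [e] at h ⊢
  obtain ⟨a, b, h1, h2, h3, h4⟩ := h.of_append (by simp) hw
  have ha : a = t := by
    have := h1.last
    simp at this
    exact this.symm
  subst ha
  rw [List.nextOf_eq h.nodup h1.last h2.head]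
  exact ⟨_, _, rfl, h1, h2, h3, h4⟩

lemma IsPth.split_two_aux [DecidableEq V] {u v t t' : V} {l P Q : List V} (h : IsPth r u v l)
    (hl : l = P ++ Q)
    (hP : IsPth r u t P) (hQ : IsPth r (l.nextOf t) v Q) (hd : P.Disjoint Q)
    (ht' : t' ∈ Q) (hv' : t' ≠ v) :
    ∃ P M Q, l = P ++ (M ++ Q) ∧ IsPth r u t P ∧ IsPth r (l.nextOf t) t' M ∧
      IsPth r (l.nextOf t') v Q ∧ P.Disjoint M ∧ P.Disjoint Q ∧ M.Disjoint Q := by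
  obtain ⟨M, Q', rfl, h1, h2, h3, h4⟩ := hQ.split_at ht' hv'
  have : l.nextOf t' = (M ++ Q').nextOf t' := by
    have e : l = (P ++ M) ++ Q' := by rw [hl, List.append_assoc]
    rw [List.nextOf_eq hQ.nodup h1.last h2.head]
    have hn := h.nodup
    rw [e] at hn ⊢
    apply List.nextOf_eq hn _ h2.head
    rw [List.getLast?_append_of_ne_nil _ h1.ne_nil, h1.last]
  rw [this]
  refine ⟨P, M, Q', hl, hP, h1, h2, ?_, ?_, h4⟩
  · exact List.disjoint_of_disjoint_append_right_left hd
  · exact List.disjoint_of_disjoint_append_right_right hd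

lemma IsPth.split_two [DecidableEq V] {u v t t' : V} {l : List V} (h : IsPth r u v l) (ht : t ∈ l)
    (hv : t ≠ v) (ht' : t' ∈ l) (hv' : t' ≠ v) (hne : t ≠ t') :
    (∃ P M Q, l = P ++ (M ++ Q) ∧ IsPth r u t P ∧ IsPth r (l.nextOf t) t' M ∧
      IsPth r (l.nextOf t') v Q ∧ P.Disjoint M ∧ P.Disjoint Q ∧ M.Disjoint Q) ∨
    (∃ P M Q, l = P ++ (M ++ Q) ∧ IsPth r u t' P ∧ IsPth r (l.nextOf t') t M ∧
      IsPth r (l.nextOf t) v Q ∧ P.Disjoint M ∧ P.Disjoint Q ∧ M.Disjoint Q) := by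
  obtain ⟨P, Q, e, h1, h2, h3, h4⟩ := h.split_at ht hv
  obtain ⟨P', Q', e', h1', h2', h3', h4'⟩ := h.split_at ht' hv'
  by_cases hQ : t' ∈ Q
  · exact Or.inl (h.split_two_aux e h1 h2 h4 hQ hv')
  right
  refine h.split_two_aux e' h1' h2' h4' ?_ hv
  by_contra hQ'
  have hP : t' ∈ P := by
    have := ht'
    rw [e] at this
    simp at this
    tauto
  have hP' : t ∈ P' := by
    have := ht
    rw [e'] at this
    simp at this
    tauto
  obtain ⟨P1, rfl⟩ := List.getLast?_eq_some_iff.1 h1.last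
  obtain ⟨P2, rfl⟩ := List.getLast?_eq_some_iff.1 h1'.last
  have hn := h.nodup
  rw [e] at e' hn
  have h5 := List.append_eq_append_iff.1 e'
  have h6 := h1.nodup
  have h7 := h1'.nodup
  rcases h5 with ⟨a, h8, h9⟩ | ⟨a, h8, h9⟩
  · rcases eq_or_ne a [] with rfl | ha
    · simp at h8
      exact hne h8.2.symm
    · obtain ⟨b, hb⟩ := Option.ne_none_iff_exists'.1 (mt List.getLast?_eq_none_iff.1 ha)
      have : b = t' := by
        have := congrArg List.getLast? h8
        rw [List.getLast?_append_of_ne_nil _ ha, hb] at this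
        simp at this
        exact this.symm
      subst this
      apply hQ
      rw [h9]
      simp [List.mem_of_getLast? hb]
  · rcases eq_or_ne a [] with rfl | ha
    · simp at h8
      exact hne h8.2
    · obtain ⟨b, hb⟩ := Option.ne_none_iff_exists'.1 (mt List.getLast?_eq_none_iff.1 ha)
      have : b = t := by
        have := congrArg List.getLast? h8
        rw [List.getLast?_append_of_ne_nil _ ha, hb] at this
        simp at this
        exact this.symm
      subst this
      apply hQ'
      rw [h9]
      simp [List.mem_of_getLast? hb]

/-- Either the path `l` through the rows `Y` can be lengthened by the row `x`, or `x` together with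
the rows that follow the neighbours of `x` have pairwise disjoint neighbourhoods off `l`. -/
lemma IsPth.grow [DecidableEq V] {Y T : Finset V} (h : Bip r Y T) {l : List V} {u v x : V} {p : ℕ}
    (hl : IsPth r u v l) (hw : ∀ w ∈ l, w ∈ Y ∪ T) (hv : v ∈ Y)
    (hp : l.length + 1 = 2 * p) (hx : x ∈ Y) (hxl : x ∉ l) :
    PathIn r Y T u v (p + 1) ∨
      ((∀ t ∈ T, t ∈ l → l.nextOf t ∈ Y ∧ l.nextOf t ∈ l ∧ r t (l.nextOf t)) ∧
       (∀ t ∈ T, t ∈ l → ∀ t' ∈ T, t' ∈ l → l.nextOf t = l.nextOf t' → t = t') ∧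
       (∀ t ∈ T, t ∈ l → r x t → ∀ c ∈ T, c ∉ l → r x c → ¬ r (l.nextOf t) c) ∧
       (∀ t ∈ T, t ∈ l → ∀ t' ∈ T, t' ∈ l → t ≠ t' → r x t → r x t' → ∀ c ∈ T, c ∉ l →
          r (l.nextOf t) c → ¬ r (l.nextOf t') c)) := by
  by_cases hP : PathIn r Y T u v (p + 1)
  · exact Or.inl hP
  right
  have hne : ∀ t ∈ T, t ≠ v := fun t ht e => h.ne hv ht e.symm
  refine ⟨?_, ?_, ?_, ?_⟩
  · intro t ht htl
    obtain ⟨P, Q, e, h1, h2, h3, h4⟩ := hl.split_at htl (hne t ht)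
    refine ⟨h.rl h3 ht, ?_, h3⟩
    rw [e]
    rw [e] at h2
    exact List.mem_append_right _ h2.head_mem
  · intro t ht htl t' ht' htl' e
    by_contra hc
    rcases hl.split_two htl (hne t ht) htl' (hne t' ht') hc with
      ⟨P, M, Q, e', h1, h2, h3, h4, h5, h6⟩ | ⟨P, M, Q, e', h1, h2, h3, h4, h5, h6⟩
    · exact h6 h2.head_mem (e ▸ h3.head_mem)
    · exact h6 h2.head_mem (e ▸ h3.head_mem)
  · intro t ht htl hxt c hc hcl hxc hsc
    apply hP
    obtain ⟨P, Q, e, h1, h2, h3, h4⟩ := hl.split_at htl (hne t ht)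
    have hxP : x ∉ P := fun hh => hxl (by rw [e]; simp [hh])
    have hxQ : x ∉ Q := fun hh => hxl (by rw [e]; simp [hh])
    have hcP : c ∉ P := fun hh => hcl (by rw [e]; simp [hh])
    have hcQ : c ∉ Q := fun hh => hcl (by rw [e]; simp [hh])
    have hxc' : x ≠ c := h.ne hx hc
    have g1 := (h2.cons hcQ (h.symm hsc)).cons (w := x) (by simp [hxc', hxQ]) hxc
    have g2 := h1.append g1 (by simp [hxP, hcP, h4]) (h.symm hxt)
    refine ⟨_, g2, ?_, ?_⟩
    · rw [e] at hp
      simp at hp ⊢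
      omega
    · intro w hw'
      simp at hw'
      rcases hw' with hw' | rfl | rfl | hw'
      · exact hw w (by rw [e]; simp [hw'])
      · simp [hx]
      · simp [hc]
      · exact hw w (by rw [e]; simp [hw'])
  · have key : ∀ t t', r x t → r x t' → ∀ c ∈ T, c ∉ l →
        r (l.nextOf t) c → r (l.nextOf t') c →
        (∃ P M Q, l = P ++ (M ++ Q) ∧ IsPth r u t P ∧ IsPth r (l.nextOf t) t' M ∧
          IsPth r (l.nextOf t') v Q ∧ P.Disjoint M ∧ P.Disjoint Q ∧ M.Disjoint Q) → False := by
      intro t t' hxt hxt' c hc hcl h1c h2c ⟨P, M, Q, e, h1, h2, h3, h4, h5, h6⟩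
      apply hP
      have hxP : x ∉ P := fun hh => hxl (by rw [e]; simp [hh])
      have hxM : x ∉ M := fun hh => hxl (by rw [e]; simp [hh])
      have hxQ : x ∉ Q := fun hh => hxl (by rw [e]; simp [hh])
      have hcP : c ∉ P := fun hh => hcl (by rw [e]; simp [hh])
      have hcM : c ∉ M := fun hh => hcl (by rw [e]; simp [hh])
      have hcQ : c ∉ Q := fun hh => hcl (by rw [e]; simp [hh])
      have hxc' : x ≠ c := h.ne hx hc
      have g1 := h3.cons hcQ (h.symm h2c)
      have g2 := (h2.reverse h.symm).append g1
        (by simpa [List.disjoint_reverse_left, hcM] using h6) h1c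
      have g3 := g2.cons (w := x) (by simp [hxM, hxc', hxQ]) hxt'
      have g4 := h1.append g3 (by
        intro a ha hb
        simp at hb
        rcases hb with rfl | hb | rfl | hb
        · exact hxP ha
        · exact h4 ha hb
        · exact hcP ha
        · exact h5 ha hb) (h.symm hxt)
      refine ⟨_, g4, ?_, ?_⟩
      · rw [e] at hp
        simp at hp ⊢
        omega
      · intro w hw'
        simp at hw'
        rcases hw' with hw' | rfl | hw' | rfl | hw'
        · exact hw w (by rw [e]; simp [hw'])
        · simp [hx]
        · exact hw w (by rw [e]; simp [hw'])
        · simp [hc]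
        · exact hw w (by rw [e]; simp [hw'])
    intro t ht htl t' ht' htl' htt hxt hxt' c hc hcl h1 h2
    rcases hl.split_two htl (hne t ht) htl' (hne t' ht') htt with h3 | h3
    · exact key t t' hxt hxt' c hc hcl h1 h2 h3
    · exact key t' t hxt' hxt c hc hcl h2 h1 h3

end Growth

/-- The neighbours of `y` in `T`. -/
noncomputable def nb {V : Type} (r : V → V → Prop) (y : V) (T : Finset V) : Finset V :=
  open scoped Classical in T.filter (r y)

/-- The relation `r` restricted to pairs between `Y` and `T`. -/
def Rst {V : Type} (r : V → V → Prop) (Y T : Finset V) (u v : V) : Prop :=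
  r u v ∧ (u ∈ Y ∧ v ∈ T ∨ u ∈ T ∧ v ∈ Y)

/-- A cycle of `r` with `2 * n` vertices inside `Y ∪ T`. -/
def HamIn {V : Type} [DecidableEq V] (r : V → V → Prop) (Y T : Finset V) (n : ℕ) : Prop :=
  ∃ l, IsCyc r l ∧ l.length = 2 * n ∧ ∀ w ∈ l, w ∈ Y ∪ T

section Paths

variable {V : Type} {r : V → V → Prop}

@[simp] lemma mem_nb {y t : V} {T : Finset V} : t ∈ nb r y T ↔ t ∈ T ∧ r y t := by
  simp [nb]

lemma nb_subset {y : V} {T : Finset V} : nb r y T ⊆ T := fun _ ht => (mem_nb.1 ht).1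

lemma Bip.rst {A B Y T : Finset V} (h : Bip r A B) (hY : Y ⊆ A) (hT : T ⊆ B) :
    Bip (Rst r Y T) Y T := by
  have hd : Disjoint Y T := Finset.disjoint_of_subset_left hY
    (Finset.disjoint_of_subset_right hT h.disj)
  refine ⟨hd, ?_, ?_, ?_⟩
  · rintro u v ⟨e, h1⟩
    exact ⟨h.symm e, by tauto⟩
  · rintro u v ⟨e, h1⟩ hu
    rcases h1 with h1 | h1
    · exact h1.2
    · exact absurd h1.1 (Finset.disjoint_left.1 hd hu)
  · rintro u v ⟨e, h1⟩ hu
    rcases h1 with h1 | h1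
    · exact absurd hu (Finset.disjoint_left.1 hd h1.1)
    · exact h1.2

lemma nb_rst {Y T : Finset V} {y : V} (hy : y ∈ Y) : nb (Rst r Y T) y T = nb r y T := by
  ext t
  simp [Rst]
  tauto

lemma IsPth.mono {r' : V → V → Prop} {u v : V} {l : List V} (h : IsPth r u v l)
    (hr : ∀ u v, r u v → r' u v) : IsPth r' u v l :=
  ⟨h.nodup, h.chain.imp hr, h.head, h.last⟩

lemma PathIn.imp [DecidableEq V] {r' : V → V → Prop} {Y T : Finset V} {u v : V} {p : ℕ}
    (h : PathIn r Y T u v p) (hr : ∀ u v, r u v → r' u v) : PathIn r' Y T u v p := by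
  obtain ⟨l, h1, h2, h3⟩ := h
  exact ⟨l, h1.mono hr, h2, h3⟩

variable [DecidableEq V]

lemma exists_common {T : Finset V} {y y' : V} (h : T.card < (nb r y T).card + (nb r y' T).card) :
    ∃ t ∈ T, r y t ∧ r y' t := by
  by_contra! hc
  have : Disjoint (nb r y T) (nb r y' T) := by
    rw [Finset.disjoint_left]
    intro t h1 h2
    rw [mem_nb] at h1 h2
    exact hc t h1.1 h1.2 h2.2
  rw [← Finset.card_union_of_disjoint this] at h
  exact absurd (Finset.card_le_card (Finset.union_subset nb_subset nb_subset)) (not_le.2 h)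

lemma PathIn.one {Y T : Finset V} {y : V} (hy : y ∈ Y) : PathIn r Y T y y 1 :=
  ⟨[y], IsPth.single y, by simp, by simp [hy]⟩

lemma PathIn.two {A B Y T : Finset V} (h : Bip r A B) (hY : Y ⊆ A) (hT : T ⊆ B) {y y' t : V}
    (hy : y ∈ Y)
    (hy' : y' ∈ Y) (hne : y ≠ y') (ht : t ∈ T) (h1 : r y t) (h2 : r y' t) :
    PathIn r Y T y y' 2 := by
  have g1 := h.ne (hY hy) (hT ht)
  have g2 := h.ne (hY hy') (hT ht)
  refine ⟨[y, t, y'], ⟨by simp [g1, hne, g2.symm], by simp [h1, h.symm h2], by simp, by simp⟩,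
    by simp, by simp [hy, hy', ht]⟩

lemma nb_sdiff_card {T S : Finset V} {y : V} {K : ℕ} (h : K ≤ (nb r y T).card) :
    K ≤ (nb r y (T \ S)).card + (T ∩ S).card := by
  have : nb r y T ⊆ nb r y (T \ S) ∪ (T ∩ S) := by
    intro t
    simp
    tauto
  have := (Finset.card_le_card this).trans (Finset.card_union_le _ _)
  omega

lemma path_aux {Y T : Finset V} (h : Bip r Y T) {K : ℕ} (hK : ∀ y ∈ Y, K ≤ (nb r y T).card)
    (hT : T.card + 2 ≤ 2 * K) {y1 y2 : V} (h1 : y1 ∈ Y) (h2 : y2 ∈ Y) (hne : y1 ≠ y2) (p : ℕ)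
    (hp : 2 ≤ p) (hpY : p ≤ Y.card) (hpK : p ≤ K + 1) : PathIn r Y T y1 y2 p := by
  induction p, hp using Nat.le_induction with
  | base =>
    obtain ⟨t, ht, g1, g2⟩ := exists_common (r := r) (T := T) (y := y1) (y' := y2)
      (by have := hK _ h1; have := hK _ h2; omega)
    exact PathIn.two h subset_rfl subset_rfl h1 h2 hne ht g1 g2
  | succ p hp ih =>
    obtain ⟨l, hl, hlen, hw⟩ := ih (by omega) (by omega)
    obtain ⟨c1, c2⟩ := h.card_inter hl hw h1 hlen
    obtain ⟨x, hx, hxl⟩ : ∃ x ∈ Y, x ∉ l := by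
      by_contra! hc
      have : Y ⊆ Y ∩ l.toFinset := fun y hy => by simp [hy, hc y hy]
      have := Finset.card_le_card this
      omega
    rcases hl.grow h hw h2 hlen hx hxl with hgoal | ⟨hs1, hs2, hs3, hs4⟩
    · exact hgoal
    set S := nb r x (T ∩ l.toFinset) with hS
    set T' := T \ l.toFinset with hT'
    have hT'c : T'.card + (T ∩ l.toFinset).card = T.card := by
      rw [hT']; exact Finset.card_sdiff_add_card_inter _ _
    have memS : ∀ t, t ∈ S ↔ (t ∈ T ∧ t ∈ l) ∧ r x t := by simp [hS]
    have hxN : (nb r x T).card = S.card + (nb r x T').card := by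
      rw [← Finset.card_union_of_disjoint]
      · congr 1
        ext t
        simp [memS, hT']
        tauto
      · rw [Finset.disjoint_left]
        intro t
        simp [memS, hT']
        tauto
    have hxK := hK x hx
    rcases S.eq_empty_or_nonempty with hSe | hSn
    · -- all neighbours of `x` are off the path
      have hnx : ∀ t ∈ T, r x t → t ∉ l := by
        intro t ht hxt htl
        have : t ∈ S := (memS t).2 ⟨⟨ht, htl⟩, hxt⟩
        simp [hSe] at this
      obtain ⟨P, Q, e, g1, g2, g3, g4⟩ := hl.split_at hl.head_mem hne
      have hP : P = [y1] := by
        have e1 := g1.head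
        have e2 := g1.last
        obtain ⟨P', rfl⟩ := List.head?_eq_some_iff.1 e1
        rcases eq_or_ne P' [] with rfl | hP'
        · rfl
        · exfalso
          have := g1.nodup
          rw [List.getLast?_cons_of_ne_nil hP'] at e2
          simp at this
          exact this.1 (List.mem_of_getLast? e2)
      subst hP
      generalize l.nextOf y1 = t1 at *
      have ht1 : t1 ∈ T := h.lr g3 h1
      obtain ⟨P', Q', e', k1, k2, k3, k4⟩ := g2.split_at g2.head_mem
        (fun hh => h.ne h2 ht1 hh.symm)
      have hP' : P' = [t1] := by
        have e1 := k1.head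
        have e2 := k1.last
        obtain ⟨P'', rfl⟩ := List.head?_eq_some_iff.1 e1
        rcases eq_or_ne P'' [] with rfl | hP'
        · rfl
        · exfalso
          have := k1.nodup
          rw [List.getLast?_cons_of_ne_nil hP'] at e2
          simp at this
          exact this.1 (List.mem_of_getLast? e2)
      generalize Q.nextOf t1 = y' at *
      subst hP' e' e
      have hy' : y' ∈ Y := h.rl k3 ht1
      obtain ⟨c, hc, hxc, hyc⟩ := exists_common (r := r) (T := T) (y := x) (y' := y')
        (by have := hK _ hy'; omega)
      obtain ⟨c', hc', hxc', hyc'⟩ := exists_common (r := r) (T := T.erase c) (y := x) (y' := y1)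
        (by
          have e3 := Finset.card_erase_of_mem hc
          have e4 : ∀ z, (nb r z T).card ≤ (nb r z (T.erase c)).card + 1 := by
            intro z
            have : nb r z T ⊆ insert c (nb r z (T.erase c)) := by
              intro t; simp; tauto
            exact (Finset.card_le_card this).trans (Finset.card_insert_le _ _)
          have := e4 x
          have := e4 y1
          have := hK _ h1
          omega)
      simp at hc'
      have hcl := hnx c hc hxc
      have hcl' := hnx c' hc'.2 hxc'
      simp at hcl hcl' hxl
      have d1 := h.ne hx hc
      have d2 := h.ne hx hc'.2
      have q1 := k2.cons hcl.2.2 (h.symm hyc)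
      have q2 := q1.cons (w := x) (by simp [hxl, d1]) hxc
      have q3 := q2.cons (w := c') (by simp [hcl', hc'.1, d2.symm]) (h.symm hxc')
      have q4 := q3.cons (w := y1) (by
        have := hl.nodup
        simp at this
        simp [this, Ne.symm hcl.1, Ne.symm hcl'.1, Ne.symm hxl.1]) hyc'
      refine ⟨_, q4, ?_, ?_⟩
      · simp at hlen ⊢
        omega
      · intro w hw'
        simp at hw'
        rcases hw' with rfl | rfl | rfl | rfl | hw'
        · simp [h1]
        · simp [hc']
        · simp [hx]
        · simp [hc]
        · exact hw w (by simp [hw'])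
    · exfalso
      -- pairwise disjoint neighbourhoods off the path
      have hdisj : (S : Set V).PairwiseDisjoint (fun t => nb r (l.nextOf t) T') := by
        intro t ht t' ht' hne'
        have e1 := (memS t).1 ht
        have e2 := (memS t').1 ht'
        refine Finset.disjoint_left.2 ?_
        intro c hc hc'
        simp [hT'] at hc hc'
        exact hs4 t e1.1.1 e1.1.2 t' e2.1.1 e2.1.2 hne' e1.2 e2.2 c hc.1.1 hc.1.2 hc.2 hc'.2
      have hcard := Finset.card_biUnion (fun t ht t' ht' hh => hdisj ht ht' hh)
      have hge : S.card * (K + 1 - p) ≤ (S.biUnion fun t => nb r (l.nextOf t) T').card := by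
        rw [hcard, ← smul_eq_mul]
        refine Finset.card_nsmul_le_sum _ _ _ ?_
        intro t ht
        have e1 := (memS t).1 ht
        have := nb_sdiff_card (S := l.toFinset) (hK _ (hs1 t e1.1.1 e1.1.2).1)
        rw [← hT'] at this
        omega
      have hd2 : Disjoint (nb r x T') (S.biUnion fun t => nb r (l.nextOf t) T') := by
        rw [Finset.disjoint_biUnion_right]
        intro t ht
        have e1 := (memS t).1 ht
        refine Finset.disjoint_left.2 ?_
        intro c hc hc'
        simp [hT'] at hc hc'
        exact hs3 t e1.1.1 e1.1.2 e1.2 c hc.1.1 hc.1.2 hc.2 hc'.2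
      have hle : (nb r x T').card + (S.biUnion fun t => nb r (l.nextOf t) T').card ≤ T'.card := by
        rw [← Finset.card_union_of_disjoint hd2]
        apply Finset.card_le_card
        refine Finset.union_subset nb_subset ?_
        intro c hc
        simp at hc
        obtain ⟨t, _, hc, _⟩ := hc
        exact hc
      have hs : 1 ≤ S.card := hSn.card_pos
      obtain ⟨e, he⟩ : ∃ e, K + 1 - p = e + 1 := ⟨K - p, by omega⟩
      rw [he] at hge
      have : S.card * (e + 1) ≥ S.card + e := by nlinarith
      omega

/-- The path lemma: if each row of `Y` has at least `K` neighbours among at most `2 * K - 2`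
columns, any two rows are joined by a path with `p` rows. -/
lemma Bip.path {A B : Finset V} (h : Bip r A B) {Y T : Finset V} (hY : Y ⊆ A) (hTB : T ⊆ B)
    {K : ℕ} (hK : ∀ y ∈ Y, K ≤ (nb r y T).card)
    (hT : T.card + 2 ≤ 2 * K) {y1 y2 : V} (h1 : y1 ∈ Y) (h2 : y2 ∈ Y) (hne : y1 ≠ y2) {p : ℕ}
    (hp : 2 ≤ p) (hpY : p ≤ Y.card) (hpK : p ≤ K + 1) : PathIn r Y T y1 y2 p :=
  (path_aux (h.rst hY hTB) (fun y hy => by rw [nb_rst hy]; exact hK y hy) hT h1 h2 hne p hp hpY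
    hpK).imp fun _ _ e => e.1

/-- Closing up a path through `q` rows with one further column. -/
lemma Bip.cyc {A B : Finset V} (h : Bip r A B) {Y T : Finset V} (hY : Y ⊆ A) (hTB : T ⊆ B)
    {K : ℕ} (hK : ∀ y ∈ Y, K ≤ (nb r y T).card)
    (hT : T.card + 3 ≤ 2 * K) {p : ℕ} (hp : 2 ≤ p) (hpY : p ≤ Y.card) (hpK : p ≤ K) :
    HamIn r Y T p := by
  obtain ⟨y1, h1, y2, h2, hne⟩ := Finset.one_lt_card.1 (show 1 < Y.card by omega)
  obtain ⟨t, ht, e1, e2⟩ := exists_common (r := r) (T := T) (y := y1) (y' := y2)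
    (by have := hK _ h1; have := hK _ h2; omega)
  have e3 := Finset.card_erase_of_mem ht
  obtain ⟨l, hl, hlen, hw⟩ := h.path (T := T.erase t) (K := K - 1) hY
    ((Finset.erase_subset _ _).trans hTB) (by
      intro y hy
      have := hK y hy
      have : nb r y T ⊆ insert t (nb r y (T.erase t)) := by
        intro t; simp; tauto
      have := (Finset.card_le_card this).trans (Finset.card_insert_le _ _)
      omega) (by omega) h1 h2 hne hp hpY (by omega)
  refine ⟨l ++ [t], hl.join (IsPth.single t) ?_ e2 (h.symm e1), by simp; omega, ?_⟩
  · simp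
    intro htl
    have := hw t htl
    simp at this
    exact Finset.disjoint_left.1 h.disj (hY this) (hTB ht)
  · intro w hw'
    simp at hw'
    rcases hw' with hw' | rfl
    · have := hw w hw'
      simp at this ⊢
      tauto
    · simp [ht]

end Paths

section Closure

variable {V : Type} {r : V → V → Prop}

lemma HasCyc.imp {r' : V → V → Prop} {n : ℕ} (h : HasCyc r n) (hr : ∀ u v, r u v → r' u v) :
    HasCyc r' n := by
  obtain ⟨l, h1, h2⟩ := h
  exact ⟨l, h1.mono hr, h2⟩

lemma IsCyc.reverse {l : List V} (hs : ∀ {a b}, r a b → r b a) (h : IsCyc r l) :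
    IsCyc r l.reverse := by
  refine ⟨List.nodup_reverse.2 h.nodup, ?_, ?_⟩
  · rw [List.isChain_reverse]
    exact h.chain.imp fun _ _ e => hs e
  · intro u hu v hv
    simp at hu hv
    exact hs (h.close v hv u hu)

lemma isChain_or_split {s : V → V → Prop} {l : List V} :
    l.IsChain s ∨ ∃ P Q a b, l = P ++ Q ∧ P.getLast? = some a ∧ Q.head? = some b ∧ ¬ s a b := by
  induction l with
  | nil => simp
  | cons a l ih =>
    cases l with
    | nil => simp
    | cons b l =>
      by_cases hab : s a b
      · rcases ih with ih | ⟨P, Q, c, d, e, h1, h2, h3⟩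
        · left
          simp [hab, ih]
        · right
          refine ⟨a :: P, Q, c, d, by simp [e], ?_, h2, h3⟩
          rw [List.getLast?_cons, h1]
          simp
      · right
        exact ⟨[a], b :: l, a, b, by simp, by simp, by simp, hab⟩

variable [DecidableEq V]

lemma HamIn.hasCyc {Y T : Finset V} {n : ℕ} (h : HamIn r Y T n) : HasCyc r (2 * n) := by
  obtain ⟨l, h1, h2, _⟩ := h
  exact ⟨l, h1, h2⟩

lemma IsPth.nextOf_inj {u v t t' : V} {l : List V} (hl : IsPth r u v l) (ht : t ∈ l) (hv : t ≠ v)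
    (ht' : t' ∈ l) (hv' : t' ≠ v) (e : l.nextOf t = l.nextOf t') : t = t' := by
  by_contra hc
  rcases hl.split_two ht hv ht' hv' hc with
    ⟨P, M, Q, e', h1, h2, h3, h4, h5, h6⟩ | ⟨P, M, Q, e', h1, h2, h3, h4, h5, h6⟩
  · exact h6 h2.head_mem (e ▸ h3.head_mem)
  · exact h6 h2.head_mem (e ▸ h3.head_mem)

/-- A Hamiltonian path between nonadjacent vertices of large degree sum closes up. -/
lemma IsPth.crossing {Y T : Finset V} (h : Bip r Y T) {l : List V} {u v : V} {n : ℕ}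
    (hl : IsPth r u v l) (hw : ∀ w ∈ l, w ∈ Y ∪ T) (hv : v ∈ T)
    (hYn : Y.card = n) (hTn : T.card = n)
    (hlen : l.length = 2 * n) (hd : n + 1 ≤ (nb r u T).card + (nb r v Y).card) :
    HamIn r Y T n := by
  have hall : l.toFinset = Y ∪ T := by
    apply Finset.eq_of_subset_of_card_le
    · intro w hw'
      exact hw w (by simpa using hw')
    · rw [Finset.card_union_of_disjoint h.disj, List.toFinset_card_of_nodup hl.nodup]
      omega
  have hmem : ∀ w ∈ Y ∪ T, w ∈ l := fun w hw' => by rw [← hall] at hw'; simpa using hw'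
  have hyv : ∀ y ∈ Y, y ≠ v := fun y hy => h.ne hy hv
  have hcard : ((nb r v Y).image l.nextOf).card = (nb r v Y).card := by
    apply Finset.card_image_of_injOn
    intro y hy y' hy' e
    simp at hy hy'
    exact hl.nextOf_inj (hmem y (by simp [hy])) (hyv y hy.1) (hmem y' (by simp [hy']))
      (hyv y' hy'.1) e
  have hsub : (nb r v Y).image l.nextOf ⊆ T := by
    intro t ht
    simp at ht
    obtain ⟨y, ⟨hy, _⟩, rfl⟩ := ht
    obtain ⟨P, Q, e, h1, h2, h3, h4⟩ := hl.split_at (hmem y (by simp [hy])) (hyv y hy)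
    exact h.lr h3 hy
  have hnd : ¬ Disjoint (nb r u T) ((nb r v Y).image l.nextOf) := by
    intro hdj
    have := Finset.card_le_card (Finset.union_subset (nb_subset (r := r) (y := u)) hsub)
    rw [Finset.card_union_of_disjoint hdj] at this
    omega
  rw [Finset.not_disjoint_iff] at hnd
  obtain ⟨t, ht, ht'⟩ := hnd
  simp at ht ht'
  obtain ⟨y, ⟨hy, hvy⟩, rfl⟩ := ht'
  obtain ⟨P, Q, e, h1, h2, h3, h4⟩ := hl.split_at (hmem y (by simp [hy])) (hyv y hy)
  refine ⟨P.reverse ++ Q, (h1.reverse h.symm).join h2 (by simpa using h4) ht.2 hvy, ?_, ?_⟩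
  · rw [e] at hlen
    simpa using hlen
  · intro w hw'
    apply hw
    rw [e]
    simpa using hw'

lemma mm_step {Y T : Finset V} {s : V → V → Prop} (h : Bip s Y T) {u v : V}
    (hv : v ∈ T) {n : ℕ} (hn : 2 ≤ n) (hYn : Y.card = n) (hTn : T.card = n)
    (hd : n + 1 ≤ (nb s u T).card + (nb s v Y).card)
    (hc : HamIn (fun a b => s a b ∨ (a = u ∧ b = v) ∨ (a = v ∧ b = u)) Y T n) :
    HamIn s Y T n := by
  set s' : V → V → Prop := fun a b => s a b ∨ (a = u ∧ b = v) ∨ (a = v ∧ b = u) with hs'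
  have hsymm : ∀ {a b}, s' a b → s' b a := by
    rintro a b (e | e | e)
    · exact Or.inl (h.symm e)
    · exact Or.inr (Or.inr ⟨e.2, e.1⟩)
    · exact Or.inr (Or.inl ⟨e.2, e.1⟩)
  have main : ∀ l : List V, IsCyc s' l → l.length = 2 * n → (∀ w ∈ l, w ∈ Y ∪ T) →
      l.head? = some u → l.getLast? = some v → HamIn s Y T n := by
    intro l hl hlen hw h1 h2
    have hch : l.IsChain s := by
      rw [List.isChain_iff_getElem]
      intro i hi
      have h3 := (List.isChain_iff_getElem.1 hl.chain) i hi
      have h0 : 0 < l.length := by omega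
      have e1 : l[0] = u := by
        rw [List.head?_eq_getElem?, List.getElem?_eq_getElem h0] at h1
        simpa using h1
      have e2 : l[l.length - 1] = v := by
        rw [List.getLast?_eq_getElem?, List.getElem?_eq_getElem (by omega)] at h2
        simpa using h2
      rcases h3 with h3 | ⟨h3, h4⟩ | ⟨h3, h4⟩
      · exact h3
      · exfalso
        have a1 := (List.Nodup.getElem_inj_iff hl.nodup).1 (h3.trans e1.symm)
        have a2 := (List.Nodup.getElem_inj_iff hl.nodup).1 (h4.trans e2.symm)
        omega
      · exfalso
        have a1 := (List.Nodup.getElem_inj_iff hl.nodup).1 (h3.trans e2.symm)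
        omega
    exact IsPth.crossing h ⟨hl.nodup, hch, h1, h2⟩ hw hv hYn hTn hlen hd
  have main2 : ∀ l : List V, IsCyc s' l → l.length = 2 * n → (∀ w ∈ l, w ∈ Y ∪ T) →
      ∀ a b, l.head? = some b → l.getLast? = some a → ¬ s a b → HamIn s Y T n := by
    intro l hl hlen hw a b h1 h2 h3
    have h4 := hl.close a h2 b h1
    rcases h4 with h4 | ⟨rfl, rfl⟩ | ⟨rfl, rfl⟩
    · exact absurd h4 h3
    · exact main l.reverse (hl.reverse hsymm) (by simpa using hlen) (by simpa using hw)
        (by simpa using h2) (by simpa using h1)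
    · exact main l hl hlen hw h1 h2
  obtain ⟨l, hl, hlen, hw⟩ := hc
  by_cases hs : IsCyc s l
  · exact ⟨l, hs, hlen, hw⟩
  rcases isChain_or_split (s := s) (l := l) with hch | ⟨P, Q, a, b, rfl, h1, h2, h3⟩
  · have : ∃ a ∈ l.getLast?, ∃ b ∈ l.head?, ¬ s a b := by
      by_contra! hcon
      exact hs ⟨hl.nodup, hch, hcon⟩
    obtain ⟨a, ha, b, hb, hab⟩ := this
    exact main2 l hl hlen hw a b hb ha hab
  · refine main2 (Q ++ P) hl.rotate ?_ ?_ a b ?_ ?_ h3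
    · simp at hlen ⊢
      omega
    · intro w hw'
      apply hw
      simp at hw' ⊢
      tauto
    · rw [List.head?_append_of_ne_nil, h2]
      rintro rfl
      simp at h2
    · rw [List.getLast?_append_of_ne_nil, h1]
      rintro rfl
      simp at h1

/-- The bipartite closure lemma: edges between vertices of large degree sum may be added without
creating the first Hamiltonian cycle. -/
lemma Bip.closure {A B Y T : Finset V} (h : Bip r A B) (hY : Y ⊆ A) (hT : T ⊆ B)
    {r' : V → V → Prop} (h' : ∀ u v, r' u v → r' v u) {n : ℕ} (hn : 2 ≤ n) (hYn : Y.card = n)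
    (hTn : T.card = n)
    (hd : ∀ y ∈ Y, ∀ t ∈ T, r' y t → r y t ∨ n + 1 ≤ (nb r y T).card + (nb r t Y).card)
    (hc : HamIn (Rst r' Y T) Y T n) : HamIn r Y T n := by
  classical
  have hb := h.rst hY hT
  have hdj := hb.disj
  set F := (Y ×ˢ T).filter (fun p => r' p.1 p.2 ∧ ¬ r p.1 p.2) with hF
  have key : ∀ G : Finset (V × V), G ⊆ F →
      HamIn (fun a b => Rst r Y T a b ∨ (a, b) ∈ G ∨ (b, a) ∈ G) Y T n →
      HamIn (Rst r Y T) Y T n := by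
    intro G
    induction G using Finset.induction_on with
    | empty =>
      intro _ hG
      obtain ⟨l, h1, h2, h3⟩ := hG
      exact ⟨l, h1.mono (by simp), h2, h3⟩
    | insert p G hp ih =>
      intro hsub hG
      have hGF : G ⊆ F := (Finset.subset_insert _ _).trans hsub
      apply ih hGF
      have hpF := hsub (Finset.mem_insert_self _ _)
      simp [hF] at hpF
      have hmemG : ∀ q ∈ G, q.1 ∈ Y ∧ q.2 ∈ T := by
        intro q hq
        have := hGF hq
        simp [hF] at this
        exact this.1
      refine mm_step (u := p.1) (v := p.2) ?_ hpF.1.2 hn hYn hTn ?_ ?_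
      · refine ⟨hdj, ?_, ?_, ?_⟩
        · rintro u v (e | e | e)
          · exact Or.inl (hb.symm e)
          · exact Or.inr (Or.inr e)
          · exact Or.inr (Or.inl e)
        · rintro u v (e | e | e) hu
          · exact hb.lr e hu
          · exact (hmemG _ e).2
          · exact absurd (hmemG _ e).2 (Finset.disjoint_left.1 hdj hu)
        · rintro u v (e | e | e) hu
          · exact hb.rl e hu
          · exact absurd hu (Finset.disjoint_left.1 hdj (hmemG _ e).1)
          · exact (hmemG _ e).1
      · have := (hd _ hpF.1.1 _ hpF.1.2 hpF.2.1).resolve_left hpF.2.2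
        refine this.trans (add_le_add (Finset.card_le_card ?_) (Finset.card_le_card ?_))
        · intro t ht
          simp [Rst] at ht ⊢
          tauto
        · intro t ht
          simp [Rst] at ht ⊢
          tauto
      · obtain ⟨l, h1, h2, h3⟩ := hG
        refine ⟨l, h1.mono ?_, h2, h3⟩
        rintro a b (e | e | e)
        · exact Or.inl (Or.inl e)
        · rw [Finset.mem_insert] at e
          rcases e with e | e
          · right; left; rw [← e]; exact ⟨rfl, rfl⟩
          · exact Or.inl (Or.inr (Or.inl e))
        · rw [Finset.mem_insert] at e
          rcases e with e | e
          · right; right; rw [← e]; exact ⟨rfl, rfl⟩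
          · exact Or.inl (Or.inr (Or.inr e))
  have : HamIn (Rst r Y T) Y T n := by
    apply key F subset_rfl
    obtain ⟨l, h1, h2, h3⟩ := hc
    refine ⟨l, h1.mono ?_, h2, h3⟩
    rintro a b ⟨e, h4⟩
    by_cases hab : r a b
    · exact Or.inl ⟨hab, h4⟩
    right
    rcases h4 with h4 | h4
    · left
      simp [hF, h4, e, hab]
    · right
      simp [hF, h4, h' _ _ e]
      intro hh
      exact hab (h.symm hh)
  obtain ⟨l, h1, h2, h3⟩ := this
  exact ⟨l, h1.mono fun _ _ e => e.1, h2, h3⟩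

end Closure

section Consequences

variable {V : Type} {r : V → V → Prop}

lemma nb_eq_of_forall {y : V} {T : Finset V} (h : ∀ t ∈ T, r y t) : nb r y T = T := by
  ext t
  simp
  exact fun ht => h t ht

lemma nb_mono {y : V} {T T' : Finset V} (h : T ⊆ T') : nb r y T ⊆ nb r y T' := by
  intro t
  simp
  exact fun ht e => ⟨h ht, e⟩

variable [DecidableEq V]

lemma Bip.ham_complete {A B Y T : Finset V} (h : Bip r A B) (hY : Y ⊆ A) (hT : T ⊆ B) {n : ℕ}
    (hn : 3 ≤ n) (hYn : n ≤ Y.card) (hTn : T.card = n) (hc : ∀ y ∈ Y, ∀ t ∈ T, r y t) :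
    HamIn r Y T n :=
  h.cyc (K := n) hY hT (fun y hy => by rw [nb_eq_of_forall (hc y hy), hTn]) (by omega) (by omega)
    hYn le_rfl

/-- A special case of the closure lemma: a Hamiltonian cycle exists as soon as all nonadjacent pairs
have large degree sum. -/
lemma Bip.ham_of_degree {A B Y T : Finset V} (h : Bip r A B) (hY : Y ⊆ A) (hT : T ⊆ B) {n : ℕ}
    (hn : 3 ≤ n) (hYn : Y.card = n) (hTn : T.card = n)
    (hd : ∀ y ∈ Y, ∀ t ∈ T, r y t ∨ n + 1 ≤ (nb r y T).card + (nb r t Y).card) :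
    HamIn r Y T n := by
  set r' : V → V → Prop := fun u v => u ∈ Y ∧ v ∈ T ∨ u ∈ T ∧ v ∈ Y with hr'
  have hb := h.rst hY hT
  have hb' : Bip (Rst r' Y T) Y T := by
    refine ⟨hb.disj, ?_, ?_, ?_⟩
    · rintro u v ⟨e, h1⟩
      exact ⟨by simp [hr'] at e ⊢; tauto, by tauto⟩
    · rintro u v ⟨e, h1⟩ hu
      have := Finset.disjoint_left.1 hb.disj hu
      tauto
    · rintro u v ⟨e, h1⟩ hu
      have := Finset.disjoint_right.1 hb.disj hu
      tauto
  refine h.closure hY hT (r' := r') ?_ (by omega) hYn hTn ?_ ?_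
  · intro u v e
    simp [hr'] at e ⊢
    tauto
  · intro y hy t ht _
    exact hd y hy t ht
  · refine hb'.ham_complete subset_rfl subset_rfl hn hYn.ge hTn ?_
    intro y hy t ht
    exact ⟨Or.inl ⟨hy, ht⟩, Or.inl ⟨hy, ht⟩⟩

/-- All but one row complete, the remaining row with two neighbours. -/
lemma Bip.ham_one_extra {A B Y T : Finset V} (h : Bip r A B) (hY : Y ⊆ A) (hT : T ⊆ B) {n : ℕ}
    (hn : 3 ≤ n) (hYn : Y.card + 1 = n) (hTn : T.card = n) (hc : ∀ y ∈ Y, ∀ t ∈ T, r y t)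
    {z : V} (hz : z ∈ A) (hzY : z ∉ Y) (hzd : 2 ≤ (nb r z T).card) :
    HasCyc r (2 * n) := by
  refine (h.ham_of_degree (Y := insert z Y) (T := T) (n := n) ?_ hT hn
    (by rw [Finset.card_insert_of_notMem hzY]; omega) hTn ?_).hasCyc
  · exact Finset.insert_subset hz hY
  · intro y hy t ht
    rw [Finset.mem_insert] at hy
    rcases hy with rfl | hy
    · right
      have : Y ⊆ nb r t (insert y Y) := by
        intro w hw
        simp [hw, h.symm (hc w hw t ht)]
      have := Finset.card_le_card this
      omega
    · exact Or.inl (hc y hy t ht)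

/-- All rows miss at most one column, and each column has two neighbours. -/
lemma Bip.ham_miss_one {A B Y T : Finset V} (h : Bip r A B) (hY : Y ⊆ A) (hT : T ⊆ B) {n : ℕ}
    (hn : 3 ≤ n) (hYn : Y.card = n) (hTn : T.card = n)
    (hrow : ∀ y ∈ Y, n ≤ (nb r y T).card + 1) (hcol : ∀ t ∈ T, 2 ≤ (nb r t Y).card) :
    HasCyc r (2 * n) := by
  refine (h.ham_of_degree hY hT hn hYn hTn ?_).hasCyc
  intro y hy t ht
  have := hrow y hy
  have := hcol t ht
  omega

/-- All but two rows complete, and the two remaining rows have at least two neighbours each and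
three neighbours together. -/
lemma Bip.ham_two_extra {A B Y T : Finset V} (h : Bip r A B) (hY : Y ⊆ A) (hT : T ⊆ B) {n : ℕ}
    (hn : 3 ≤ n) (hYn : Y.card + 2 = n) (hTn : T.card = n) (hc : ∀ y ∈ Y, ∀ t ∈ T, r y t)
    {z z' : V} (hz : z ∈ A) (hz' : z' ∈ A) (hzY : z ∉ Y) (hzY' : z' ∉ Y) (hne : z ≠ z')
    (hzd : 2 ≤ (nb r z T).card) (hzd' : 2 ≤ (nb r z' T).card)
    (hu : 3 ≤ (nb r z T ∪ nb r z' T).card) : HasCyc r (2 * n) := by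
  set Y2 := insert z (insert z' Y) with hY2
  have hY2A : Y2 ⊆ A := Finset.insert_subset hz (Finset.insert_subset hz' hY)
  have hY2c : Y2.card = n := by
    rw [hY2, Finset.card_insert_of_notMem (by simp [hne, hzY]), Finset.card_insert_of_notMem hzY']
    omega
  have hb := h.rst hY2A hT
  set M := nb r z T ∪ nb r z' T with hM
  set r' : V → V → Prop := fun u v => (Rst r Y2 T) u v ∨ ((u = z ∨ u = z') ∧ v ∈ M) ∨
    ((v = z ∨ v = z') ∧ u ∈ M) with hr'
  have hsymm : ∀ u v, r' u v → r' v u := by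
    rintro u v (e | e | e)
    · exact Or.inl (hb.symm e)
    · exact Or.inr (Or.inr e)
    · exact Or.inr (Or.inl e)
  have hb' : Bip (Rst r' Y2 T) Y2 T := by
    refine ⟨hb.disj, ?_, ?_, ?_⟩
    · rintro u v ⟨e, h1⟩
      exact ⟨hsymm _ _ e, by tauto⟩
    · rintro u v ⟨e, h1⟩ hu
      have := Finset.disjoint_left.1 hb.disj hu
      tauto
    · rintro u v ⟨e, h1⟩ hu
      have := Finset.disjoint_right.1 hb.disj hu
      tauto
  have hcolY : ∀ t ∈ T, n ≤ (nb r t Y2).card + 2 := by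
    intro t ht
    have : Y ⊆ nb r t Y2 := by
      intro w hw
      simp [hY2, hw, h.symm (hc w hw t ht)]
    have := Finset.card_le_card this
    omega
  have hMT : M ⊆ T := Finset.union_subset nb_subset nb_subset
  have hcolM : ∀ t ∈ M, n ≤ (nb r t Y2).card + 1 := by
    intro t ht
    rw [hM, Finset.mem_union, mem_nb, mem_nb] at ht
    rcases ht with ht | ht
    · have : insert z Y ⊆ nb r t Y2 := by
        intro w hw
        simp at hw
        rcases hw with rfl | hw
        · simp [hY2, h.symm ht.2]
        · simp [hY2, hw, h.symm (hc w hw t ht.1)]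
      have := Finset.card_le_card this
      rw [Finset.card_insert_of_notMem hzY] at this
      omega
    · have : insert z' Y ⊆ nb r t Y2 := by
        intro w hw
        simp at hw
        rcases hw with rfl | hw
        · simp [hY2, h.symm ht.2]
        · simp [hY2, hw, h.symm (hc w hw t ht.1)]
      have := Finset.card_le_card this
      rw [Finset.card_insert_of_notMem hzY'] at this
      omega
  refine (h.closure hY2A hT (r' := r') hsymm (by omega) hY2c hTn ?_ ?_).hasCyc
  · intro y hy t ht hyt
    have hzT : ∀ t ∈ T, t ≠ z ∧ t ≠ z' := by
      intro t ht
      constructor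
      · rintro rfl
        exact h.ne hz (hT ht) rfl
      · rintro rfl
        exact h.ne hz' (hT ht) rfl
    rcases hyt with e | ⟨e, e'⟩ | ⟨e, _⟩
    · exact Or.inl e.1
    · right
      have := hcolM t e'
      rcases e with rfl | rfl <;> omega
    · exfalso
      have := hzT t ht
      tauto
  · refine hb'.ham_of_degree subset_rfl subset_rfl hn hY2c hTn ?_
    intro y hy t ht
    by_cases hyY : y ∈ Y
    · left
      exact ⟨Or.inl ⟨hc y hyY t ht, Or.inl ⟨hy, ht⟩⟩, Or.inl ⟨hy, ht⟩⟩
    · right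
      have hyz : y = z ∨ y = z' := by
        simp [hY2] at hy
        tauto
      have h1 : 3 ≤ (nb (Rst r' Y2 T) y T).card := by
        refine hu.trans (Finset.card_le_card ?_)
        intro t ht
        rw [mem_nb]
        exact ⟨hMT ht, Or.inr (Or.inl ⟨hyz, ht⟩), Or.inl ⟨hy, hMT ht⟩⟩
      have h2 : (nb r t Y2).card ≤ (nb (Rst r' Y2 T) t Y2).card := by
        apply Finset.card_le_card
        intro w hw
        rw [mem_nb] at hw ⊢
        exact ⟨hw.1, Or.inl ⟨hw.2, Or.inr ⟨ht, hw.1⟩⟩, Or.inr ⟨ht, hw.1⟩⟩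
      have := hcolY t ht
      omega

/-- A complete square with an extra row and an extra column, each with two neighbours. -/
lemma Bip.ham_row_col {A B Y T : Finset V} (h : Bip r A B) (hY : Y ⊆ A) (hT : T ⊆ B) {n : ℕ}
    (hn : 3 ≤ n) (hYn : Y.card + 1 = n) (hTn : T.card + 1 = n) (hc : ∀ y ∈ Y, ∀ t ∈ T, r y t)
    {u z : V} (hu : u ∈ A) (hz : z ∈ B) (huY : u ∉ Y) (hzT : z ∉ T)
    (hud : 2 ≤ (nb r u (insert z T)).card) (hzd : 2 ≤ (nb r z Y).card) : HasCyc r (2 * n) := by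
  set Y2 := insert u Y with hY2
  set T2 := insert z T with hT2
  have hY2A : Y2 ⊆ A := Finset.insert_subset hu hY
  have hT2B : T2 ⊆ B := Finset.insert_subset hz hT
  have hY2c : Y2.card = n := by
    rw [hY2, Finset.card_insert_of_notMem huY]
    omega
  have hT2c : T2.card = n := by
    rw [hT2, Finset.card_insert_of_notMem hzT]
    omega
  have hb := h.rst hY2A hT2B
  set r' : V → V → Prop := fun a b => ¬ (a = u ∧ b = z) ∧ ¬ (a = z ∧ b = u) with hr'
  have hsymm : ∀ u v, r' u v → r' v u := by
    rintro u v e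
    simp [hr'] at e ⊢
    tauto
  have hb' : Bip (Rst r' Y2 T2) Y2 T2 := by
    refine ⟨hb.disj, ?_, ?_, ?_⟩
    · rintro u v ⟨e, h1⟩
      exact ⟨hsymm _ _ e, by tauto⟩
    · rintro u v ⟨e, h1⟩ hu
      have := Finset.disjoint_left.1 hb.disj hu
      tauto
    · rintro u v ⟨e, h1⟩ hu
      have := Finset.disjoint_right.1 hb.disj hu
      tauto
  have hdisj : ∀ w, w ∈ Y2 → w ∉ T2 := fun w hw => Finset.disjoint_left.1 hb.disj hw
  refine (h.closure hY2A hT2B (r' := r') hsymm (by omega) hY2c hT2c ?_ ?_).hasCyc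
  · intro y hy t ht hyt
    rw [hY2, Finset.mem_insert] at hy
    rw [hT2, Finset.mem_insert] at ht
    rcases hy with rfl | hy
    · rcases ht with rfl | ht
      · exact absurd ⟨rfl, rfl⟩ hyt.1
      · right
        have : Y ⊆ nb r t Y2 := by
          intro w hw
          simp [hY2, hw, h.symm (hc w hw t ht)]
        have := Finset.card_le_card this
        omega
    · rcases ht with rfl | ht
      · right
        have h1 : T ⊆ nb r y T2 := by
          intro w hw
          simp [hT2, hw, (hc y hy w hw)]
        have h2 := Finset.card_le_card h1
        have h3 := Finset.card_le_card (nb_mono (r := r) (y := t) (Finset.subset_insert u Y))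
        rw [← hY2] at h3
        omega
      · exact Or.inl (hc y hy t ht)
  · refine hb'.ham_of_degree subset_rfl subset_rfl hn hY2c hT2c ?_
    intro y hy t ht
    by_cases hyt : y = u ∧ t = z
    · right
      obtain ⟨rfl, rfl⟩ := hyt
      have h1 : T ⊆ nb (Rst r' Y2 T2) y T2 := by
        intro w hw
        have hw2 : w ∈ T2 := by simp [hT2, hw]
        rw [mem_nb]
        refine ⟨hw2, ⟨?_, ?_⟩, Or.inl ⟨hy, hw2⟩⟩
        · rintro ⟨_, rfl⟩
          exact hzT hw
        · rintro ⟨rfl, _⟩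
          exact hdisj _ hy ht
      have h2 : Y ⊆ nb (Rst r' Y2 T2) t Y2 := by
        intro w hw
        have hw2 : w ∈ Y2 := by simp [hY2, hw]
        rw [mem_nb]
        refine ⟨hw2, ⟨?_, ?_⟩, Or.inr ⟨ht, hw2⟩⟩
        · rintro ⟨rfl, _⟩
          exact hdisj _ hy ht
        · rintro ⟨_, rfl⟩
          exact huY hw
      have := Finset.card_le_card h1
      have := Finset.card_le_card h2
      omega
    · left
      refine ⟨⟨hyt, ?_⟩, Or.inl ⟨hy, ht⟩⟩
      rintro ⟨rfl, rfl⟩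
      exact hdisj _ hy (by simp [hT2])

end Consequences

/-- A red-blue coloured complete bipartite graph with a red cycle `c` of length `2 * k` (with period
`2 * k`, even positions in `B`) and no red cycle of length `2 * k + 2`; the vertices off the cycle
are `X ⊆ A` and `Y ⊆ B`. -/
structure Setup {V : Type} (r bl : V → V → Prop) (A B X Y : Finset V) (k : ℕ) (c : ℕ → V) :
    Prop where
  rb : Bip r A B
  bb : Bip bl A B
  tot : ∀ a ∈ A, ∀ b ∈ B, r a b ∨ bl a b
  kpos : 2 ≤ k
  per : ∀ i, c (i + 2 * k) = c i
  inj : ∀ i < 2 * k, ∀ j < 2 * k, c i = c j → i = j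
  adj : ∀ i, r (c i) (c (i + 1))
  even : ∀ i, c (2 * i) ∈ B
  odd : ∀ i, c (2 * i + 1) ∈ A
  XA : X ⊆ A
  YB : Y ⊆ B
  Xoff : ∀ x ∈ X, ∀ i, c i ≠ x
  Yoff : ∀ y ∈ Y, ∀ i, c i ≠ y
  AX : ∀ a ∈ A, a ∈ X ∨ ∃ i, c i = a
  BY : ∀ b ∈ B, b ∈ Y ∨ ∃ i, c i = b
  nored : ¬ HasCyc r (2 * k + 2)
  excl : ∀ {u v}, r u v → ¬ bl u v

/-- The cycle vertices in even positions. -/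
def evens {V : Type} [DecidableEq V] (k : ℕ) (c : ℕ → V) : Finset V :=
  (Finset.range k).image fun i => c (2 * i)

/-- The successors on the cycle of the even neighbours of `x`. -/
noncomputable def succs {V : Type} [DecidableEq V] (r : V → V → Prop) (k : ℕ) (c : ℕ → V) (x : V) :
    Finset V :=
  open scoped Classical in
  ((Finset.range k).filter fun i => r x (c (2 * i))).image fun i => c (2 * i + 1)

/-- The predecessors on the cycle of the even neighbours of `x`. -/
noncomputable def preds {V : Type} [DecidableEq V] (r : V → V → Prop) (k : ℕ) (c : ℕ → V) (x : V) :
    Finset V :=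
  open scoped Classical in
  ((Finset.range k).filter fun i => r x (c (2 * i + 2))).image fun i => c (2 * i + 1)

namespace Setup

section Defs

variable {V : Type} {r bl : V → V → Prop} {A B X Y : Finset V} {k : ℕ}
  {c : ℕ → V}

lemma swap (h : Setup r bl A B X Y k c) : Setup r bl B A Y X k (fun i => c (i + 1)) where
  rb := h.rb.swap
  bb := h.bb.swap
  tot a ha b hb := (h.tot b hb a ha).imp h.rb.symm h.bb.symm
  kpos := h.kpos
  per i := by rw [show i + 2 * k + 1 = i + 1 + 2 * k by omega, h.per]
  inj i hi j hj e := by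
    have hk := h.kpos
    have key : ∀ i, i < 2 * k → ∃ i' < 2 * k, c (i + 1) = c i' ∧
        (i' = i + 1 ∨ (i' = 0 ∧ i + 1 = 2 * k)) := by
      intro i hi
      rcases Nat.lt_or_ge (i + 1) (2 * k) with h1 | h1
      · exact ⟨i + 1, h1, rfl, Or.inl rfl⟩
      · refine ⟨0, by omega, ?_, Or.inr ⟨rfl, by omega⟩⟩
        have := h.per 0
        rw [← this]
        congr 1
        omega
    obtain ⟨i', hi', e1, h1⟩ := key i hi
    obtain ⟨j', hj', e2, h2⟩ := key j hj
    have := h.inj i' hi' j' hj' (by rw [← e1, ← e2]; exact e)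
    omega
  adj i := h.adj (i + 1)
  even i := h.odd i
  odd i := h.even (i + 1)
  XA := h.YB
  YB := h.XA
  Xoff x hx i := h.Yoff x hx _
  Yoff x hx i := h.Xoff x hx _
  AX b hb := by
    rcases h.BY b hb with h1 | ⟨i, h1⟩
    · exact Or.inl h1
    · right
      have := h.kpos
      refine ⟨i + (2 * k - 1), ?_⟩
      rw [show i + (2 * k - 1) + 1 = i + 2 * k by omega, h.per, h1]
  BY b hb := by
    rcases h.AX b hb with h1 | ⟨i, h1⟩
    · exact Or.inl h1
    · right
      have := h.kpos
      refine ⟨i + (2 * k - 1), ?_⟩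
      rw [show i + (2 * k - 1) + 1 = i + 2 * k by omega, h.per, h1]
  nored := h.nored
  excl := h.excl

lemma per_mul (h : Setup r bl A B X Y k c) (i j : ℕ) : c (i + j * (2 * k)) = c i := by
  induction j with
  | zero => simp
  | succ j ih => rw [Nat.succ_mul, ← add_assoc, h.per, ih]

lemma mod (h : Setup r bl A B X Y k c) (i : ℕ) : c (i % (2 * k)) = c i := by
  conv_rhs => rw [← Nat.mod_add_div' i (2 * k)]
  rw [h.per_mul]

lemma eq_iff (h : Setup r bl A B X Y k c) {i j : ℕ} : c i = c j ↔ i % (2 * k) = j % (2 * k) := by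
  have hk : 0 < 2 * k := by have := h.kpos; omega
  constructor
  · intro e
    rw [← h.mod i, ← h.mod j] at e
    exact h.inj _ (Nat.mod_lt _ hk) _ (Nat.mod_lt _ hk) e
  · intro e
    rw [← h.mod i, ← h.mod j, e]

lemma inj_near (h : Setup r bl A B X Y k c) {i j : ℕ} (e : c i = c j) (h1 : i ≤ j)
    (h2 : j < i + 2 * k) : i = j := by
  rw [h.eq_iff] at e
  have h3 : j - i < 2 * k := by omega
  have h4 : (j - i) % (2 * k) = 0 := Nat.sub_mod_eq_zero_of_mod_eq e.symm
  rw [Nat.mod_eq_of_lt h3] at h4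
  omega

/-- Every cycle vertex occurs in any window of length `2 * k`. -/
lemma exists_window (h : Setup r bl A B X Y k c) (i j : ℕ) : ∃ t < 2 * k, c (i + t) = c j := by
  have hk : 0 < 2 * k := by have := h.kpos; omega
  refine ⟨(j + i * (2 * k) - i) % (2 * k), Nat.mod_lt _ hk, ?_⟩
  have h0 : i ≤ i * (2 * k) := Nat.le_mul_of_pos_right _ hk
  rw [h.eq_iff, Nat.add_mod_mod, show i + (j + i * (2 * k) - i) = j + i * (2 * k) by omega]
  simp

lemma arc (h : Setup r bl A B X Y k c) (i l : ℕ) (h1 : 1 ≤ l) (h2 : l ≤ 2 * k) :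
    IsPth r (c i) (c (i + l - 1)) ((List.range l).map fun j => c (i + j)) := by
  refine ⟨?_, ?_, ?_, ?_⟩
  · refine List.Nodup.map_on ?_ List.nodup_range
    intro a ha b hb e
    simp at ha hb
    rcases le_total a b with hab | hab
    · have := h.inj_near e (by omega) (by omega)
      omega
    · have := h.inj_near e.symm (by omega) (by omega)
      omega
  · rw [List.isChain_iff_getElem]
    intro a ha
    simp
    exact h.adj _
  · obtain ⟨l, rfl⟩ : ∃ m, l = m + 1 := ⟨l - 1, by omega⟩
    simp [List.range_succ_eq_map]
  · obtain ⟨l, rfl⟩ : ∃ m, l = m + 1 := ⟨l - 1, by omega⟩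
    simp [List.range_succ]

lemma ne_of_off {x : V} (hx : ∀ i, c i ≠ x) (l i : ℕ) :
    x ∉ ((List.range l).map fun j => c (i + j)) := by
  intro hh
  simp at hh
  obtain ⟨a, _, ha⟩ := hh
  exact hx _ ha

/-- A red path off the cycle that closes an arc to a cycle of length `2 * k + 2` is impossible. -/
lemma no_arc (h : Setup r bl A B X Y k c) {i l : ℕ} (h1 : 1 ≤ l) (h2 : l ≤ 2 * k) {L : List V}
    {u v : V} (hL : IsPth r u v L)
    (hoff : ∀ w ∈ L, ∀ j, c j ≠ w) (hlen : L.length + l = 2 * k + 2) (e1 : r u (c (i + l - 1)))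
    (e2 : r v (c i)) : False := by
  apply h.nored
  refine ⟨_, (h.arc i l h1 h2).join hL ?_ (h.rb.symm e1) e2, by simp; omega⟩
  intro w hw hwL
  exact ne_of_off (hoff w hwL) l i hw

lemma no_cross (h : Setup r bl A B X Y k c) {x y : V} (hx : ∀ i, c i ≠ x) (hy : ∀ i, c i ≠ y)
    (hxy : x ≠ y) {i j : ℕ}
    (h1 : r x (c i)) (h2 : r x (c j)) (h3 : r y (c (i + 1))) (h4 : r y (c (j + 1))) :
    c i = c j := by
  obtain ⟨t, ht, e⟩ := h.exists_window i j
  rcases Nat.eq_zero_or_pos t with rfl | ht0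
  · simpa using e
  have e' : c (i + t + 1) = c (j + 1) := by
    rw [h.eq_iff] at e ⊢
    rw [Nat.add_mod, e, ← Nat.add_mod]
  exfalso
  apply h.nored
  have p1 := (h.arc (i + 1) t ht0 (by omega)).append (IsPth.single x)
    (by simpa using ne_of_off hx t (i + 1))
    (by rw [show i + 1 + t - 1 = i + t by omega, e]; exact h.rb.symm h2)
  have p2 := ((h.arc (i + t + 1) (2 * k - t) (by omega) (by omega)).reverse h.rb.symm).append
    (IsPth.single y) (by simpa using ne_of_off hy (2 * k - t) (i + t + 1))
    (by rw [e']; exact h.rb.symm h4)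
  refine ⟨_, p1.join p2 ?_ ?_ h3, by simp; omega⟩
  · intro w hw hw'
    simp only [List.mem_append, List.mem_reverse, List.mem_singleton] at hw hw'
    rcases hw with hw | rfl
    · rcases hw' with hw' | rfl
      · simp at hw hw'
        obtain ⟨a, ha, rfl⟩ := hw
        obtain ⟨b, hb, eb⟩ := hw'
        have := h.inj_near eb.symm (by omega) (by omega)
        omega
      · exact ne_of_off hy _ _ hw
    · rcases hw' with hw' | rfl
      · exact ne_of_off hx _ _ hw'
      · exact hxy rfl
  · rw [show i + t + 1 + (2 * k - t) - 1 = i + 2 * k by omega, h.per]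
    exact h1

lemma no_edge (h : Setup r bl A B X Y k c) {x y : V} (hx : ∀ i, c i ≠ x) (hy : ∀ i, c i ≠ y)
    (hxy : x ≠ y) {i : ℕ}
    (h0 : r x y) (h1 : r x (c i)) : ¬ r y (c (i + 1)) := by
  intro h2
  refine h.no_arc (i := i + 1) (l := 2 * k) (by have := h.kpos; omega) le_rfl
    ((IsPth.single y).cons (w := x) (by simpa using hxy) h0) ?_ (by simp; omega) ?_ h2
  · simp [hx, hy]
  · rw [show i + 1 + 2 * k - 1 = i + 2 * k by omega, h.per]
    exact h1

lemma no_cherry (h : Setup r bl A B X Y k c) {x x' y : V} (hx : ∀ i, c i ≠ x) (hx' : ∀ i, c i ≠ x')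
    (hy : ∀ i, c i ≠ y)
    (hxx : x ≠ x') (hxy : x ≠ y) (hxy' : x' ≠ y) {i : ℕ} (h0 : r x y) (h0' : r x' y)
    (h1 : r x (c i)) : ¬ r x' (c (i + 2)) := by
  intro h2
  have hk := h.kpos
  refine h.no_arc (i := i + 2) (l := 2 * k - 1) (by omega) (by omega)
    (((IsPth.single x').cons (w := y) (by simpa using hxy'.symm) (h.rb.symm h0')).cons (w := x)
      (by simp [hxx, hxy]) h0) ?_ (by simp; omega) ?_ h2
  · simp [hx, hy, hx']
  · rw [show i + 2 + (2 * k - 1) - 1 = i + 2 * k by omega, h.per]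
    exact h1

end Defs

end Setup

section Stars

variable {V : Type} [DecidableEq V]

/-- The rows that are compatible with `y` under a partial matching. -/
lemma exists_matched (m : V → V → Prop) (hs : ∀ a b, m a b → m b a)
    (hu : ∀ a b c, m a b → m a c → b = c) (y : V) :
    ∃ D : Finset V, D.card ≤ 2 ∧ y ∈ D ∧ ∀ a ∈ D, ∀ b, (a = b ∨ m a b) → b ∈ D := by
  by_cases hz : ∃ z, m y z
  · obtain ⟨z, hz⟩ := hz
    refine ⟨{y, z}, Finset.card_le_two, by simp, ?_⟩
    intro a ha b hb
    simp at ha ⊢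
    rcases ha with rfl | rfl
    · rcases hb with rfl | hb
      · simp
      · right; exact hu _ _ _ hb hz
    · rcases hb with rfl | hb
      · simp
      · left; exact hu _ _ _ hb (hs _ _ hz)
  · refine ⟨{y}, by simp, by simp, ?_⟩
    intro a ha b hb
    simp at ha ⊢
    subst ha
    rcases hb with rfl | hb
    · rfl
    · exact absurd ⟨b, hb⟩ hz

/-- If any two disjoint edges of `E` are matched on one side, then two vertices on one
side cover `E`. -/
lemma cover_two (E : V → V → Prop) (m m' : V → V → Prop) (hs : ∀ a b, m a b → m b a)
    (hu : ∀ a b c, m a b → m a c → b = c) (hs' : ∀ a b, m' a b → m' b a)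
    (hu' : ∀ a b c, m' a b → m' a c → b = c)
    (hE : ∀ x x' y y', x ≠ x' → y ≠ y' → E x y → E x' y' → m x x' ∨ m' y y') :
    (∃ W : Finset V, W.card ≤ 2 ∧ ∀ x y, E x y → x ∈ W) ∨
      ∃ W : Finset V, W.card ≤ 2 ∧ ∀ x y, E x y → y ∈ W := by
  by_cases h3 : ∃ x1 x2 x3 y1 y2 y3, x1 ≠ x2 ∧ x1 ≠ x3 ∧ x2 ≠ x3 ∧ E x1 y1 ∧ E x2 y2 ∧ E x3 y3
  · right
    have h4 : ∃ x1 x2 x3 y1 y2 y3, x1 ≠ x2 ∧ x1 ≠ x3 ∧ x2 ≠ x3 ∧ E x1 y1 ∧ E x2 y2 ∧ E x3 y3 ∧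
        ¬ m x1 x2 ∧ ¬ m x1 x3 := by
      obtain ⟨x1, x2, x3, y1, y2, y3, a, b, c, d, e, f⟩ := h3
      by_cases m1 : m x1 x2
      · exact ⟨x3, x1, x2, y3, y1, y2, b.symm, c.symm, a, f, d, e,
          fun hh => c (hu _ _ _ m1 (hs _ _ hh)),
          fun hh => b (hu _ _ _ (hs _ _ m1) (hs _ _ hh))⟩
      by_cases m2 : m x1 x3
      · refine ⟨x2, x1, x3, y2, y1, y3, a.symm, c, b, e, d, f, fun hh => m1 (hs _ _ hh),
          fun hh => a (hu _ _ _ (hs _ _ m2) (hs _ _ hh))⟩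
      · exact ⟨x1, x2, x3, y1, y2, y3, a, b, c, d, e, f, m1, m2⟩
    obtain ⟨x1, x2, x3, y1, y2, y3, a, b, c, d, e, f, m1, m2⟩ := h4
    obtain ⟨D, hD, hy, hcl⟩ := exists_matched m' hs' hu' y1
    have step : ∀ x x' y y', x ≠ x' → ¬ m x x' → E x y → E x' y' → y ∈ D → y' ∈ D := by
      intro x x' y y' hx hm h5 h6 h7
      by_cases hyy : y = y'
      · rwa [← hyy]
      · exact hcl y h7 y' (Or.inr ((hE x x' y y' hx hyy h5 h6).resolve_left hm))
    refine ⟨D, hD, ?_⟩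
    have hd2 : ∀ y, E x2 y → y ∈ D := fun y hh => step _ _ _ _ a m1 d hh hy
    have hd3 : ∀ y, E x3 y → y ∈ D := fun y hh => step _ _ _ _ b m2 d hh hy
    have hd1 : ∀ y, E x1 y → y ∈ D := fun y hh =>
      step _ _ _ _ a.symm (fun hm => m1 (hs _ _ hm)) e hh (hd2 _ e)
    intro x y hxy
    by_cases e1 : x = x1
    · subst e1; exact hd1 y hxy
    by_cases e2 : x = x2
    · subst e2; exact hd2 y hxy
    by_cases f1 : m x1 x
    · exact step _ _ _ _ (Ne.symm e2) (fun f2 => a (hu _ _ _ (hs _ _ f1) (hs _ _ f2))) e hxy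
        (hd2 _ e)
    · exact step _ _ _ _ (Ne.symm e1) f1 d hxy hy
  · left
    by_cases h1 : ∃ x1 y1, E x1 y1
    · obtain ⟨x1, y1, h1⟩ := h1
      by_cases h2 : ∃ x2 y2, x1 ≠ x2 ∧ E x2 y2
      · obtain ⟨x2, y2, h2, h4⟩ := h2
        refine ⟨{x1, x2}, Finset.card_le_two, ?_⟩
        intro x y hxy
        by_contra hx
        simp at hx
        exact h3 ⟨x1, x2, x, y1, y2, y, h2, Ne.symm hx.1, Ne.symm hx.2, h1, h4, hxy⟩
      · refine ⟨{x1}, by simp, ?_⟩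
        intro x y hxy
        by_contra hx
        simp at hx
        exact h2 ⟨x, y, Ne.symm hx, hxy⟩
    · exact ⟨∅, by simp, fun x y hxy => absurd ⟨x, y, hxy⟩ h1⟩

lemma cover_one_two (E : V → V → Prop) (m' : V → V → Prop) (hs' : ∀ a b, m' a b → m' b a)
    (hu' : ∀ a b c, m' a b → m' a c → b = c)
    (hE : ∀ x x' y y', x ≠ x' → y ≠ y' → E x y → E x' y' → m' y y') :
    (∃ W : Finset V, W.card ≤ 1 ∧ ∀ x y, E x y → x ∈ W) ∨
      ∃ W : Finset V, W.card ≤ 2 ∧ ∀ x y, E x y → y ∈ W := by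
  by_cases h2 : ∃ x1 x2 y1 y2, x1 ≠ x2 ∧ E x1 y1 ∧ E x2 y2
  · right
    obtain ⟨x1, x2, y1, y2, a, b, d⟩ := h2
    obtain ⟨D, hD, hy, hcl⟩ := exists_matched m' hs' hu' y1
    have step : ∀ x x' y y', x ≠ x' → E x y → E x' y' → y ∈ D → y' ∈ D := by
      intro x x' y y' hx h5 h6 h7
      by_cases hyy : y = y'
      · rwa [← hyy]
      · exact hcl y h7 y' (Or.inr (hE x x' y y' hx hyy h5 h6))
    refine ⟨D, hD, ?_⟩
    intro x y hxy
    by_cases e1 : x1 = x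
    · subst e1
      exact step _ _ _ _ a.symm d hxy (step _ _ _ _ a b d hy)
    · exact step _ _ _ _ e1 b hxy hy
  · left
    by_cases h1 : ∃ x1 y1, E x1 y1
    · obtain ⟨x1, y1, h1⟩ := h1
      refine ⟨{x1}, by simp, ?_⟩
      intro x y hxy
      by_contra hx
      simp at hx
      exact h2 ⟨x1, x, y1, y, Ne.symm hx, h1, hxy⟩
    · exact ⟨∅, by simp, fun x y hxy => absurd ⟨x, y, hxy⟩ h1⟩

lemma cover_one (E : V → V → Prop)
    (hE : ∀ x x' y y', x ≠ x' → y ≠ y' → E x y → ¬ E x' y') :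
    (∃ W : Finset V, W.card ≤ 1 ∧ ∀ x y, E x y → x ∈ W) ∨
      ∃ W : Finset V, W.card ≤ 1 ∧ ∀ x y, E x y → y ∈ W := by
  by_cases h2 : ∃ x1 x2 y1 y2, x1 ≠ x2 ∧ E x1 y1 ∧ E x2 y2
  · right
    obtain ⟨x1, x2, y1, y2, a, b, d⟩ := h2
    have step : ∀ x x' y y', x ≠ x' → E x y → E x' y' → y = y' := by
      intro x x' y y' hx h5 h6
      by_contra hyy
      exact hE x x' y y' hx hyy h5 h6
    refine ⟨{y1}, by simp, ?_⟩
    intro x y hxy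
    simp
    by_cases e1 : x1 = x
    · subst e1
      rw [step _ _ _ _ a b d, step _ _ _ _ a hxy d]
    · exact (step _ _ _ _ e1 b hxy).symm
  · left
    by_cases h1 : ∃ x1 y1, E x1 y1
    · obtain ⟨x1, y1, h1⟩ := h1
      refine ⟨{x1}, by simp, ?_⟩
      intro x y hxy
      by_contra hx
      simp at hx
      exact h2 ⟨x1, x, y1, y, Ne.symm hx, h1, hxy⟩
    · exact ⟨∅, by simp, fun x y hxy => absurd ⟨x, y, hxy⟩ h1⟩

end Stars

section ShortPaths

variable {V : Type} {r : V → V → Prop} [DecidableEq V] {A B Y T : Finset V}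

lemma PathIn.three (h : Bip r A B) (hY : Y ⊆ A) (hT : T ⊆ B) {y z y' t t' : V} (hy : y ∈ Y)
    (hz : z ∈ Y) (hy' : y' ∈ Y) (h1 : y ≠ z) (h2 : z ≠ y') (h3 : y ≠ y') (ht : t ∈ T) (ht' : t' ∈ T)
    (htt : t ≠ t') (e1 : r y t) (e2 : r z t) (e3 : r z t') (e4 : r y' t') :
    PathIn r Y T y y' 3 := by
  have g : ∀ a ∈ Y, ∀ b ∈ T, a ≠ b := fun a ha b hb => h.ne (hY ha) (hT hb)
  have a1 := g y hy t ht
  have a2 := g y hy t' ht'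
  have a3 := (g z hz t ht).symm
  have a4 := g z hz t' ht'
  have a5 := (g y' hy' t ht).symm
  have a6 := (g y' hy' t' ht').symm
  refine ⟨[y, t, z, t', y'], ⟨by simp_all, by simp [e1, h.symm e2, e3, h.symm e4], by simp,
    by simp⟩, by simp, by simp [hy, hy', ht, ht', hz]⟩

/-- Among three rows, the pairs not joined by a path with three rows form a matching. -/
lemma path_three_or (h : Bip r A B) (hY : Y ⊆ A) (hT : T ⊆ B) {K : ℕ} (hK : 2 ≤ K)
    (hTK : T.card + 1 ≤ 2 * K) (hd : ∀ y ∈ Y, K ≤ (nb r y T).card) {y z w : V} (hy : y ∈ Y)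
    (hz : z ∈ Y) (hw : w ∈ Y) (h1 : y ≠ z) (h2 : z ≠ w) (h3 : y ≠ w) :
    PathIn r Y T y z 3 ∨ PathIn r Y T y w 3 := by
  have inter : ∀ a ∈ Y, ∀ b ∈ Y, ∃ t ∈ T, r a t ∧ r b t := fun a ha b hb =>
    exists_common (by have := hd a ha; have := hd b hb; omega)
  obtain ⟨t, ht, e1, e2⟩ := inter y hy w hw
  obtain ⟨t', ht', e3, e4⟩ := inter w hw z hz
  by_cases htt : t = t'
  · subst htt
    by_cases hc : ∃ s ∈ T, s ≠ t ∧ r w s ∧ (r y s ∨ r z s)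
    · left
      obtain ⟨s, hs, hst, g1, g2 | g2⟩ := hc
      · exact PathIn.three h hY hT hy hw hz h3 h2.symm h1 hs ht hst g2 g1 e3 e4
      · exact PathIn.three h hY hT hy hw hz h3 h2.symm h1 ht hs (Ne.symm hst) e1 e3 g1 g2
    · -- now `y` and `z` have the same neighbours
      push Not at hc
      have key : ∀ a ∈ Y, (∀ s ∈ T, s ≠ t → r w s → ¬ r a s) →
          ∀ s ∈ T, s ≠ t → ¬ r w s → r a s := by
        intro a ha hh s hs hst hws
        by_contra has
        have c1 : (nb r a (T.erase t) ∪ nb r w (T.erase t)) ⊆ (T.erase t).erase s := by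
          intro v
          simp
          rintro (⟨⟨v1, v2⟩, v3⟩ | ⟨⟨v1, v2⟩, v3⟩)
          · exact ⟨fun e => has (e ▸ v3), v1, v2⟩
          · exact ⟨fun e => hws (e ▸ v3), v1, v2⟩
        have c2 : Disjoint (nb r a (T.erase t)) (nb r w (T.erase t)) := by
          rw [Finset.disjoint_left]
          intro v
          simp
          intro v1 v2 v3 _ _ v4
          exact hh v v2 v1 v4 v3
        have c3 := Finset.card_le_card c1
        rw [Finset.card_union_of_disjoint c2,
          Finset.card_erase_of_mem (by simp [hs, hst]), Finset.card_erase_of_mem ht] at c3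
        have c4 : ∀ b, (nb r b T).card ≤ (nb r b (T.erase t)).card + 1 := by
          intro b
          have : nb r b T ⊆ insert t (nb r b (T.erase t)) := by
            intro v; simp; tauto
          exact (Finset.card_le_card this).trans (Finset.card_insert_le _ _)
        have := c4 a
        have := c4 w
        have := hd a ha
        have := hd w hw
        omega
      have ky := key y hy (fun s hs hst hws => (hc s hs hst hws).1)
      have kz := key z hz (fun s hs hst hws => (hc s hs hst hws).2)
      right
      have : 1 < (nb r y T).card := lt_of_lt_of_le (by omega) (hd y hy)
      obtain ⟨s, hs, hst⟩ := Finset.exists_mem_ne this t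
      rw [mem_nb] at hs
      have hws : ¬ r w s := fun hh => (hc s hs.1 hst hh).1 hs.2
      exact PathIn.three h hY hT hy hz hw h1 h2 h3 hs.1 ht hst hs.2 (kz s hs.1 hst hws) e4 e3
  · exact Or.inl (PathIn.three h hY hT hy hw hz h3 h2.symm h1 ht ht' htt e1 e2 e3 e4)

/-- Two disjoint paths joined by two edges. -/
lemma PathIn.cycle (h : Bip r A B) {X T' : Finset V} {x x' y y' : V} {p q n : ℕ}
    (hy : PathIn r Y T y y' p) (hx : PathIn r X T' x x' q) (hd : Disjoint (Y ∪ T) (X ∪ T'))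
    (e : r x y) (e' : r x' y') (hn : p + q = n + 1) : HasCyc r (2 * n) := by
  obtain ⟨l, h1, h2, h3⟩ := hy
  obtain ⟨l', h1', h2', h3'⟩ := hx
  refine ⟨_, h1.join (h1'.reverse h.symm) ?_ (h.symm e') e, ?_⟩
  · rw [List.disjoint_reverse_right]
    intro w hw hw'
    exact Finset.disjoint_left.1 hd (h3 w hw) (h3' w hw')
  · simp
    omega

end ShortPaths

lemma card_le_of_eq {V : Type} [DecidableEq V] {r bl : V → V → Prop} {y : V} {T : Finset V}
    (h1 : ∀ t ∈ T, ∀ t' ∈ T, r y t → r y t' → t = t') (h2 : ∀ t ∈ T, r y t ∨ bl y t) :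
    T.card ≤ (nb bl y T).card + 1 := by
  have h3 : T ⊆ nb bl y T ∪ nb r y T := by
    intro t ht
    have := h2 t ht
    simp [ht]
    tauto
  have h4 : (nb r y T).card ≤ 1 := by
    rw [Finset.card_le_one]
    intro a ha b hb
    rw [mem_nb] at ha hb
    exact h1 a ha.1 b hb.1 ha.2 hb.2
  have := Finset.card_le_card h3
  have := Finset.card_union_le (nb bl y T) (nb r y T)
  omega

lemma card_le_add {V : Type} [DecidableEq V] {r bl : V → V → Prop} {y : V} {T : Finset V}
    (h2 : ∀ t ∈ T, r y t ∨ bl y t) : T.card ≤ (nb r y T).card + (nb bl y T).card := by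
  have h3 : T ⊆ nb r y T ∪ nb bl y T := by
    intro t ht
    have := h2 t ht
    simp [ht]
    tauto
  exact (Finset.card_le_card h3).trans (Finset.card_union_le _ _)

namespace Setup

variable {V : Type} {r bl : V → V → Prop} {A B X Y : Finset V} {k : ℕ}
  {c : ℕ → V}

lemma mod_two (h : Setup r bl A B X Y k c) (i : ℕ) : ∃ j < k, c (2 * j) = c (2 * i) ∧
    c (2 * j + 1) = c (2 * i + 1) ∧ c (2 * j + 2) = c (2 * i + 2) := by
  have hk := h.kpos
  have key : ∀ t, c (2 * (i % k) + t) = c (2 * i + t) := by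
    intro t
    have e : 2 * i + t = 2 * (i % k) + t + (i / k) * (2 * k) := by
      have := Nat.mod_add_div' i k
      nlinarith
    rw [e, h.per_mul]
  exact ⟨i % k, Nat.mod_lt _ (by omega), key 0, key 1, key 2⟩

lemma eq_even (h : Setup r bl A B X Y k c) {i j : ℕ} (hi : i < k) (hj : j < k)
    (e : c (2 * i) = c (2 * j)) : i = j := by
  have := h.inj (2 * i) (by omega) (2 * j) (by omega) e
  omega

lemma eq_odd (h : Setup r bl A B X Y k c) {i j : ℕ} (hi : i < k) (hj : j < k)
    (e : c (2 * i + 1) = c (2 * j + 1)) : i = j := by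
  have := h.inj (2 * i + 1) (by omega) (2 * j + 1) (by omega) e
  omega

/-- The red neighbourhood is not closed under shifting by two unless it is empty or everything. -/
lemma all_of_shift (h : Setup r bl A B X Y k c) {x : V} {i : ℕ} (h0 : r x (c (2 * i)))
    (hs : ∀ j, r x (c (2 * j)) → r x (c (2 * j + 2))) (j : ℕ) : r x (c (2 * j)) := by
  have h1 : ∀ t, r x (c (2 * (i + t))) := by
    intro t
    induction t with
    | zero => exact h0
    | succ t ih => exact hs _ ih
  obtain ⟨t, _, ht⟩ := h.mod_two (j + i * k - i)
  have := h.kpos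
  have e := h1 (j + i * k - i)
  have h0 : i ≤ i * k := Nat.le_mul_of_pos_right _ (by omega)
  rw [show 2 * (i + (j + i * k - i)) = 2 * j + i * (2 * k) by
    have : i + (j + i * k - i) = j + i * k := by omega
    rw [this]; ring, h.per_mul] at e
  exact e

lemma xy_ne (h : Setup r bl A B X Y k c) {x y : V} (hx : x ∈ X) (hy : y ∈ Y) : x ≠ y :=
  h.rb.ne (h.XA hx) (h.YB hy)

lemma totc (h : Setup r bl A B X Y k c) {T : Finset V} (hT : T ⊆ A) {y : V} (hy : y ∈ B) :
    ∀ t ∈ T, r y t ∨ bl y t :=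
  fun t ht => (h.tot t (hT ht) y hy).imp h.rb.symm h.bb.symm

variable [DecidableEq V]

lemma mem_evens (h : Setup r bl A B X Y k c) {v : V} : v ∈ evens k c ↔ ∃ i, v = c (2 * i) := by
  simp only [evens, Finset.mem_image, Finset.mem_range]
  constructor
  · rintro ⟨i, _, rfl⟩; exact ⟨i, rfl⟩
  · rintro ⟨i, rfl⟩
    obtain ⟨j, hj, e, _⟩ := h.mod_two i
    exact ⟨j, hj, e⟩

lemma mem_odds (h : Setup r bl A B X Y k c) {v : V} :
    v ∈ evens k (fun i => c (i + 1)) ↔ ∃ i, v = c (2 * i + 1) := h.swap.mem_evens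

lemma mem_succs (h : Setup r bl A B X Y k c) {x v : V} :
    v ∈ succs r k c x ↔ ∃ i, r x (c (2 * i)) ∧ v = c (2 * i + 1) := by
  simp only [succs, Finset.mem_image, Finset.mem_filter, Finset.mem_range]
  constructor
  · rintro ⟨i, ⟨_, h1⟩, rfl⟩; exact ⟨i, h1, rfl⟩
  · rintro ⟨i, h1, rfl⟩
    obtain ⟨j, hj, e, e', _⟩ := h.mod_two i
    exact ⟨j, ⟨hj, e ▸ h1⟩, e'⟩

lemma mem_preds (h : Setup r bl A B X Y k c) {x v : V} :
    v ∈ preds r k c x ↔ ∃ i, r x (c (2 * i + 2)) ∧ v = c (2 * i + 1) := by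
  simp only [preds, Finset.mem_image, Finset.mem_filter, Finset.mem_range]
  constructor
  · rintro ⟨i, ⟨_, h1⟩, rfl⟩; exact ⟨i, h1, rfl⟩
  · rintro ⟨i, h1, rfl⟩
    obtain ⟨j, hj, e, e', e''⟩ := h.mod_two i
    exact ⟨j, ⟨hj, e'' ▸ h1⟩, e'⟩

lemma evens_sub (h : Setup r bl A B X Y k c) : evens k c ⊆ B := by
  intro v hv
  obtain ⟨i, rfl⟩ := h.mem_evens.1 hv
  exact h.even i

lemma odds_sub (h : Setup r bl A B X Y k c) : evens k (fun i => c (i + 1)) ⊆ A := h.swap.evens_sub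

lemma succs_sub (h : Setup r bl A B X Y k c) {x : V} :
    succs r k c x ⊆ evens k (fun i => c (i + 1)) := by
  intro v hv
  obtain ⟨i, _, rfl⟩ := h.mem_succs.1 hv
  exact h.mem_odds.2 ⟨i, rfl⟩

lemma preds_sub (h : Setup r bl A B X Y k c) {x : V} :
    preds r k c x ⊆ evens k (fun i => c (i + 1)) := by
  intro v hv
  obtain ⟨i, _, rfl⟩ := h.mem_preds.1 hv
  exact h.mem_odds.2 ⟨i, rfl⟩

lemma off_odds (h : Setup r bl A B X Y k c) {x : V} (hx : ∀ i, c i ≠ x) :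
    x ∉ evens k (fun i => c (i + 1)) := by
  intro hh
  obtain ⟨i, e⟩ := h.mem_odds.1 hh
  exact hx _ e.symm

lemma off_evens (h : Setup r bl A B X Y k c) {x : V} (hx : ∀ i, c i ≠ x) : x ∉ evens k c := by
  intro hh
  obtain ⟨i, e⟩ := h.mem_evens.1 hh
  exact hx _ e.symm

lemma evens_shift (h : Setup r bl A B X Y k c) : evens k (fun i => c (i + 1 + 1)) = evens k c := by
  ext v
  rw [h.swap.swap.mem_evens, h.mem_evens]
  constructor
  · rintro ⟨i, rfl⟩; exact ⟨i + 1, rfl⟩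
  · rintro ⟨i, rfl⟩
    have := h.kpos
    refine ⟨i + (k - 1), ?_⟩
    rw [show 2 * (i + (k - 1)) + 1 + 1 = 2 * i + 2 * k by omega, h.per]

lemma card_evens (h : Setup r bl A B X Y k c) : (evens k c).card = k := by
  rw [evens, Finset.card_image_of_injOn, Finset.card_range]
  intro i hi j hj e
  exact h.eq_even (by simpa using hi) (by simpa using hj) e

lemma card_odds (h : Setup r bl A B X Y k c) : (evens k (fun i => c (i + 1))).card = k :=
  h.swap.card_evens

lemma card_nb_eq (h : Setup r bl A B X Y k c) {x : V} : (nb r x (evens k c)).card =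
    (open scoped Classical in (Finset.range k).filter fun i => r x (c (2 * i))).card := by
  classical
  rw [← Finset.card_image_of_injOn (f := fun i => c (2 * i))]
  · congr 1
    ext v
    simp only [evens, mem_nb, Finset.mem_image, Finset.mem_filter, Finset.mem_range]
    constructor
    · rintro ⟨⟨i, hi, rfl⟩, h1⟩; exact ⟨i, ⟨hi, h1⟩, rfl⟩
    · rintro ⟨i, ⟨hi, h1⟩, rfl⟩; exact ⟨⟨i, hi, rfl⟩, h1⟩
  · intro i hi j hj e
    simp at hi hj
    exact h.eq_even hi.1 hj.1 e

lemma card_succs (h : Setup r bl A B X Y k c) {x : V} :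
    (succs r k c x).card = (nb r x (evens k c)).card := by
  rw [h.card_nb_eq, succs, Finset.card_image_of_injOn]
  intro i hi j hj e
  simp at hi hj
  exact h.eq_odd hi.1 hj.1 e

lemma card_preds (h : Setup r bl A B X Y k c) {x : V} :
    (preds r k c x).card = (nb r x (evens k c)).card := by
  have h1 : (nb r x (evens k c)).card = (nb r x (evens k fun i => c (i + 1 + 1))).card := by
    rw [h.evens_shift]
  rw [h1, h.swap.swap.card_nb_eq, preds, Finset.card_image_of_injOn]
  intro i hi j hj e
  simp at hi hj
  exact h.eq_odd hi.1 hj.1 e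

lemma card_union_succs (h : Setup r bl A B X Y k c) {x : V} (h1 : 0 < (nb r x (evens k c)).card)
    (h2 : (nb r x (evens k c)).card < k) :
    (nb r x (evens k c)).card + 1 ≤ (succs r k c x ∪ preds r k c x).card := by
  by_contra hlt
  have e1 : succs r k c x ∪ preds r k c x = preds r k c x := by
    symm
    apply Finset.eq_of_subset_of_card_le Finset.subset_union_right
    rw [h.card_preds]; omega
  have e2 : succs r k c x ⊆ preds r k c x := Finset.union_eq_right.1 e1
  obtain ⟨v, hv⟩ := Finset.card_pos.1 h1
  obtain ⟨hv, hxv⟩ := mem_nb.1 hv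
  obtain ⟨i, rfl⟩ := h.mem_evens.1 hv
  have := h.all_of_shift hxv (fun j hj => by
    have h3 := e2 (h.mem_succs.2 ⟨j, hj, rfl⟩)
    obtain ⟨j', h4, e⟩ := h.mem_preds.1 h3
    rw [h.eq_iff] at e
    have : c (2 * j + 2) = c (2 * j' + 2) := by
      rw [h.eq_iff, Nat.add_mod (2 * j + 1) 1, e, ← Nat.add_mod]
    rwa [this])
  have h5 : nb r x (evens k c) = evens k c := nb_eq_of_forall (fun t ht => by
    obtain ⟨j, rfl⟩ := h.mem_evens.1 ht
    exact this j)
  rw [h5, h.card_evens] at h2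
  omega

lemma no_red_succs (h : Setup r bl A B X Y k c) {x y : V} (hx : x ∈ X) (hy : y ∈ Y) (e : r x y) :
    ∀ t ∈ succs r k c x, ¬ r y t := by
  intro t ht
  obtain ⟨i, h1, rfl⟩ := h.mem_succs.1 ht
  exact h.no_edge (h.Xoff x hx) (h.Yoff y hy) (h.xy_ne hx hy) e h1

lemma no_red_preds (h : Setup r bl A B X Y k c) {x y : V} (hx : x ∈ X) (hy : y ∈ Y) (e : r x y) :
    ∀ t ∈ preds r k c x, ¬ r y t := by
  intro t ht h2
  obtain ⟨i, h1, rfl⟩ := h.mem_preds.1 ht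
  exact h.no_edge (h.Yoff y hy) (h.Xoff x hx) (h.xy_ne hx hy).symm (h.rb.symm e) h2 h1

lemma insert_sub (h : Setup r bl A B X Y k c) {x : V} (hx : x ∈ X) :
    insert x (succs r k c x) ⊆ A :=
  Finset.insert_subset (h.XA hx) (h.succs_sub.trans h.odds_sub)

lemma card_insert_succs (h : Setup r bl A B X Y k c) {x : V} (hx : x ∈ X) :
    (insert x (succs r k c x)).card = (nb r x (evens k c)).card + 1 := by
  rw [Finset.card_insert_of_notMem (fun hh => h.off_odds (h.Xoff x hx) (h.succs_sub hh)),
    h.card_succs]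

lemma eq_of_red_succs (h : Setup r bl A B X Y k c) {x y : V} (hx : x ∈ X) (hy : y ∈ Y) :
    ∀ t ∈ insert x (succs r k c x), ∀ t' ∈ insert x (succs r k c x), r y t → r y t' → t = t' := by
  intro t ht t' ht' e e'
  rw [Finset.mem_insert] at ht ht'
  rcases ht with rfl | ht
  · rcases ht' with rfl | ht'
    · rfl
    · exact absurd e' (h.no_red_succs hx hy (h.rb.symm e) t' ht')
  · rcases ht' with rfl | ht'
    · exact absurd e (h.no_red_succs hx hy (h.rb.symm e') t ht)
    · obtain ⟨i, h1, rfl⟩ := h.mem_succs.1 ht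
      obtain ⟨j, h2, rfl⟩ := h.mem_succs.1 ht'
      have := h.no_cross (h.Xoff x hx) (h.Yoff y hy) (h.xy_ne hx hy) h1 h2 e e'
      rw [h.eq_iff] at this ⊢
      rw [Nat.add_mod, this, ← Nat.add_mod]

lemma eq_of_red_preds (h : Setup r bl A B X Y k c) {x y : V} (hx : x ∈ X) (hy : y ∈ Y) :
    ∀ t ∈ insert x (preds r k c x), ∀ t' ∈ insert x (preds r k c x), r y t → r y t' → t = t' := by
  intro t ht t' ht' e e'
  rw [Finset.mem_insert] at ht ht'
  rcases ht with rfl | ht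
  · rcases ht' with rfl | ht'
    · rfl
    · exact absurd e' (h.no_red_preds hx hy (h.rb.symm e) t' ht')
  · rcases ht' with rfl | ht'
    · exact absurd e (h.no_red_preds hx hy (h.rb.symm e') t ht)
    · obtain ⟨i, h1, rfl⟩ := h.mem_preds.1 ht
      obtain ⟨j, h2, rfl⟩ := h.mem_preds.1 ht'
      exact h.no_cross (h.Yoff y hy) (h.Xoff x hx) (h.xy_ne hx hy).symm e e' h1 h2

lemma miss_succs (h : Setup r bl A B X Y k c) {x y : V} (hx : x ∈ X) (hy : y ∈ Y) :
    (insert x (succs r k c x)).card ≤ (nb bl y (insert x (succs r k c x))).card + 1 :=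
  card_le_of_eq (h.eq_of_red_succs hx hy) (h.totc (h.insert_sub hx) (h.YB hy))

/-- Blue paths on rows in `Y` using the successors of the neighbours of `x` and `x` as columns. -/
lemma path_succs (h : Setup r bl A B X Y k c) {x : V} (hx : x ∈ X) {Y0 : Finset V} (hY0 : Y0 ⊆ Y)
    {y y' : V} (hy : y ∈ Y0) (hy' : y' ∈ Y0) (hne : y ≠ y') {p : ℕ} (hp : 2 ≤ p)
    (hpY : p ≤ Y0.card) (hpd : p ≤ (nb r x (evens k c)).card + 1)
    (hd : 3 ≤ (nb r x (evens k c)).card ∨ (p = 2 ∧ 2 ≤ (nb r x (evens k c)).card)) :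
    PathIn bl Y0 (insert x (succs r k c x)) y y' p := by
  have hK : ∀ y ∈ Y0, (nb r x (evens k c)).card ≤ (nb bl y (insert x (succs r k c x))).card := by
    intro y hy
    have := h.miss_succs hx (hY0 hy)
    rw [h.card_insert_succs hx] at this
    omega
  have hc := h.card_insert_succs hx
  rcases hd with hd | ⟨rfl, hd⟩
  · exact h.bb.swap.path (hY0.trans h.YB) (h.insert_sub hx) hK (by omega) hy hy' hne hp hpY hpd
  · obtain ⟨t, ht, e1, e2⟩ := exists_common (r := bl) (T := insert x (succs r k c x)) (y := y)
      (y' := y') (by have := hK y hy; have := hK y' hy'; omega)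
    exact PathIn.two h.bb.swap (hY0.trans h.YB) (h.insert_sub hx) hy hy' hne ht e1 e2

lemma blue_odds (h : Setup r bl A B X Y k c) {y : V} (hy : y ∈ Y) :
    k ≤ (nb r y (evens k (fun i => c (i + 1)))).card +
      (nb bl y (evens k (fun i => c (i + 1)))).card := by
  have := card_le_add (h.totc h.odds_sub (h.YB hy))
  rwa [h.card_odds] at this

/-- Blue paths on rows in `Y` using the cycle vertices as columns. -/
lemma path_odds (h : Setup r bl A B X Y k c) {Y0 : Finset V} (hY0 : Y0 ⊆ Y) {d : ℕ}
    (hd : ∀ y ∈ Y0, (nb r y (evens k (fun i => c (i + 1)))).card ≤ d)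
    {y y' : V} (hy : y ∈ Y0) (hy' : y' ∈ Y0) (hne : y ≠ y') {p : ℕ} (hp : 2 ≤ p)
    (hpY : p ≤ Y0.card) (hpd : p + d ≤ k + 1) (hdk : 2 * d + 2 ≤ k) :
    PathIn bl Y0 (evens k (fun i => c (i + 1))) y y' p := by
  have hK : ∀ y ∈ Y0, k - d ≤ (nb bl y (evens k (fun i => c (i + 1)))).card := by
    intro y hy
    have := h.blue_odds (hY0 hy)
    have := hd y hy
    omega
  exact h.bb.swap.path (hY0.trans h.YB) h.odds_sub hK (by rw [h.card_odds]; omega) hy hy' hne hp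
    hpY (by omega)

lemma path_succs_or (h : Setup r bl A B X Y k c) {x : V} (hx : x ∈ X) {Y0 : Finset V}
    (hY0 : Y0 ⊆ Y) (hd : (nb r x (evens k c)).card = 2)
    {y z w : V} (hy : y ∈ Y0) (hz : z ∈ Y0) (hw : w ∈ Y0) (h1 : y ≠ z) (h2 : z ≠ w) (h3 : y ≠ w) :
    PathIn bl Y0 (insert x (succs r k c x)) y z 3 ∨
      PathIn bl Y0 (insert x (succs r k c x)) y w 3 := by
  have hc := h.card_insert_succs hx
  refine path_three_or h.bb.swap (hY0.trans h.YB) (h.insert_sub hx) (K := 2) le_rfl (by omega) ?_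
    hy hz hw h1 h2 h3
  intro y hy
  have := h.miss_succs hx (hY0 hy)
  omega

lemma path_odds_or (h : Setup r bl A B X Y k c) {Y0 : Finset V} (hY0 : Y0 ⊆ Y) {d : ℕ}
    (hd : ∀ y ∈ Y0, (nb r y (evens k (fun i => c (i + 1)))).card ≤ d) (hdk : 2 * d + 1 ≤ k)
    (hk : d + 2 ≤ k)
    {y z w : V} (hy : y ∈ Y0) (hz : z ∈ Y0) (hw : w ∈ Y0) (h1 : y ≠ z) (h2 : z ≠ w) (h3 : y ≠ w) :
    PathIn bl Y0 (evens k (fun i => c (i + 1))) y z 3 ∨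
      PathIn bl Y0 (evens k (fun i => c (i + 1))) y w 3 := by
  refine path_three_or h.bb.swap (hY0.trans h.YB) h.odds_sub (K := k - d) (by omega)
    (by rw [h.card_odds]; omega) ?_ hy hz hw h1 h2 h3
  intro y hy
  have := h.blue_odds (hY0 hy)
  have := hd y hy
  omega

/-- Joining blue paths on the two sides. -/
lemma join_paths (h : Setup r bl A B X Y k c) {Y0 X0 T T' : Finset V} (hY0 : Y0 ⊆ Y) (hX0 : X0 ⊆ X)
    (hT : T ⊆ A) (hT' : T' ⊆ B) (hd : Disjoint Y0 T') (hd' : Disjoint X0 T) {x x' y y' : V}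
    {p q n : ℕ} (hy : PathIn bl Y0 T y y' p) (hx : PathIn bl X0 T' x x' q)
    (e : bl x y) (e' : bl x' y') (hn : p + q = n + 1) : HasCyc bl (2 * n) := by
  refine PathIn.cycle h.bb hy hx ?_ e e' hn
  rw [Finset.disjoint_left]
  intro v hv hv'
  rw [Finset.mem_union] at hv hv'
  rcases hv with hv | hv <;> rcases hv' with hv' | hv'
  · exact h.xy_ne (hX0 hv') (hY0 hv) rfl
  · exact Finset.disjoint_left.1 hd hv hv'
  · exact Finset.disjoint_left.1 hd' hv' hv
  · exact h.rb.ne (hT hv) (hT' hv') rfl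

end Setup

lemma PathIn.complete {V : Type} [DecidableEq V] {r : V → V → Prop} {A B Y T : Finset V}
    (h : Bip r A B) (hY : Y ⊆ A) (hT : T ⊆ B) (hc : ∀ y ∈ Y, ∀ t ∈ T, r y t) {y y' : V}
    (hy : y ∈ Y) (hy' : y' ∈ Y) (hne : y ≠ y') {p : ℕ} (hp : 2 ≤ p) (hpY : p ≤ Y.card)
    (hpT : p ≤ T.card + 1) : PathIn r Y T y y' p := by
  rcases hp.eq_or_lt with rfl | hp'
  · obtain ⟨t, ht⟩ := Finset.card_pos.1 (show 0 < T.card by omega)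
    exact PathIn.two h hY hT hy hy' hne ht (hc _ hy _ ht) (hc _ hy' _ ht)
  · exact h.path hY hT (K := T.card) (fun y hy => by rw [nb_eq_of_forall (hc y hy)]) (by omega)
      hy hy' hne hp hpY hpT

lemma exists_path_complete {V : Type} [DecidableEq V] {r : V → V → Prop} {A B Y T : Finset V}
    (h : Bip r A B) (hY : Y ⊆ A) (hT : T ⊆ B) (hc : ∀ y ∈ Y, ∀ t ∈ T, r y t) {y t : V}
    (hy : y ∈ Y) (ht : t ∈ T) {p : ℕ} (hp : 1 ≤ p) (hpY : p ≤ Y.card) (hpT : p ≤ T.card) :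
    ∃ l, IsPth r y t l ∧ l.length = 2 * p ∧ ∀ w ∈ l, w ∈ Y ∪ T := by
  have key : ∃ y' ∈ Y, PathIn r Y (T.erase t) y y' p := by
    rcases hp.eq_or_lt with rfl | hp'
    · exact ⟨y, hy, PathIn.one hy⟩
    · obtain ⟨y', hy', hne⟩ := Finset.exists_mem_ne (show 1 < Y.card by omega) y
      refine ⟨y', hy', PathIn.complete h hY ((Finset.erase_subset _ _).trans hT)
        (fun a ha b hb => hc a ha b (Finset.mem_of_mem_erase hb)) hy hy' hne.symm hp' hpY ?_⟩
      rw [Finset.card_erase_of_mem ht]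
      omega
  obtain ⟨y', hy', l, h1, h2, h3⟩ := key
  refine ⟨_, h1.append (IsPth.single t) ?_ (hc _ hy' _ ht), by simp; omega, ?_⟩
  · simp only [List.disjoint_singleton]
    intro hl
    have := h3 t hl
    simp at this
    exact h.ne (hY this) (hT ht) rfl
  · intro w hw
    simp at hw ⊢
    rcases hw with hw | rfl
    · have := h3 w hw
      simp at this
      tauto
    · exact Or.inr ht

namespace Setup

variable {V : Type} {r bl : V → V → Prop} {A B X Y : Finset V} {k : ℕ}
  {c : ℕ → V} [DecidableEq V]

lemma off_union (h : Setup r bl A B X Y k c) {X1 Y1 : Finset V} (hX : X1 ⊆ X) (hY : Y1 ⊆ Y) {w : V}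
    (hw : w ∈ X1 ∪ Y1) (j : ℕ) : c j ≠ w := by
  rcases Finset.mem_union.1 hw with hw | hw
  · exact h.Xoff w (hX hw) j
  · exact h.Yoff w (hY hw) j

/-- Two disjoint red edges from the cycle to the same side of a large red complete graph are
impossible. -/
lemma no_two_edges (h : Setup r bl A B X Y k c) {X1 Y1 : Finset V} (hX : X1 ⊆ X) (hY : Y1 ⊆ Y)
    (hc : ∀ x ∈ X1, ∀ y ∈ Y1, r x y) (hXc : k / 2 + 1 ≤ X1.card) (hYc : k / 2 ≤ Y1.card)
    {x x' b b' : V} (hx : x ∈ X1) (hx' : x' ∈ X1) (hne : x ≠ x') (hb : b ∈ evens k c)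
    (hb' : b' ∈ evens k c) (hbb : b ≠ b') (e : r x b) (e' : r x' b') : False := by
  have hk := h.kpos
  have main : ∀ i s, 1 ≤ s → s ≤ k → k + 1 - s ≤ k / 2 + 1 → 2 ≤ k + 1 - s → ∀ x ∈ X1, ∀ x' ∈ X1,
      x ≠ x' → r x (c i) → r x' (c (i + 2 * s)) → False := by
    intro i s hs1 hs2 hs3 hs4 x hx x' hx' hne e e'
    obtain ⟨l, h1, h2, h3⟩ := PathIn.complete h.rb (hX.trans h.XA) (hY.trans h.YB) hc hx' hx
      hne.symm hs4 (by omega) (by omega)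
    exact h.no_arc (i := i) (l := 2 * s + 1) (by omega) (by omega) h1
      (fun w hw => h.off_union hX hY (h3 w hw)) (by omega) e' e
  obtain ⟨i, rfl⟩ := h.mem_evens.1 hb
  obtain ⟨j, rfl⟩ := h.mem_evens.1 hb'
  obtain ⟨s, hs, es, -⟩ := h.mod_two (j + i * k - i)
  have h0 : i ≤ i * k := Nat.le_mul_of_pos_right _ (by omega)
  have ej : c (2 * i + 2 * s) = c (2 * j) := by
    have e1 : c (2 * i + 2 * s) = c (2 * i + 2 * (j + i * k - i)) := by
      rw [h.eq_iff] at es ⊢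
      rw [Nat.add_mod, es, ← Nat.add_mod]
    rw [e1, show 2 * i + 2 * (j + i * k - i) = 2 * j + i * (2 * k) by
      have : i + (j + i * k - i) = j + i * k := by omega
      rw [← Nat.mul_add, this]; ring, h.per_mul]
  have hs0 : s ≠ 0 := by
    rintro rfl
    exact hbb (by simpa using ej)
  rcases le_or_gt s (k / 2) with hh | hh
  · refine main (2 * i + 2 * s) (k - s) (by omega) (by omega) (by omega) (by omega) x' hx' x hx
      hne.symm (ej ▸ e') ?_
    rw [show 2 * i + 2 * s + 2 * (k - s) = 2 * i + 2 * k by omega, h.per]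
    exact e
  · exact main (2 * i) s (by omega) (by omega) (by omega) (by omega) x hx x' hx' hne e (ej ▸ e')

lemma cyc_of_miss (h : Setup r bl A B X Y k c) {T : Finset V} (hT : T ⊆ A) {n : ℕ} (hn : 4 ≤ n)
    (hY : n ≤ Y.card) (hTn : n + 1 ≤ T.card)
    (hu : ∀ y ∈ Y, ∀ t ∈ T, ∀ t' ∈ T, r y t → r y t' → t = t') : HasCyc bl (2 * n) := by
  obtain ⟨T', hT', hc⟩ := Finset.exists_subset_card_eq hTn
  refine (h.bb.swap.cyc h.YB (hT'.trans hT) (K := n) ?_ (by omega) (by omega) hY le_rfl).hasCyc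
  intro y hy
  have := card_le_of_eq (fun t ht t' ht' => hu y hy t (hT' ht) t' (hT' ht'))
    (h.totc (hT'.trans hT) (h.YB hy))
  omega

lemma deg_lt (h : Setup r bl A B X Y k c) {n : ℕ} (hn : 4 ≤ n) (hY : n ≤ Y.card)
    (hb : ¬ HasCyc bl (2 * n)) {x : V} (hx : x ∈ X) : (nb r x (evens k c)).card + 1 ≤ n := by
  by_contra hlt
  refine hb (h.cyc_of_miss (h.insert_sub hx) hn hY ?_ fun y hy => h.eq_of_red_succs hx hy)
  rw [h.card_insert_succs hx]
  omega

lemma r_iff_of_nb (h : Setup r bl A B X Y k c) {z z' : V}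
    (e : nb r z (evens k c) = nb r z' (evens k c)) (i : ℕ) :
    r z (c (2 * i)) ↔ r z' (c (2 * i)) := by
  have hi : c (2 * i) ∈ evens k c := h.mem_evens.2 ⟨i, rfl⟩
  constructor
  · intro h1
    exact (mem_nb.1 (e ▸ mem_nb.2 ⟨hi, h1⟩ : c (2 * i) ∈ nb r z' (evens k c))).2
  · intro h1
    exact (mem_nb.1 (e ▸ mem_nb.2 ⟨hi, h1⟩ : c (2 * i) ∈ nb r z (evens k c))).2

lemma succs_congr (h : Setup r bl A B X Y k c) {z z' : V}
    (e : nb r z (evens k c) = nb r z' (evens k c)) : succs r k c z = succs r k c z' := by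
  ext v
  simp only [h.mem_succs, h.r_iff_of_nb e]

lemma preds_congr (h : Setup r bl A B X Y k c) {z z' : V}
    (e : nb r z (evens k c) = nb r z' (evens k c)) : preds r k c z = preds r k c z' := by
  ext v
  rw [h.mem_preds, h.mem_preds]
  exact exists_congr fun i => and_congr (h.r_iff_of_nb e (i + 1)) Iff.rfl

/-- A set of off-cycle vertices with a common large neighbourhood forces two cycle vertices with
many red neighbours. -/
lemma dominating (h : Setup r bl A B X Y k c) (hk : 5 ≤ k) (hY : Y.card = k)
    (hb : ¬ HasCyc bl (2 * k)) {Z : Finset V} (hZ : Z ⊆ X) {z0 : V} (hz0 : z0 ∈ Z)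
    (hS : ∀ z ∈ Z, nb r z (evens k c) = nb r z0 (evens k c))
    (hS0 : 0 < (nb r z0 (evens k c)).card) (hcard : (nb r z0 (evens k c)).card + Z.card = k)
    (hu : ∀ y ∈ Y, ∀ z ∈ Z, ∀ z' ∈ Z, r y z → r y z' → z = z') :
    ∃ t ∈ evens k (fun i => c (i + 1)), ∃ t' ∈ evens k (fun i => c (i + 1)), t ≠ t' ∧
      k ≤ (nb r t Y).card + 1 ∧ k ≤ (nb r t' Y).card + 1 := by
  have hZ0 : 0 < Z.card := Finset.card_pos.2 ⟨z0, hz0⟩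
  have hoff : ∀ z ∈ Z, z ∉ evens k (fun i => c (i + 1)) := fun z hz => h.off_odds (h.Xoff z (hZ hz))
  have key : ∀ Q : Finset V, Q ⊆ evens k (fun i => c (i + 1)) →
      Q.card = (nb r z0 (evens k c)).card →
      (∀ z ∈ Z, ∀ y ∈ Y, ∀ t ∈ insert z Q, ∀ t' ∈ insert z Q, r y t → r y t' → t = t') →
      (∀ y ∈ Y, ∀ t ∈ Q ∪ Z, ∀ t' ∈ Q ∪ Z, r y t → r y t' → t = t') ∧
      ∃ t ∈ Q ∪ Z, k ≤ (nb r t Y).card + 1 := by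
    intro Q hQ hQc hQu
    have hu' : ∀ y ∈ Y, ∀ t ∈ Q ∪ Z, ∀ t' ∈ Q ∪ Z, r y t → r y t' → t = t' := by
      intro y hy t ht t' ht' e e'
      rw [Finset.mem_union] at ht ht'
      rcases ht with ht | ht <;> rcases ht' with ht' | ht'
      · exact hQu z0 hz0 y hy t (by simp [ht]) t' (by simp [ht']) e e'
      · exact hQu t' ht' y hy t (by simp [ht]) t' (by simp) e e'
      · exact hQu t ht y hy t (by simp) t' (by simp [ht']) e e'
      · exact hu y hy t ht t' ht' e e'
    refine ⟨hu', ?_⟩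
    have hsub : Q ∪ Z ⊆ A := Finset.union_subset (hQ.trans h.odds_sub) (hZ.trans h.XA)
    have hdisj : Disjoint Q Z := Finset.disjoint_left.2 fun v hv hv' => hoff v hv' (hQ hv)
    have hQZ : (Q ∪ Z).card = k := by rw [Finset.card_union_of_disjoint hdisj]; omega
    by_contra hcon
    push Not at hcon
    refine hb (h.bb.swap.ham_miss_one h.YB hsub (by omega) hY hQZ ?_ ?_)
    · intro y hy
      have := card_le_of_eq (hu' y hy) (h.totc hsub (h.YB hy))
      omega
    · intro t ht
      have h1 := hcon t ht
      have h2 := card_le_add (r := r) (bl := bl) (y := t) (T := Y)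
        (fun y hy => h.tot t (hsub ht) y (h.YB hy))
      omega
  obtain ⟨u1, t1, ht1, hd1⟩ := key (succs r k c z0) h.succs_sub h.card_succs (by
    intro z hz y hy
    rw [← h.succs_congr (hS z hz)]
    exact h.eq_of_red_succs (hZ hz) hy)
  obtain ⟨u2, t2, ht2, hd2⟩ := key (preds r k c z0) h.preds_sub h.card_preds (by
    intro z hz y hy
    rw [← h.preds_congr (hS z hz)]
    exact h.eq_of_red_preds (hZ hz) hy)
  have both : ∀ t ∈ succs r k c z0 ∪ Z, t ∈ preds r k c z0 ∪ Z → k ≤ (nb r t Y).card + 1 →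
      False := by
    intro t ht ht' hd
    set C := ((succs r k c z0 ∪ preds r k c z0) ∪ Z).erase t with hC
    have hCA : C ⊆ A := by
      refine (Finset.erase_subset _ _).trans (Finset.union_subset (Finset.union_subset ?_ ?_)
        (hZ.trans h.XA))
      · exact h.succs_sub.trans h.odds_sub
      · exact h.preds_sub.trans h.odds_sub
    have hCc : k ≤ C.card := by
      have h1 := h.card_union_succs hS0 (by omega)
      have hdisj : Disjoint (succs r k c z0 ∪ preds r k c z0) Z :=
        Finset.disjoint_left.2 fun v hv hv' => hoff v hv'
          ((Finset.union_subset h.succs_sub h.preds_sub) hv)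
      rw [hC, Finset.card_erase_of_mem (by simp at ht ⊢; tauto), Finset.card_union_of_disjoint
        hdisj]
      omega
    obtain ⟨T, hT, hTc⟩ := Finset.exists_subset_card_eq hCc
    obtain ⟨R, hR, hRc⟩ := Finset.exists_subset_card_eq (show k - 1 ≤ (nb r t Y).card by omega)
    have hRY : R ⊆ Y := hR.trans nb_subset
    obtain ⟨y', hy', hyR⟩ := Finset.exists_mem_notMem_of_card_lt_card
      (show R.card < Y.card by omega)
    have hmem : ∀ v ∈ C, (v ∈ succs r k c z0 ∪ Z ∨ v ∈ preds r k c z0 ∪ Z) ∧ v ≠ t := by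
      intro v hv
      simp [hC] at hv ⊢
      tauto
    refine hb (h.bb.swap.ham_one_extra (Y := R) (T := T) (hRY.trans h.YB) (hT.trans hCA)
      (by omega) (by omega) hTc ?_ (h.YB hy') hyR ?_)
    · intro y hy v hv
      have hyt := mem_nb.1 (hR hy)
      obtain ⟨hm, hvt⟩ := hmem v (hT hv)
      refine (h.totc hCA (h.YB hyt.1) v (hT hv)).resolve_left fun hyv => hvt ?_
      rcases hm with hm | hm
      · exact u1 y hyt.1 v hm t ht hyv (h.rb.symm hyt.2)
      · exact u2 y hyt.1 v hm t ht' hyv (h.rb.symm hyt.2)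
    · have h1 := card_le_add (h.totc (hT.trans hCA) (h.YB hy'))
      have h2 : nb r y' T ⊆ nb r y' (succs r k c z0 ∪ Z) ∪ nb r y' (preds r k c z0 ∪ Z) := by
        intro v hv
        rw [mem_nb] at hv
        have := (hmem v (hT hv.1)).1
        rw [Finset.mem_union, mem_nb, mem_nb]
        tauto
      have h3 : ∀ Q, (∀ y ∈ Y, ∀ t ∈ Q, ∀ t' ∈ Q, r y t → r y t' → t = t') →
          (nb r y' Q).card ≤ 1 := by
        intro Q hQ
        rw [Finset.card_le_one]
        intro a ha b hb
        rw [mem_nb] at ha hb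
        exact hQ y' hy' a ha.1 b hb.1 ha.2 hb.2
      have h4 := (Finset.card_le_card h2).trans (Finset.card_union_le _ _)
      have := h3 _ u1
      have := h3 _ u2
      omega
  have m1 : t1 ∉ preds r k c z0 ∪ Z := fun hh => both t1 ht1 hh hd1
  have m2 : t2 ∉ succs r k c z0 ∪ Z := fun hh => both t2 hh ht2 hd2
  simp only [Finset.mem_union, not_or] at ht1 ht2 m1 m2
  have n1 := ht1.resolve_right m1.2
  have n2 := ht2.resolve_right m2.2
  exact ⟨t1, h.succs_sub n1, t2, h.preds_sub n2, fun e => m1.1 (e ▸ n2), hd1, hd2⟩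

end Setup

/-- Two sets with at least two elements and three elements in total contain a small witness. -/
lemma exists_small_witness {V : Type} [DecidableEq V] {P Q : Finset V} (hP : 2 ≤ P.card)
    (hQ : 2 ≤ Q.card) (hPQ : 3 ≤ (P ∪ Q).card) :
    ∃ D ⊆ P ∪ Q, D.card ≤ 5 ∧ 2 ≤ (P ∩ D).card ∧ 2 ≤ (Q ∩ D).card ∧
      3 ≤ ((P ∩ D) ∪ (Q ∩ D)).card := by
  obtain ⟨P', hP', hPc⟩ := Finset.exists_subset_card_eq hP
  obtain ⟨Q', hQ', hQc⟩ := Finset.exists_subset_card_eq hQ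
  have key : ∃ D ⊆ P ∪ Q, D.card ≤ 5 ∧ 3 ≤ D.card ∧ P' ⊆ D ∧ Q' ⊆ D := by
    have h0 : P' ∪ Q' ⊆ P ∪ Q := Finset.union_subset_union hP' hQ'
    have h1 := Finset.card_union_le P' Q'
    rcases Nat.lt_or_ge (P' ∪ Q').card 3 with h2 | h2
    · obtain ⟨e, he, he'⟩ := Finset.exists_mem_notMem_of_card_lt_card
        (show (P' ∪ Q').card < (P ∪ Q).card by omega)
      refine ⟨insert e (P' ∪ Q'), Finset.insert_subset he h0, ?_, ?_,
        Finset.subset_union_left.trans (Finset.subset_insert _ _),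
        Finset.subset_union_right.trans (Finset.subset_insert _ _)⟩
      · rw [Finset.card_insert_of_notMem he']; omega
      · have := Finset.card_le_card (Finset.subset_union_left (s₁ := P') (s₂ := Q'))
        rw [Finset.card_insert_of_notMem he']; omega
    · exact ⟨P' ∪ Q', h0, by omega, h2, Finset.subset_union_left, Finset.subset_union_right⟩
  obtain ⟨D, hD, h5, h3, hPD, hQD⟩ := key
  refine ⟨D, hD, h5, ?_, ?_, ?_⟩
  · rw [← hPc]; exact Finset.card_le_card (Finset.subset_inter hP' hPD)
  · rw [← hQc]; exact Finset.card_le_card (Finset.subset_inter hQ' hQD)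
  · rw [← Finset.union_inter_distrib_right, Finset.inter_eq_right.2 hD]
    exact h3

namespace Setup

variable {V : Type} {r bl : V → V → Prop} {A B X Y : Finset V} {k : ℕ}
  {c : ℕ → V} [DecidableEq V]

lemma no_red_window (h : Setup r bl A B X Y k c) {X1 Y1 : Finset V} (hX : X1 ⊆ X) (hY : Y1 ⊆ Y)
    (hc : ∀ x ∈ X1, ∀ y ∈ Y1, r x y) {n : ℕ} (hn : 5 ≤ n) (hnk : n ≤ k) (hXc : n ≤ X1.card + 2)
    (hYc : n ≤ Y1.card + 2) {x y : V} (hx : x ∈ X1) (hy : y ∈ Y1) {i s : ℕ} (e : r x (c (i + 6)))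
    (hs : s ≤ n) : ¬ r y (c (i + 1 + 2 * s)) := by
  intro e'
  rcases Nat.lt_or_ge s 3 with h3 | h3
  · obtain ⟨l, h1, h2, h4⟩ := exists_path_complete h.rb (hX.trans h.XA) (hY.trans h.YB) hc hx hy
      (p := 3 - s) (by omega) (by omega) (by omega)
    refine h.no_arc (i := i + 6) (l := 2 * k + 2 * s - 4) (by omega) (by omega)
      (h1.reverse h.rb.symm) (fun w hw => h.off_union hX hY (h4 w (by simpa using hw)))
      (by simp; omega) ?_ e
    rw [show i + 6 + (2 * k + 2 * s - 4) - 1 = i + 1 + 2 * s + 2 * k by omega, h.per]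
    exact e'
  · obtain ⟨l, h1, h2, h4⟩ := exists_path_complete h.rb (hX.trans h.XA) (hY.trans h.YB) hc hx hy
      (p := s - 2) (by omega) (by omega) (by omega)
    refine h.no_arc (i := i + 1 + 2 * s) (l := 2 * k + 6 - 2 * s) (by omega) (by omega)
      h1 (fun w hw => h.off_union hX hY (h4 w hw)) (by omega) ?_ e'
    rw [show i + 1 + 2 * s + (2 * k + 6 - 2 * s) - 1 = i + 6 + 2 * k by omega, h.per]
    exact e

lemma exists_consecutive (h : Setup r bl A B X Y k c) {z : V}
    (hz : k < 2 * (nb r z (evens k c)).card) : ∃ i, r z (c (2 * i)) ∧ r z (c (2 * i + 2)) := by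
  have h1 : ¬ Disjoint (succs r k c z) (preds r k c z) := by
    intro hd
    have := Finset.card_le_card (Finset.union_subset (h.succs_sub (x := z)) (h.preds_sub (x := z)))
    rw [Finset.card_union_of_disjoint hd, h.card_succs, h.card_preds, h.card_odds] at this
    omega
  obtain ⟨v, hv, hv'⟩ := Finset.not_disjoint_iff.1 h1
  obtain ⟨i, e, rfl⟩ := h.mem_succs.1 hv
  obtain ⟨j, e', e2⟩ := h.mem_preds.1 hv'
  have : c (2 * i + 2) = c (2 * j + 2) := by
    rw [h.eq_iff] at e2 ⊢
    rw [Nat.add_mod (2 * i + 1) 1, e2, ← Nat.add_mod]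
  exact ⟨i, e, this ▸ e'⟩

/-- A large red complete bipartite graph off the cycle is impossible: the case where it is joined to
the cycle on its smaller side. -/
lemma no_red_complete_of_edge (h : Setup r bl A B X Y k c) {n : ℕ} (hn : 5 ≤ n) (hnk : n ≤ k)
    (hX : X.card = n) (hY : Y.card = n) (hb : ¬ HasCyc bl (2 * n)) {X1 Y1 : Finset V}
    (hX1 : X1 ⊆ X) (hY1 : Y1 ⊆ Y) (hXc : X1.card + 2 = n) (hYc : Y1.card + 1 = n)
    (hc : ∀ x ∈ X1, ∀ y ∈ Y1, r x y) {x : V} (hx : x ∈ X1) {i0 : ℕ} (e : r x (c (2 * i0))) :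
    False := by
  set i := i0 + k - 3 with hi
  have e' : r x (c (2 * i + 6)) := by
    rw [show 2 * i + 6 = 2 * i0 + 2 * k by omega, h.per]
    exact e
  have hblue : ∀ y ∈ Y1, ∀ s ≤ n, bl y (c (2 * i + 1 + 2 * s)) := by
    intro y hy s hs
    refine (h.totc h.odds_sub (h.YB (hY1 hy)) _ ?_).resolve_left
      (h.no_red_window hX1 hY1 hc hn hnk (by omega) (by omega) hx hy e' hs)
    exact h.mem_odds.2 ⟨i + s, by congr 1; omega⟩
  obtain ⟨y', hy', hyY⟩ := Finset.exists_mem_notMem_of_card_lt_card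
    (show Y1.card < Y.card by omega)
  have hdy := h.swap.deg_lt (by omega) (by omega) hb hy'
  have hby := h.blue_odds hy'
  have fin : ∀ T ⊆ evens k (fun i => c (i + 1)), T.card = n →
      (∀ t ∈ T, ∃ s ≤ n, t = c (2 * i + 1 + 2 * s)) → 2 ≤ (nb bl y' T).card → False := by
    intro T hT hTc hTw h2
    refine hb (h.bb.swap.ham_one_extra (hY1.trans h.YB) (hT.trans h.odds_sub) (by omega) hYc hTc ?_
      (h.YB hy') hyY h2)
    intro y hy t ht
    obtain ⟨s, hs, rfl⟩ := hTw t ht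
    exact hblue y hy s hs
  rcases hnk.eq_or_lt with rfl | hlt
  · rcases Nat.lt_or_ge (nb bl y' (evens n fun i => c (i + 1))).card 2 with h2 | h2
    · obtain ⟨t, ht, t', ht', hne, h3, h4⟩ := h.swap.dominating hn hX hb (Z := {y'})
        (by simpa using hy') (Finset.mem_singleton_self _) (by simp) (by omega)
        (by simp only [Finset.card_singleton]; omega) (by
          intro y _ z hz z' hz' _ _
          simp at hz hz'
          rw [hz, hz'])
      rw [h.evens_shift] at ht ht'
      have key : ∀ t, n ≤ (nb r t X).card + 1 → 2 ≤ (nb r t X1).card := by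
        intro t ht
        have h5 : nb r t X ⊆ nb r t X1 ∪ (X \ X1) := by
          intro v hv
          simp at hv ⊢
          tauto
        have h6 := (Finset.card_le_card h5).trans (Finset.card_union_le _ _)
        rw [Finset.card_sdiff_of_subset hX1] at h6
        omega
      obtain ⟨x1, hx1⟩ := Finset.card_pos.1 (lt_of_lt_of_le (by norm_num) (key t h3))
      obtain ⟨x2, hx2, hne'⟩ := Finset.exists_mem_ne (lt_of_lt_of_le (by norm_num) (key t' h4)) x1
      rw [mem_nb] at hx1 hx2
      exact h.no_two_edges hX1 hY1 hc (by omega) (by omega) hx1.1 hx2.1 hne'.symm ht ht' hne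
        (h.rb.symm hx1.2) (h.rb.symm hx2.2)
    · refine fin _ subset_rfl h.card_odds ?_ h2
      intro t ht
      obtain ⟨j, rfl⟩ := h.mem_odds.1 ht
      obtain ⟨s, hs, -, es, -⟩ := h.mod_two (j + i * n - i)
      have h0 : i ≤ i * n := Nat.le_mul_of_pos_right _ (by omega)
      refine ⟨s, hs.le, ?_⟩
      have e1 : c (2 * i + (2 * s + 1)) = c (2 * i + (2 * (j + i * n - i) + 1)) := by
        rw [h.eq_iff] at es ⊢
        rw [Nat.add_mod, es, ← Nat.add_mod]
      rw [show 2 * i + 1 + 2 * s = 2 * i + (2 * s + 1) by omega, e1,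
        show 2 * i + (2 * (j + i * n - i) + 1) = 2 * j + 1 + i * (2 * n) by
        have : i + (j + i * n - i) = j + i * n := by omega
        rw [← add_assoc, ← Nat.mul_add, this]; ring, h.per_mul]
  · set W := (Finset.range (n + 1)).image (fun s => c (2 * i + 1 + 2 * s)) with hW
    have hWo : W ⊆ evens k (fun i => c (i + 1)) := by
      intro v hv
      simp [hW] at hv
      obtain ⟨s, -, rfl⟩ := hv
      exact h.mem_odds.2 ⟨i + s, by congr 1; omega⟩
    have hWc : W.card = n + 1 := by
      rw [hW, Finset.card_image_of_injOn, Finset.card_range]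
      intro a ha b hb e
      simp at ha hb
      dsimp at e
      rcases le_total a b with hab | hab
      · have := h.inj_near e (by omega) (by omega); omega
      · have := h.inj_near e.symm (by omega) (by omega); omega
    have h2 : 2 ≤ (nb bl y' W).card := by
      have h3 := card_le_add (h.totc (hWo.trans h.odds_sub) (h.YB hy'))
      have h4 := Finset.card_le_card (nb_mono (r := r) (y := y') hWo)
      change (nb r y' (evens k fun i => c (i + 1))).card + 1 ≤ n at hdy
      omega
    obtain ⟨D, hD, hDc⟩ := Finset.exists_subset_card_eq h2
    obtain ⟨T, hDT, hTW, hTc⟩ := Finset.exists_subsuperset_card_eq (hD.trans nb_subset)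
      (show D.card ≤ n by omega) (show n ≤ W.card by omega)
    refine fin T (hTW.trans hWo) hTc ?_ ?_
    · intro t ht
      have := hTW ht
      simp only [hW, Finset.mem_image, Finset.mem_range] at this
      obtain ⟨s, hs, rfl⟩ := this
      exact ⟨s, by omega, rfl⟩
    · rw [← hDc]
      refine Finset.card_le_card fun v hv => ?_
      exact mem_nb.2 ⟨hDT hv, (mem_nb.1 (hD hv)).2⟩

lemma no_red_complete (h : Setup r bl A B X Y k c) {n : ℕ} (hn : 5 ≤ n) (hnk : n ≤ k)
    (hX : X.card = n) (hY : Y.card = n) (hb : ¬ HasCyc bl (2 * n)) {X1 Y1 : Finset V}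
    (hX1 : X1 ⊆ X) (hY1 : Y1 ⊆ Y) (hXc : n ≤ X1.card + 2) (hYc : n ≤ Y1.card + 1)
    (hc : ∀ x ∈ X1, ∀ y ∈ Y1, r x y) : False := by
  wlog hXe : X1.card + 2 = n generalizing X1
  · obtain ⟨X2, hX2, hX2c⟩ := Finset.exists_subset_card_eq (show n - 2 ≤ X1.card by omega)
    exact this (hX2.trans hX1) (by omega) (fun x hx => hc x (hX2 hx)) (by omega)
  wlog hYe : Y1.card + 1 = n generalizing Y1
  · obtain ⟨Y2, hY2, hY2c⟩ := Finset.exists_subset_card_eq (show n - 1 ≤ Y1.card by omega)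
    exact this (hY2.trans hY1) (by omega) (fun x hx y hy => hc x hx y (hY2 hy)) (by omega)
  by_cases hE : ∃ x ∈ X1, ∃ i, r x (c (2 * i))
  · obtain ⟨x, hx, i, e⟩ := hE
    exact h.no_red_complete_of_edge hn hnk hX hY hb hX1 hY1 hXe hYe hc hx e
  push Not at hE
  have hblue : ∀ x ∈ X1, ∀ b ∈ evens k c, bl x b := by
    intro x hx b hb'
    obtain ⟨i, rfl⟩ := h.mem_evens.1 hb'
    exact (h.tot x (h.XA (hX1 hx)) _ (h.even i)).resolve_left (hE x hx i)
  have hz : ∃ z z', z ∈ X ∧ z' ∈ X ∧ z ∉ X1 ∧ z' ∉ X1 ∧ z ≠ z' := by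
    have : 1 < (X \ X1).card := by rw [Finset.card_sdiff_of_subset hX1]; omega
    obtain ⟨z, hz, z', hz', hne⟩ := Finset.one_lt_card.1 this
    rw [Finset.mem_sdiff] at hz hz'
    exact ⟨z, z', hz.1, hz'.1, hz.2, hz'.2, hne⟩
  obtain ⟨z, z', hzX, hzX', hz1, hz1', hne⟩ := hz
  have hdeg : ∀ z ∈ X, (nb r z (evens k c)).card + 1 ≤ n :=
    fun z hz => h.deg_lt (by omega) (by omega) hb hz
  have hsum : ∀ z ∈ X, k ≤ (nb r z (evens k c)).card + (nb bl z (evens k c)).card := by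
    intro z hz
    have := h.swap.blue_odds hz
    rwa [h.evens_shift] at this
  have hsum' : ∀ z ∈ X, (nb r z (evens k c)).card + 2 ≤ k ∨ 2 ≤ (nb bl z (evens k c)).card →
      2 ≤ (nb bl z (evens k c)).card := by
    intro z hz h1
    have := hsum z hz
    omega
  -- a dominating pair on the cycle is impossible
  have dom : ∀ Z ⊆ X, k = n → ∀ z0 ∈ Z, (∀ z ∈ Z, nb r z (evens k c) = nb r z0 (evens k c)) →
      0 < (nb r z0 (evens k c)).card → (nb r z0 (evens k c)).card + Z.card = k →
      (∀ y ∈ Y, ∀ z ∈ Z, ∀ z' ∈ Z, r y z → r y z' → z = z') → False := by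
    intro Z hZ hkn z0 hz0 hS hS0 hSc hu
    obtain ⟨t, ht, t', ht', hne, h3, h4⟩ := h.dominating (by omega) (by omega) (by rwa [hkn]) hZ hz0
      hS hS0 hSc hu
    have key : ∀ t, k ≤ (nb r t Y).card + 1 → 2 ≤ (nb r t Y1).card := by
      intro t ht
      have h5 : nb r t Y ⊆ nb r t Y1 ∪ (Y \ Y1) := by
        intro v hv
        simp at hv ⊢
        tauto
      have h6 := (Finset.card_le_card h5).trans (Finset.card_union_le _ _)
      rw [Finset.card_sdiff_of_subset hY1] at h6
      omega
    obtain ⟨y1, hy1⟩ := Finset.card_pos.1 (lt_of_lt_of_le (by norm_num) (key t h3))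
    obtain ⟨y2, hy2, hne'⟩ := Finset.exists_mem_ne (lt_of_lt_of_le (by norm_num) (key t' h4)) y1
    rw [mem_nb] at hy1 hy2
    exact h.swap.no_two_edges hY1 hX1 (fun y hy x hx => h.rb.symm (hc x hx y hy)) (by omega)
      (by omega) hy1.1 hy2.1 hne'.symm ht ht' hne (h.rb.symm hy1.2) (h.rb.symm hy2.2)
  have single : ∀ z ∈ X, 2 ≤ (nb bl z (evens k c)).card := by
    intro z hz
    by_contra hlt
    have h1 := hsum z hz
    have h2 := hdeg z hz
    refine dom {z} (by simpa using hz) (by omega) z (by simp) (by simp) (by omega)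
      (by simp only [Finset.card_singleton]; omega) ?_
    intro y _ a ha b hb' _ _
    simp at ha hb'
    rw [ha, hb']
  have s1 := single z hzX
  have s2 := single z' hzX'
  rcases Nat.lt_or_ge (nb bl z (evens k c) ∪ nb bl z' (evens k c)).card 3 with h3 | h3
  · -- the two remaining vertices have the same neighbourhood
    have e1 : nb bl z (evens k c) = nb bl z (evens k c) ∪ nb bl z' (evens k c) :=
      Finset.eq_of_subset_of_card_le Finset.subset_union_left (by omega)
    have e2 : nb bl z' (evens k c) = nb bl z (evens k c) ∪ nb bl z' (evens k c) :=
      Finset.eq_of_subset_of_card_le Finset.subset_union_right (by omega)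
    have hbb : nb bl z (evens k c) = nb bl z' (evens k c) := by rw [e1, ← e2]
    have hb2 : (nb bl z (evens k c)).card = 2 := by rw [← e1] at h3; omega
    have hr : ∀ z ∈ X, nb r z (evens k c) = evens k c \ nb bl z (evens k c) := by
      intro z hz
      ext v
      rw [Finset.mem_sdiff, mem_nb, mem_nb]
      constructor
      · exact fun hv => ⟨hv.1, fun hv' => h.excl hv.2 hv'.2⟩
      · exact fun hv => ⟨hv.1, (h.tot z (h.XA hz) v (h.evens_sub hv.1)).resolve_right
          fun hv' => hv.2 ⟨hv.1, hv'⟩⟩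
    have hrr : nb r z' (evens k c) = nb r z (evens k c) := by rw [hr z' hzX', hr z hzX, hbb]
    have hrc : (nb r z (evens k c)).card + 2 = k := by
      rw [hr z hzX, Finset.card_sdiff_of_subset nb_subset, hb2, h.card_evens]
      omega
    have hex : ∀ y' ∈ Y, r z y' → ¬ r z' y' := by
      intro y' hy' f1 f2
      obtain ⟨i, g1, g2⟩ := h.exists_consecutive (z := z) (by omega)
      exact h.no_cherry (h.Xoff z hzX) (h.Xoff z' hzX') (h.Yoff y' hy') hne (h.xy_ne hzX hy')
        (h.xy_ne hzX' hy') f1 f2 g1 ((h.r_iff_of_nb hrr (i + 1)).2 g2)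
    have hdz := hdeg z hzX
    have hu : ∀ y ∈ Y, ∀ a ∈ ({z, z'} : Finset V), ∀ b ∈ ({z, z'} : Finset V), r y a → r y b →
        a = b := by
      intro y hy a ha b hb' f1 f2
      simp at ha hb'
      rcases ha with rfl | rfl <;> rcases hb' with rfl | rfl
      · rfl
      · exact absurd (h.rb.symm f2) (hex y hy (h.rb.symm f1))
      · exact absurd (h.rb.symm f1) (hex y hy (h.rb.symm f2))
      · rfl
    have hZ : ({z, z'} : Finset V) ⊆ X := by
      intro v hv
      simp at hv
      rcases hv with rfl | rfl <;> assumption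
    have hZc : ({z, z'} : Finset V).card = 2 := Finset.card_pair hne
    rcases hnk.eq_or_lt with hkn | hkn
    · refine dom {z, z'} hZ hkn.symm z (by simp) ?_ (by omega) (by omega) hu
      intro v hv
      simp at hv
      rcases hv with rfl | rfl
      · rfl
      · exact hrr
    · have e3 := h.succs_congr hrr
      have hnz : z' ∉ insert z (succs r k c z) := by
        simp only [Finset.mem_insert, not_or]
        exact ⟨hne.symm, fun hh => h.off_odds (h.Xoff z' hzX') (h.succs_sub hh)⟩
      refine hb (h.cyc_of_miss (T := insert z' (insert z (succs r k c z)))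
        (Finset.insert_subset (h.XA hzX') (h.insert_sub hzX)) (by omega) hY.ge ?_ ?_)
      · rw [Finset.card_insert_of_notMem hnz, h.card_insert_succs hzX]
        omega
      · intro y hy t ht t' ht' f1 f2
        have m1 := h.eq_of_red_succs hzX hy
        have m2 := h.eq_of_red_succs hzX' hy
        rw [e3] at m2
        rw [Finset.mem_insert, Finset.mem_insert] at ht ht'
        rcases ht with ht | ht | ht <;> rcases ht' with ht' | ht' | ht'
        · rw [ht, ht']
        · exact hu y hy t (by simp [ht]) t' (by simp [ht']) f1 f2
        · exact m2 t (by simp [ht]) t' (by simp [ht']) f1 f2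
        · exact hu y hy t (by simp [ht]) t' (by simp [ht']) f1 f2
        · rw [ht, ht']
        · exact m1 t (by simp [ht]) t' (by simp [ht']) f1 f2
        · exact m2 t (by simp [ht]) t' (by simp [ht']) f1 f2
        · exact m1 t (by simp [ht]) t' (by simp [ht']) f1 f2
        · exact m1 t (by simp [ht]) t' (by simp [ht']) f1 f2
  · obtain ⟨D, hD, hD5, d1, d2, d3⟩ := exists_small_witness s1 s2 h3
    have hDe : D ⊆ evens k c := hD.trans (Finset.union_subset nb_subset nb_subset)
    obtain ⟨T, hDT, hTW, hTc⟩ := Finset.exists_subsuperset_card_eq hDe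
      (show D.card ≤ n by omega) (show n ≤ (evens k c).card by rw [h.card_evens]; exact hnk)
    have hmono : ∀ z, nb bl z (evens k c) ∩ D ⊆ nb bl z T := by
      intro z v hv
      rw [Finset.mem_inter, mem_nb] at hv
      exact mem_nb.2 ⟨hDT hv.2, hv.1.2⟩
    exact hb (h.bb.ham_two_extra (hX1.trans h.XA) (hTW.trans h.evens_sub) (by omega) hXe hTc
      (fun x hx b hb' => hblue x hx b (hTW hb')) (h.XA hzX) (h.XA hzX') hz1 hz1' hne
      (d1.trans (Finset.card_le_card (hmono z))) (d2.trans (Finset.card_le_card (hmono z')))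
      (d3.trans (Finset.card_le_card (Finset.union_subset_union (hmono z) (hmono z')))))

end Setup

/-- Two rows in `Y` which are not joined by a path through `p` rows and columns in `T`. -/
def BadPair {V : Type} [DecidableEq V] (r : V → V → Prop) (Y T : Finset V) (p : ℕ) (u v : V) :
    Prop :=
  u ∈ Y ∧ v ∈ Y ∧ u ≠ v ∧ ¬ PathIn r Y T u v p

section BadPair

variable {V : Type} [DecidableEq V] {r : V → V → Prop} {Y T : Finset V} {p : ℕ}

lemma BadPair.symm (hr : ∀ {u v}, r u v → r v u) {u v : V} (h : BadPair r Y T p u v) :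
    BadPair r Y T p v u :=
  ⟨h.2.1, h.1, h.2.2.1.symm, fun hp => h.2.2.2 (hp.symm hr)⟩

lemma BadPair.unique (hr : ∀ y z w, y ∈ Y → z ∈ Y → w ∈ Y → y ≠ z → z ≠ w → y ≠ w →
      PathIn r Y T y z p ∨ PathIn r Y T y w p) {u v w : V}
    (h : BadPair r Y T p u v) (h' : BadPair r Y T p u w) : v = w := by
  by_contra hne
  rcases hr u v w h.1 h.2.1 h'.2.1 h.2.2.1 hne h'.2.2.1 with hp | hp
  · exact h.2.2.2 hp
  · exact h'.2.2.2 hp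

lemma BadPair.path {u v : V} (h : ¬ BadPair r Y T p u v) (hu : u ∈ Y) (hv : v ∈ Y) (hne : u ≠ v) :
    PathIn r Y T u v p := by
  by_contra hp
  exact h ⟨hu, hv, hne, hp⟩

end BadPair

section Covers

variable {V : Type} [DecidableEq V] {r bl : V → V → Prop} {X Y : Finset V}

lemma red_of_star (htot : ∀ x ∈ X, ∀ y ∈ Y, r x y ∨ bl x y)
    (hst : ∀ x ∈ X, ∀ x' ∈ X, ∀ y ∈ Y, ∀ y' ∈ Y, x ≠ x' → y ≠ y' → bl x y → ¬ bl x' y') :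
    (∃ X1 ⊆ X, X.card ≤ X1.card + 1 ∧ ∀ x ∈ X1, ∀ y ∈ Y, r x y) ∨
      ∃ Y1 ⊆ Y, Y.card ≤ Y1.card + 1 ∧ ∀ x ∈ X, ∀ y ∈ Y1, r x y := by
  rcases cover_one (fun x y => x ∈ X ∧ y ∈ Y ∧ bl x y)
    (fun x x' y y' h1 h2 h3 h4 => hst x h3.1 x' h4.1 y h3.2.1 y' h4.2.1 h1 h2 h3.2.2 h4.2.2)
    with ⟨W, hW, hE⟩ | ⟨W, hW, hE⟩
  · refine Or.inl ⟨X \ W, Finset.sdiff_subset, ?_, ?_⟩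
    · have := Finset.le_card_sdiff W X
      omega
    · intro x hx y hy
      rw [Finset.mem_sdiff] at hx
      exact (htot x hx.1 y hy).resolve_right fun hb => hx.2 (hE x y ⟨hx.1, hy, hb⟩)
  · refine Or.inr ⟨Y \ W, Finset.sdiff_subset, ?_, ?_⟩
    · have := Finset.le_card_sdiff W Y
      omega
    · intro x hx y hy
      rw [Finset.mem_sdiff] at hy
      exact (htot x hx y hy.1).resolve_right fun hb => hy.2 (hE x y ⟨hx, hy.1, hb⟩)

lemma red_of_bad {m m' : V → V → Prop} (htot : ∀ x ∈ X, ∀ y ∈ Y, r x y ∨ bl x y)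
    (hs : ∀ a b, m a b → m b a) (hu : ∀ a b c, m a b → m a c → b = c)
    (hs' : ∀ a b, m' a b → m' b a) (hu' : ∀ a b c, m' a b → m' a c → b = c)
    (hst : ∀ x ∈ X, ∀ x' ∈ X, ∀ y ∈ Y, ∀ y' ∈ Y, x ≠ x' → y ≠ y' → bl x y → bl x' y' →
      m x x' ∨ m' y y') :
    (∃ X1 ⊆ X, X.card ≤ X1.card + 2 ∧ ∀ x ∈ X1, ∀ y ∈ Y, r x y) ∨
      ∃ Y1 ⊆ Y, Y.card ≤ Y1.card + 2 ∧ ∀ x ∈ X, ∀ y ∈ Y1, r x y := by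
  rcases cover_two (fun x y => x ∈ X ∧ y ∈ Y ∧ bl x y) m m' hs hu hs' hu'
    (fun x x' y y' h1 h2 h3 h4 => hst x h3.1 x' h4.1 y h3.2.1 y' h4.2.1 h1 h2 h3.2.2 h4.2.2)
    with ⟨W, hW, hE⟩ | ⟨W, hW, hE⟩
  · refine Or.inl ⟨X \ W, Finset.sdiff_subset, ?_, ?_⟩
    · have := Finset.le_card_sdiff W X
      omega
    · intro x hx y hy
      rw [Finset.mem_sdiff] at hx
      exact (htot x hx.1 y hy).resolve_right fun hb => hx.2 (hE x y ⟨hx.1, hy, hb⟩)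
  · refine Or.inr ⟨Y \ W, Finset.sdiff_subset, ?_, ?_⟩
    · have := Finset.le_card_sdiff W Y
      omega
    · intro x hx y hy
      rw [Finset.mem_sdiff] at hy
      exact (htot x hx y hy.1).resolve_right fun hb => hy.2 (hE x y ⟨hx, hy.1, hb⟩)

end Covers

namespace Setup

variable {V : Type} {r bl : V → V → Prop} {A B X Y : Finset V} {k : ℕ}
  {c : ℕ → V}

lemma totXY (h : Setup r bl A B X Y k c) {X0 Y0 : Finset V} (hX : X0 ⊆ X) (hY : Y0 ⊆ Y) :
    ∀ x ∈ X0, ∀ y ∈ Y0, r x y ∨ bl x y :=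
  fun x hx y hy => h.tot x (h.XA (hX hx)) y (h.YB (hY hy))

variable [DecidableEq V]

/-- The columns `x` and its successors avoid the rest of `X`. -/
lemma disj_succs (h : Setup r bl A B X Y k c) {x : V} {X0 : Finset V} (hX0 : X0 ⊆ X) (hx : x ∉ X0) :
    Disjoint X0 (insert x (succs r k c x)) := by
  rw [Finset.disjoint_left]
  intro v hv hv'
  rw [Finset.mem_insert] at hv'
  rcases hv' with rfl | hv'
  · exact hx hv
  · exact h.off_odds (h.Xoff v (hX0 hv)) (h.succs_sub hv')

lemma disj_odds (h : Setup r bl A B X Y k c) {X0 : Finset V} (hX0 : X0 ⊆ X) :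
    Disjoint X0 (evens k (fun i => c (i + 1))) :=
  Finset.disjoint_left.2 fun v hv hv' => h.off_odds (h.Xoff v (hX0 hv)) hv'

lemma sub_odds_swap (h : Setup r bl A B X Y k c) {y : V} :
    succs r k (fun i => c (i + 1)) y ⊆ evens k c := by
  have := h.swap.succs_sub (x := y)
  rwa [h.evens_shift] at this

lemma star_absurd (h : Setup r bl A B X Y k c) {n : ℕ} (hn : 5 ≤ n) (hnk : n ≤ k)
    (hX : X.card = n) (hY : Y.card = n) (hb : ¬ HasCyc bl (2 * n)) {X0 Y0 : Finset V}
    (hX0 : X0 ⊆ X) (hY0 : Y0 ⊆ Y) (hXc : n ≤ X0.card + 1) (hYc : n ≤ Y0.card + 1)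
    (hst : ∀ x ∈ X0, ∀ x' ∈ X0, ∀ y ∈ Y0, ∀ y' ∈ Y0, x ≠ x' → y ≠ y' → bl x y → ¬ bl x' y') :
    False := by
  rcases red_of_star (h.totXY hX0 hY0) hst with ⟨X1, h1, h2, h3⟩ | ⟨Y1, h1, h2, h3⟩
  · exact h.no_red_complete hn hnk hX hY hb (h1.trans hX0) hY0 (by omega) hYc h3
  · exact h.swap.no_red_complete hn hnk hY hX hb (h1.trans hY0) hX0 (by omega) hXc
      (fun y hy x hx => h.rb.symm (h3 x hx y hy))

lemma core_small (h : Setup r bl A B X Y k c) {n : ℕ} (hn : 5 ≤ n) (hnk : n ≤ k)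
    (hX : X.card = n) (hY : Y.card = n) (hb : ¬ HasCyc bl (2 * n)) {d : ℕ}
    (hd : ∀ y ∈ Y, (nb r y (evens k (fun i => c (i + 1)))).card ≤ d) {y0 : V} (hy0 : y0 ∈ Y)
    (hyd : (nb r y0 (evens k (fun i => c (i + 1)))).card = d) (hdk : 2 * d + 2 ≤ k) : False := by
  have hYe : (Y.erase y0).card = n - 1 := by rw [Finset.card_erase_of_mem hy0, hY]
  have hsub := Finset.erase_subset y0 Y
  have hdn := h.swap.deg_lt (by omega) (by omega) hb hy0
  change (nb r y0 (evens k fun i => c (i + 1))).card + 1 ≤ n at hdn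
  rcases Nat.lt_or_ge d 2 with hd2 | hd2
  · rcases Nat.lt_or_ge (k - d) n with hkd | hkd
    · have hd1 : d = 1 := by omega
      have hkn : k = n := by omega
      subst hd1
      have hone : ∀ x ∈ X, ∀ y ∈ Y, ∀ y' ∈ Y, bl x y → bl x y' → y = y' := by
        intro x hx y hy y' hy' e e'
        by_contra hne
        exact hb (h.join_paths subset_rfl subset_rfl h.odds_sub (Finset.empty_subset _)
          (Finset.disjoint_empty_right _) (h.disj_odds subset_rfl)
          (h.path_odds subset_rfl hd hy hy' hne (p := n) (by omega) (by omega) (by omega)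
            (by omega)) (PathIn.one hx) e e' rfl)
      obtain ⟨t, ht⟩ := Finset.card_pos.1
        (show 0 < (succs r k (fun i => c (i + 1)) y0).card by rw [h.swap.card_succs]; omega)
      have hte : t ∈ evens k c := h.sub_odds_swap ht
      have hblue : ∀ x ∈ X, ∀ y ∈ Y.erase y0, bl x y → bl x t := by
        intro x hx y hy e
        rw [Finset.mem_erase] at hy
        have e0 : r x y0 := (h.tot x (h.XA hx) y0 (h.YB hy0)).resolve_right
          fun e' => hy.1 (hone x hx y hy.2 y0 hy0 e e')
        exact (h.tot x (h.XA hx) t (h.evens_sub hte)).resolve_left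
          (h.swap.no_red_succs hy0 hx (h.rb.symm e0) t ht)
      have htB : {t} ⊆ B := Finset.singleton_subset_iff.2 (h.evens_sub hte)
      refine h.star_absurd hn hnk hX hY hb subset_rfl hsub (by omega) (by omega) ?_
      intro x hx x' hx' y hy y' hy' hxx hyy e e'
      refine hb (h.join_paths (T' := {t}) (q := 2) hsub subset_rfl h.odds_sub htB
        (Finset.disjoint_singleton_right.2 fun ht' => h.off_evens (h.Yoff t (hsub ht')) hte)
        (h.disj_odds subset_rfl)
        (h.path_odds hsub (fun y hy => hd y (hsub hy)) hy hy' hyy (p := n - 1) (by omega) (by omega)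
          (by omega) (by omega))
        (PathIn.two h.bb h.XA htB hx hx' hxx (Finset.mem_singleton_self t) (hblue x hx y hy e)
          (hblue x' hx' y' hy' e')) e e' (by omega))
    · refine hb (h.bb.swap.cyc h.YB h.odds_sub (K := k - d) ?_ (by rw [h.card_odds]; omega)
        (by omega) hY.ge hkd).hasCyc
      intro y hy
      have := h.blue_odds hy
      have := hd y hy
      omega
  · refine h.star_absurd hn hnk hX hY hb subset_rfl hsub (by omega) (by omega) ?_
    intro x hx x' hx' y hy y' hy' hxx hyy e e'
    exact hb (h.join_paths (q := d) hsub subset_rfl h.odds_sub (h.swap.insert_sub hy0)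
      (h.swap.disj_succs hsub (by simp)) (h.disj_odds subset_rfl)
      (h.path_odds hsub (fun y hy => hd y (hsub hy)) hy hy' hyy (p := n + 1 - d) (by omega)
        (by omega) (by omega) (by omega))
      (h.swap.path_succs hy0 subset_rfl hx hx' hxx hd2 (by omega) (by rw [hyd]; omega)
        (by rw [hyd]; omega)) e e' (by omega))

theorem core (h : Setup r bl A B X Y k c) {n : ℕ} (hn : 5 ≤ n) (hnk : n ≤ k)
    (hX : X.card = n) (hY : Y.card = n) : HasCyc bl (2 * n) := by
  by_contra hb
  obtain ⟨x0, hx0, hxm⟩ := Finset.exists_max_image X (fun x => (nb r x (evens k c)).card)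
    (Finset.card_pos.1 (by omega))
  obtain ⟨y0, hy0, hym⟩ := Finset.exists_max_image Y
    (fun y => (nb r y (evens k (fun i => c (i + 1)))).card) (Finset.card_pos.1 (by omega))
  wlog hle : (nb r y0 (evens k (fun i => c (i + 1)))).card ≤ (nb r x0 (evens k c)).card
    generalizing A B X Y c x0 y0
  · refine this h.swap hY hX y0 hy0 hym x0 hx0 ?_ ?_
    · rw [h.evens_shift]; exact hxm
    · rw [h.evens_shift]; omega
  generalize hd' : (nb r y0 (evens k (fun i => c (i + 1)))).card = d' at *
  generalize hd : (nb r x0 (evens k c)).card = d at *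
  rcases Nat.lt_or_ge k (2 * d' + 2) with hk' | hk'
  · have hXe : (X.erase x0).card = n - 1 := by rw [Finset.card_erase_of_mem hx0, hX]
    have hYe : (Y.erase y0).card = n - 1 := by rw [Finset.card_erase_of_mem hy0, hY]
    have hdn := h.deg_lt (by omega) (by omega) hb hx0
    have hsX := Finset.erase_subset x0 X
    have hsY := Finset.erase_subset y0 Y
    have fin : ∀ p q, 2 ≤ p → 2 ≤ q → p + q = n + 1 → p ≤ d + 1 → q ≤ d' + 1 → 3 ≤ d →
        3 ≤ d' ∨ q = 2 → False := by
      intro p q hp hq hpq hpd hqd hd3 hd3'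
      refine h.star_absurd hn hnk hX hY hb hsX hsY (by omega) (by omega) ?_
      intro x hx x' hx' y hy y' hy' hxx hyy e e'
      exact hb (h.join_paths hsY hsX (h.insert_sub hx0) (h.swap.insert_sub hy0)
        (h.swap.disj_succs hsY (by simp)) (h.disj_succs hsX (by simp))
        (h.path_succs hx0 hsY hy hy' hyy hp (by omega) (by omega) (by omega))
        (h.swap.path_succs hy0 hsX hx hx' hxx hq (by omega) (by omega) (by omega)) e e' hpq)
    rcases Nat.lt_or_ge d' 3 with h3 | h3
    · have hk5 : k = 5 := by omega
      have hn5 : n = 5 := by omega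
      rcases Nat.lt_or_ge d 3 with h4 | h4
      · have hd2 : d = 2 := by omega
        have hd2' : d' = 2 := by omega
        subst hd2 hd2' hk5 hn5
        have e1 := h.evens_shift
        rcases red_of_bad (h.totXY subset_rfl subset_rfl) (m := BadPair bl X (evens 5 c) 3)
          (m' := BadPair bl Y (evens 5 fun i => c (i + 1)) 3)
          (fun a b hab => hab.symm h.bb.symm)
          (fun a b c' hab hac => hab.unique (fun y z w hy hz hw g1 g2 g3 => by
            have := h.swap.path_odds_or (d := 2) subset_rfl (by rw [e1]; exact hxm) (by omega)
              (by omega) hy hz hw g1 g2 g3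
            rwa [e1] at this) hac)
          (fun a b hab => hab.symm h.bb.symm)
          (fun a b c' hab hac => hab.unique (fun y z w hy hz hw g1 g2 g3 =>
            h.path_odds_or (d := 2) subset_rfl hym (by omega)
              (by omega) hy hz hw g1 g2 g3) hac) (by
            intro x hx x' hx' y hy y' hy' hxx hyy e e'
            by_contra hcon
            rw [not_or] at hcon
            refine hb (h.join_paths subset_rfl subset_rfl h.odds_sub h.evens_sub ?_
              (h.disj_odds subset_rfl) (BadPair.path hcon.2 hy hy' hyy)
              (BadPair.path hcon.1 hx hx' hxx) e e' rfl)
            have := h.swap.disj_odds (X0 := Y) subset_rfl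
            rwa [e1] at this) with ⟨X1, h1, h2, h3⟩ | ⟨Y1, h1, h2, h3⟩
        · exact h.no_red_complete hn hnk hX hY hb h1 subset_rfl (by omega) (by omega) h3
        · exact h.swap.no_red_complete hn hnk hY hX hb h1 subset_rfl (by omega) (by omega)
            (fun y hy x hx => h.rb.symm (h3 x hx y hy))
      · exact fin 4 2 (by omega) (by omega) (by omega) (by omega) (by omega) h4 (Or.inr rfl)
    · rcases le_total (d' + 1) (n - 1) with h5 | h5
      · exact fin (n - d') (d' + 1) (by omega) (by omega) (by omega) (by omega) (by omega)
          (by omega) (Or.inl h3)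
      · exact fin 2 (n - 1) (by omega) (by omega) (by omega) (by omega) (by omega)
          (by omega) (Or.inl h3)
  · exact h.core_small hn hnk hX hY hb hym hy0 hd' hk'

end Setup

namespace Setup

variable {V : Type} {r bl : V → V → Prop} {A B X Y : Finset V} {k : ℕ}
  {c : ℕ → V} [DecidableEq V]

lemma B_eq (h : Setup r bl A B X Y k c) : B = Y ∪ evens k c := by
  ext b
  rw [Finset.mem_union]
  constructor
  · intro hb
    rcases h.BY b hb with hY | ⟨i, rfl⟩
    · exact Or.inl hY
    · rcases Nat.even_or_odd' i with ⟨j, rfl | rfl⟩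
      · exact Or.inr (h.mem_evens.2 ⟨j, rfl⟩)
      · exact absurd hb (Finset.disjoint_left.1 h.rb.disj (h.odd j))
  · rintro (hb | hb)
    · exact h.YB hb
    · exact h.evens_sub hb

lemma card_B (h : Setup r bl A B X Y k c) : B.card = Y.card + k := by
  have hd : Disjoint Y (evens k c) :=
    Finset.disjoint_left.2 fun v hv hv' => h.off_evens (h.Yoff v hv) hv'
  rw [h.B_eq, Finset.card_union_of_disjoint hd, h.card_evens]

/-- Two vertices off the red complete graph with few red neighbours in it. -/
lemma exists_two_blue (h : Setup r bl A B X Y k c) (hk : 4 ≤ k) (hX : X.card = k + 2)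
    {X1 Y1 : Finset V} (hX1 : X1 ⊆ X) (hY1 : Y1 ⊆ Y) (hXc : X1.card + 2 = k + 1)
    (hYc : Y1.card = k + 1) (hc : ∀ x ∈ X1, ∀ y ∈ Y1, r x y) :
    ∃ z ∈ X, ∃ z' ∈ X, z ≠ z' ∧ k ≤ (nb bl z Y1).card + 1 ∧ k ≤ (nb bl z' Y1).card + 1 := by
  classical
  set F := (X \ X1).filter fun z => 3 ≤ (nb r z Y1).card with hF
  have hF1 : F.card ≤ 1 := by
    rw [Finset.card_le_one]
    intro z hz z' hz'
    rw [hF, Finset.mem_filter, Finset.mem_sdiff] at hz hz'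
    by_contra hne
    refine h.nored (h.rb.ham_two_extra (n := k + 1) (hX1.trans h.XA) (hY1.trans h.YB) (by omega) hXc
      hYc hc (h.XA hz.1.1) (h.XA hz'.1.1) hz.1.2 hz'.1.2 hne (by omega) (by omega) ?_)
    exact hz.2.trans (Finset.card_le_card Finset.subset_union_left)
  have h1 : 1 < ((X \ X1) \ F).card := by
    have := Finset.le_card_sdiff X1 X
    have := Finset.le_card_sdiff F (X \ X1)
    omega
  obtain ⟨z, hz, z', hz', hne⟩ := Finset.one_lt_card.1 h1
  have key : ∀ z ∈ (X \ X1) \ F, z ∈ X ∧ k ≤ (nb bl z Y1).card + 1 := by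
    intro z hz
    rw [Finset.mem_sdiff] at hz
    have hzX := (Finset.mem_sdiff.1 hz.1).1
    refine ⟨hzX, ?_⟩
    have h2 : ¬ 3 ≤ (nb r z Y1).card := fun h3 => hz.2 (Finset.mem_filter.2 ⟨hz.1, h3⟩)
    have := card_le_add (y := z) (T := Y1) (fun t ht => h.tot z (h.XA hzX) t (h.YB (hY1 ht)))
    omega
  exact ⟨z, (key z hz).1, z', (key z' hz').1, hne, (key z hz).2, (key z' hz').2⟩

lemma blue_cyc_of_extra (h : Setup r bl A B X Y k c) (hk : 4 ≤ k) {Y' : Finset V} (hY' : Y' ⊆ Y)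
    (hY'c : Y'.card = k) (hc : ∀ y ∈ Y', ∀ a ∈ evens k (fun i => c (i + 1)), bl y a) {z z' : V}
    (hz : z ∈ X) (hz' : z' ∈ X) (hne : z ≠ z') (hzd : k ≤ (nb bl z Y').card + 2)
    (hzd' : k ≤ (nb bl z' Y').card + 2) {u : V} (hu : u ∈ B) (huY : u ∉ Y')
    (hud : 2 ≤ (nb bl u (insert z (insert z' (evens k (fun i => c (i + 1)))))).card) :
    HasCyc bl (2 * (k + 1)) := by
  set T := evens k (fun i => c (i + 1)) with hT
  have hTc : T.card = k := h.card_odds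
  have hzT : ∀ z ∈ X, z ∉ T := fun z hz => h.off_odds (h.Xoff z hz)
  have hY'B := hY'.trans h.YB
  have hrc : ∀ z ∈ X, k ≤ (nb bl z Y').card + 2 → 2 ≤ (nb bl u (insert z T)).card →
      HasCyc bl (2 * (k + 1)) := by
    intro z hz hzd h2
    exact h.bb.swap.ham_row_col (T := T) hY'B h.odds_sub (by omega) (by omega) (by omega) hc hu
      (h.XA hz) huY
      (hzT z hz) h2 (by omega)
  by_cases h1 : 2 ≤ (nb bl u (insert z T)).card
  · exact hrc z hz hzd h1
  by_cases h2 : 2 ≤ (nb bl u (insert z' T)).card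
  · exact hrc z' hz' hzd' h2
  have e1 : (nb bl u (insert z T)).card + 1 ≤ (nb bl u (insert z (insert z' T))).card := by omega
  have hsub : nb bl u (insert z (insert z' T)) ⊆ insert z' (nb bl u (insert z T)) := by
    intro v
    simp only [mem_nb, Finset.mem_insert]
    tauto
  have hsub' : nb bl u (insert z (insert z' T)) ⊆ insert z (nb bl u (insert z' T)) := by
    intro v
    simp only [mem_nb, Finset.mem_insert]
    tauto
  have huz' : bl u z' := by
    by_contra hcon
    have : nb bl u (insert z (insert z' T)) ⊆ nb bl u (insert z T) := by
      intro v hv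
      rcases Finset.mem_insert.1 (hsub hv) with rfl | hv'
      · exact absurd (mem_nb.1 hv).2 hcon
      · exact hv'
    have := Finset.card_le_card this
    omega
  have huz : bl u z := by
    by_contra hcon
    have : nb bl u (insert z (insert z' T)) ⊆ nb bl u (insert z' T) := by
      intro v hv
      rcases Finset.mem_insert.1 (hsub' hv) with rfl | hv'
      · exact absurd (mem_nb.1 hv).2 hcon
      · exact hv'
    have := Finset.card_le_card this
    omega
  obtain ⟨T1, hT1, hT1c⟩ := Finset.exists_subset_card_eq (show k - 1 ≤ T.card by omega)
  have hz'T : z' ∉ T1 := fun hm => hzT z' hz' (hT1 hm)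
  have hzT' : z ∉ insert z' T1 := by
    rw [Finset.mem_insert]
    rintro (e | hm)
    · exact hne e
    · exact hzT z hz (hT1 hm)
  set T2 := insert z (insert z' T1) with hT2
  have hT2A : T2 ⊆ A := Finset.insert_subset (h.XA hz)
    (Finset.insert_subset (h.XA hz') (hT1.trans h.odds_sub))
  have hT2c : T2.card = k + 1 := by
    rw [hT2, Finset.card_insert_of_notMem hzT', Finset.card_insert_of_notMem hz'T]
    omega
  refine (h.bb.swap.ham_of_degree (Y := insert u Y') (T := T2) (n := k + 1)
    (Finset.insert_subset hu hY'B) hT2A (by omega) (by rw [Finset.card_insert_of_notMem huY]; omega)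
    hT2c ?_).hasCyc
  have hrowu : 2 ≤ (nb bl u T2).card := by
    have : ({z, z'} : Finset V) ⊆ nb bl u T2 := by
      intro v hv
      simp only [Finset.mem_insert, Finset.mem_singleton] at hv
      rcases hv with rfl | rfl
      · exact mem_nb.2 ⟨by simp [hT2], huz⟩
      · exact mem_nb.2 ⟨by simp [hT2], huz'⟩
    have := Finset.card_le_card this
    rwa [Finset.card_pair hne] at this
  have hrow : ∀ y ∈ Y', k - 1 ≤ (nb bl y T2).card := by
    intro y hy
    rw [← hT1c]
    exact Finset.card_le_card fun t ht => mem_nb.2 ⟨by simp [hT2, ht], hc y hy t (hT1 ht)⟩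
  have hcolz : ∀ z ∈ X, bl u z → k ≤ (nb bl z Y').card + 2 →
      k ≤ (nb bl z (insert u Y')).card + 1 := by
    intro z hz e hd
    have : insert u (nb bl z Y') ⊆ nb bl z (insert u Y') := by
      intro v hv
      rcases Finset.mem_insert.1 hv with rfl | hv'
      · exact mem_nb.2 ⟨by simp, h.bb.symm e⟩
      · exact nb_mono (Finset.subset_insert _ _) hv'
    have := Finset.card_le_card this
    rw [Finset.card_insert_of_notMem fun hm => huY (nb_subset hm)] at this
    omega
  have hcolT : ∀ t ∈ T1, k ≤ (nb bl t (insert u Y')).card := by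
    intro t ht
    rw [← hY'c]
    exact Finset.card_le_card fun y hy => mem_nb.2 ⟨by simp [hy], h.bb.symm (hc y hy t (hT1 ht))⟩
  intro y hy t ht
  rw [hT2, Finset.mem_insert, Finset.mem_insert] at ht
  rcases Finset.mem_insert.1 hy with rfl | hy'
  · rcases ht with rfl | rfl | ht
    · exact Or.inl huz
    · exact Or.inl huz'
    · right
      have := hcolT t ht
      omega
  · have h3 := hrow y hy'
    rcases ht with rfl | rfl | ht
    · have := hcolz t hz huz hzd
      omega
    · have := hcolz t hz' huz' hzd'
      omega
    · exact Or.inl (hc y hy' t (hT1 ht))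

/-- A large red complete graph off the cycle, in the setting where `C_{2k+2}` is forbidden in both
colours. -/
lemma no_red_complete_two (h : Setup r bl A B X Y k c) (hk : 4 ≤ k) (hX : X.card = k + 2)
    (hY : Y.card = k + 2) (hb : ¬ HasCyc bl (2 * (k + 1))) {X1 Y1 : Finset V} (hX1 : X1 ⊆ X)
    (hY1 : Y1 ⊆ Y) (hXc : k ≤ X1.card + 1) (hYc : k + 1 ≤ Y1.card)
    (hc : ∀ x ∈ X1, ∀ y ∈ Y1, r x y) : False := by
  wlog hXe : X1.card + 2 = k + 1 generalizing X1
  · obtain ⟨X2, hX2, hX2c⟩ := Finset.exists_subset_card_eq (show k - 1 ≤ X1.card by omega)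
    exact this (hX2.trans hX1) (by omega) (fun x hx => hc x (hX2 hx)) (by omega)
  wlog hYe : Y1.card = k + 1 generalizing Y1
  · obtain ⟨Y2, hY2, hY2c⟩ := Finset.exists_subset_card_eq hYc
    exact this (hY2.trans hY1) (by omega) (fun x hx y hy => hc x hx y (hY2 hy)) hY2c
  obtain ⟨z, hz, z', hz', hne, hzd, hzd'⟩ := h.exists_two_blue hk hX hX1 hY1 hXe hYe hc
  set T := evens k (fun i => c (i + 1)) with hT
  have hTc : T.card = k := h.card_odds
  have hTA : T ⊆ A := h.odds_sub
  have hzT : ∀ z ∈ X, z ∉ T := fun z hz => h.off_odds (h.Xoff z hz)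
  have hYB := hY1.trans h.YB
  have htot : ∀ y ∈ Y1, ∀ a ∈ T, r y a ∨ bl y a := fun y hy => h.totc h.odds_sub (hYB hy)
  rcases cover_one (fun y a => y ∈ Y1 ∧ a ∈ T ∧ r y a) (fun y y' a a' h1 h2 h3 h4 =>
    h.swap.no_two_edges hY1 hX1 (fun y hy x hx => h.rb.symm (hc x hx y hy)) (by omega) (by omega)
      h3.1 h4.1 h1 h3.2.1 h4.2.1 h2 h3.2.2 h4.2.2) with ⟨W, hW, hE⟩ | ⟨W, hW, hE⟩
  · obtain ⟨Y', hY', hY'c⟩ := Finset.exists_subset_card_eq (s := Y1 \ W) (n := k)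
      (by have := Finset.le_card_sdiff W Y1; omega)
    have hY'1 := hY'.trans Finset.sdiff_subset
    have hcb : ∀ y ∈ Y', ∀ a ∈ T, bl y a := fun y hy a ha => (htot y (hY'1 hy) a ha).resolve_left
      fun e => (Finset.mem_sdiff.1 (hY' hy)).2 (hE y a ⟨hY'1 hy, ha, e⟩)
    have hcard : ∀ z, (nb bl z Y1).card ≤ (nb bl z Y').card + 1 := by
      intro z
      have h1 : nb bl z Y1 ⊆ nb bl z Y' ∪ (Y1 \ Y') := by
        intro v
        simp only [mem_nb, Finset.mem_union, Finset.mem_sdiff]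
        tauto
      have := Finset.card_le_card h1
      have := Finset.card_union_le (nb bl z Y') (Y1 \ Y')
      have := Finset.card_sdiff_of_subset hY'1
      omega
    set T' := insert z (insert z' T) with hT'
    have hT'A : T' ⊆ A := Finset.insert_subset (h.XA hz) (Finset.insert_subset (h.XA hz') hTA)
    have hT'c : T'.card = k + 2 := by
      rw [hT', Finset.card_insert_of_notMem (by simp [hne, hzT z hz]),
        Finset.card_insert_of_notMem (hzT z' hz'), hTc]
    have hrow : ∀ u ∈ B \ Y', k + 1 ≤ (nb r u T').card := by
      intro u hu
      rw [Finset.mem_sdiff] at hu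
      have h1 : ¬ 2 ≤ (nb bl u T').card := fun h2 =>
        hb (h.blue_cyc_of_extra hk (hY'1.trans hY1) hY'c hcb hz hz' hne
          (by have := hcard z; omega) (by have := hcard z'; omega) hu.1 hu.2 h2)
      have := card_le_add (h.totc hT'A hu.1)
      omega
    have hBY : k + 2 ≤ (B \ Y').card := by
      have := Finset.le_card_sdiff Y' B
      have := h.card_B
      omega
    exact h.nored (h.rb.swap.cyc (Y := B \ Y') Finset.sdiff_subset hT'A hrow (by omega)
      (p := k + 1) (by omega) (by omega) le_rfl).hasCyc
  · obtain ⟨T1, hT1, hT1c⟩ := Finset.exists_subset_card_eq (s := T \ W) (n := k - 1)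
      (by have := Finset.le_card_sdiff W T; omega)
    have hT1T := hT1.trans Finset.sdiff_subset
    refine hb (h.bb.ham_two_extra (n := k + 1) (hT1T.trans hTA) hYB (by omega) (by omega) hYe ?_
      (h.XA hz) (h.XA hz') (fun hm => hzT z hz (hT1T hm)) (fun hm => hzT z' hz' (hT1T hm)) hne
      (by omega) (by omega)
      (le_trans (by omega) (Finset.card_le_card (Finset.subset_union_left (s₁ := nb bl z Y1)))))
    intro a ha y hy
    exact h.bb.symm ((htot y hy a (hT1T ha)).resolve_left
      fun e => (Finset.mem_sdiff.1 (hT1 ha)).2 (hE y a ⟨hy, hT1T ha, e⟩))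

end Setup

section Grow

variable {V : Type} {r : V → V → Prop} {A B Y T : Finset V}

lemma IsPth.rst (h : Bip r A B) (hY : Y ⊆ A) (hT : T ⊆ B) {u v : V} {l : List V}
    (hl : IsPth r u v l) (hw : ∀ w ∈ l, w ∈ Y ∨ w ∈ T) : IsPth (Rst r Y T) u v l := by
  refine ⟨hl.nodup, ?_, hl.head, hl.last⟩
  refine hl.chain.imp_of_mem_imp fun a b ha hb e => ⟨e, ?_⟩
  have h1 : ∀ w, w ∈ A → w ∉ B := fun w hA => Finset.disjoint_left.1 h.disj hA
  rcases hw a ha with ha | ha <;> rcases hw b hb with hb | hb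
  · exact absurd (h.lr e (hY ha)) (h1 _ (hY hb))
  · exact Or.inl ⟨ha, hb⟩
  · exact Or.inr ⟨ha, hb⟩
  · exact absurd (hT hb) (h1 _ (h.rl e (hT ha)))

variable [DecidableEq V]

lemma PathIn.four (h : Bip r A B) (hY : Y ⊆ A) (hT : T ⊆ B) {y u v y' t₁ t₂ t₃ : V} (hy : y ∈ Y)
    (hu : u ∈ Y) (hv : v ∈ Y) (hy' : y' ∈ Y) (h1 : y ≠ u) (h2 : y ≠ v) (h3 : y ≠ y') (h4 : u ≠ v)
    (h5 : u ≠ y') (h6 : v ≠ y') (ht₁ : t₁ ∈ T) (ht₂ : t₂ ∈ T) (ht₃ : t₃ ∈ T) (h12 : t₁ ≠ t₂)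
    (h13 : t₁ ≠ t₃) (h23 : t₂ ≠ t₃) (e1 : r y t₁) (e2 : r u t₁) (e3 : r u t₂) (e4 : r v t₂)
    (e5 : r v t₃) (e6 : r y' t₃) : PathIn r Y T y y' 4 := by
  have g : ∀ a ∈ Y, ∀ b ∈ T, a ≠ b := fun a ha b hb => h.ne (hY ha) (hT hb)
  refine ⟨[y, t₁, u, t₂, v, t₃, y'], ⟨?_, by simp [e1, h.symm e2, e3, h.symm e4, e5, h.symm e6],
    by simp, by simp⟩, by simp, by simp [hy, hy', ht₁, ht₂, ht₃, hu, hv]⟩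
  have := g y hy t₁ ht₁
  have := g y hy t₂ ht₂
  have := g y hy t₃ ht₃
  have := (g u hu t₁ ht₁).symm
  have := g u hu t₂ ht₂
  have := g u hu t₃ ht₃
  have := (g v hv t₁ ht₁).symm
  have := (g v hv t₂ ht₂).symm
  have := g v hv t₃ ht₃
  have := (g y' hy' t₁ ht₁).symm
  have := (g y' hy' t₂ ht₂).symm
  have := (g y' hy' t₃ ht₃).symm
  simp_all

/-- Either a path can be lengthened by a row `x`, or there are many rows with pairwise disjoint
neighbourhoods off the path. -/
lemma IsPth.grow_or (h : Bip r A B) (hY : Y ⊆ A) (hT : T ⊆ B) {l : List V} {u v x : V} {p : ℕ}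
    (hl : IsPth r u v l) (hw : ∀ w ∈ l, w ∈ Y ∪ T) (hv : v ∈ Y)
    (hp : l.length + 1 = 2 * p) (hx : x ∈ Y) (hxl : x ∉ l) :
    PathIn r Y T u v (p + 1) ∨ ∃ R ⊆ Y, R.card = (nb r x (T ∩ l.toFinset)).card + 1 ∧
      ∀ a ∈ R, ∀ b ∈ R, a ≠ b → ∀ t ∈ T \ l.toFinset, r a t → ¬ r b t := by
  have hb := h.rst hY hT
  have hrt : ∀ {a t}, a ∈ Y → t ∈ T → r a t → Rst r Y T a t := fun ha ht e => ⟨e, Or.inl ⟨ha, ht⟩⟩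
  rcases (hl.rst h hY hT fun w hw' => Finset.mem_union.1 (hw w hw')).grow hb hw hv hp hx hxl with
    h1 | ⟨f1, f2, f3, f4⟩
  · exact Or.inl (h1.imp fun _ _ e => e.1)
  right
  set S := nb r x (T ∩ l.toFinset) with hS
  have memS : ∀ {t}, t ∈ S → t ∈ T ∧ t ∈ l ∧ r x t := by
    intro t ht
    rw [hS, mem_nb, Finset.mem_inter, List.mem_toFinset] at ht
    exact ⟨ht.1.1, ht.1.2, ht.2⟩
  refine ⟨insert x (S.image l.nextOf), ?_, ?_, ?_⟩
  · rw [Finset.insert_subset_iff]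
    refine ⟨hx, ?_⟩
    intro a ha
    obtain ⟨t, ht, rfl⟩ := Finset.mem_image.1 ha
    exact (f1 t (memS ht).1 (memS ht).2.1).1
  · rw [Finset.card_insert_of_notMem, Finset.card_image_of_injOn]
    · intro t ht t' ht' e
      exact f2 t (memS ht).1 (memS ht).2.1 t' (memS ht').1 (memS ht').2.1 e
    · intro hm
      obtain ⟨t, ht, rfl⟩ := Finset.mem_image.1 hm
      exact hxl (f1 t (memS ht).1 (memS ht).2.1).2.1
  · have key : ∀ t ∈ S, ∀ s ∈ T \ l.toFinset, r x s → ¬ r (l.nextOf t) s := by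
      intro t ht s hs e e'
      rw [Finset.mem_sdiff, List.mem_toFinset] at hs
      obtain ⟨g1, g2, g3⟩ := memS ht
      exact f3 t g1 g2 (hrt hx g1 g3) s hs.1 hs.2 (hrt hx hs.1 e) (hrt (f1 t g1 g2).1 hs.1 e')
    intro a ha b hb hab s hs e e'
    rcases Finset.mem_insert.1 ha with rfl | ha
    · rcases Finset.mem_insert.1 hb with rfl | hb
      · exact hab rfl
      · obtain ⟨t, ht, rfl⟩ := Finset.mem_image.1 hb
        exact key t ht s hs e e'
    · obtain ⟨t, ht, rfl⟩ := Finset.mem_image.1 ha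
      rcases Finset.mem_insert.1 hb with rfl | hb
      · exact key t ht s hs e' e
      · obtain ⟨t', ht', rfl⟩ := Finset.mem_image.1 hb
        rw [Finset.mem_sdiff, List.mem_toFinset] at hs
        obtain ⟨g1, g2, g3⟩ := memS ht
        obtain ⟨g1', g2', g3'⟩ := memS ht'
        exact f4 t g1 g2 t' g1' g2' (fun e => hab (by rw [e])) (hrt hx g1 g3) (hrt hx g1' g3') s
          hs.1 hs.2 (hrt (f1 t g1 g2).1 hs.1 e) (hrt (f1 t' g1' g2').1 hs.1 e')

end Grow

namespace Setup

variable {V : Type} {r bl : V → V → Prop} {A B X Y : Finset V} {k : ℕ}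
  {c : ℕ → V} [DecidableEq V]

lemma path_grow (h : Setup r bl A B X Y k c) {x0 : V} (hx0 : x0 ∈ X) {d : ℕ}
    (hd : ∀ y ∈ Y, (nb r y (evens k (fun i => c (i + 1)))).card ≤ d)
    (hd0 : (nb r x0 (evens k c)).card = d) (hk : k = 2 * d + 1) (hd1 : 0 < d) {Y0 : Finset V}
    (hY0 : Y0 ⊆ Y) {y z x : V} {l : List V} (hl : IsPth bl y z l)
    (hw : ∀ w ∈ l, w ∈ Y0 ∪ insert x0 (evens k (fun i => c (i + 1))))
    (hlen : l.length + 1 = 2 * (d + 1))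
    (hy : y ∈ Y0) (hz : z ∈ Y0) (hx : x ∈ Y0) (hxl : x ∉ l) {s : ℕ} (hs2 : 2 ≤ s) (hds : d < 2 * s)
    (hs : s ≤ (nb bl x (insert x0 (evens k (fun i => c (i + 1))) ∩ l.toFinset)).card) :
    PathIn bl Y0 (insert x0 (evens k (fun i => c (i + 1)))) y z (d + 2) := by
  set O := evens k (fun i => c (i + 1)) with hO
  have hOc : O.card = k := h.card_odds
  have hx0O : x0 ∉ O := h.off_odds (h.Xoff x0 hx0)
  have hTA : insert x0 O ⊆ A := Finset.insert_subset (h.XA hx0) h.odds_sub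
  have hYB := hY0.trans h.YB
  rcases hl.grow_or h.bb.swap hYB hTA hw hz hlen hx hxl with h1 | ⟨R, hR, hRc, hdis⟩
  · exact h1
  exfalso
  have hb := h.bb.swap.rst hYB hTA
  obtain ⟨c1, -⟩ := hb.card_inter
      (hl.rst h.bb.swap hYB hTA fun w hw' => Finset.mem_union.1 (hw w hw'))
    hw hy hlen
  set L := insert x0 O ∩ l.toFinset with hL
  set F := insert x0 O \ l.toFinset with hF
  have hFL : F.card + L.card = k + 1 := by
    rw [hF, hL, Finset.card_sdiff_add_card_inter, Finset.card_insert_of_notMem hx0O, hOc]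
  by_cases hx0l : x0 ∈ l
  · have h2 : ∀ a ∈ R, 2 ≤ (nb bl a F).card := by
      intro a ha
      have e1 := h.blue_odds (hY0 (hR ha))
      have e2 := hd a (hY0 (hR ha))
      have e3 : nb bl a O ⊆ nb bl a F ∪ L.erase x0 := by
        intro t ht
        rw [mem_nb] at ht
        rw [Finset.mem_union, mem_nb, Finset.mem_erase]
        by_cases htl : t ∈ l
        · right
          refine ⟨fun e => hx0O (e ▸ ht.1), ?_⟩
          simp [hL, ht.1, htl]
        · left
          simp [hF, ht.1, htl, ht.2]
      have e4 := Finset.card_le_card e3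
      have e5 := Finset.card_union_le (nb bl a F) (L.erase x0)
      rw [Finset.card_erase_of_mem (by simp [hL, hx0l])] at e5
      change k ≤ (nb r a O).card + (nb bl a O).card at e1
      omega
    have h3 : (R.biUnion fun a => nb bl a F).card = ∑ a ∈ R, (nb bl a F).card := by
      refine Finset.card_biUnion fun a ha b hb hab => ?_
      rw [Function.onFun, Finset.disjoint_left]
      intro t ht ht'
      rw [mem_nb] at ht ht'
      exact hdis a ha b hb hab t ht.1 ht.2 ht'.2
    have h4 : (R.biUnion fun a => nb bl a F).card ≤ F.card :=
      Finset.card_le_card (Finset.biUnion_subset.2 fun a _ => nb_subset)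
    have h5 := Finset.card_nsmul_le_sum R _ 2 h2
    rw [smul_eq_mul] at h5
    omega
  · have hx0F : x0 ∈ F := by simp [hF, hx0l]
    obtain ⟨t, ht, htP⟩ : ∃ t ∈ F, t ∈ succs r k c x0 ∪ preds r k c x0 := by
      have h2 := h.card_union_succs (x := x0) (by omega) (by omega)
      obtain ⟨t, ht, htL⟩ := Finset.exists_mem_notMem_of_card_lt_card
        (show L.card < (succs r k c x0 ∪ preds r k c x0).card by omega)
      refine ⟨t, ?_, ht⟩
      have htO : t ∈ O := Finset.union_subset h.succs_sub h.preds_sub ht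
      rw [hF, Finset.mem_sdiff]
      refine ⟨Finset.mem_insert_of_mem htO, fun htl => htL ?_⟩
      rw [hL, Finset.mem_inter]
      exact ⟨Finset.mem_insert_of_mem htO, htl⟩
    have hrt : ∀ a ∈ R, r a x0 → bl a t := by
      intro a ha e
      have haY := hY0 (hR ha)
      refine (h.totc (Finset.union_subset (h.succs_sub.trans h.odds_sub)
        (h.preds_sub.trans h.odds_sub)) (h.YB haY) t htP).resolve_left ?_
      rcases Finset.mem_union.1 htP with h3 | h3
      · exact h.no_red_succs hx0 haY (h.rb.symm e) t h3
      · exact h.no_red_preds hx0 haY (h.rb.symm e) t h3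
    have hcov : R ⊆ nb r x0 R ∪ nb bl x0 R := by
      intro a ha
      rw [Finset.mem_union, mem_nb, mem_nb]
      exact (h.tot x0 (h.XA hx0) a (hYB (hR ha))).imp (fun e => ⟨ha, e⟩) (fun e => ⟨ha, e⟩)
    have h3 : (nb r x0 R).card ≤ 1 := by
      rw [Finset.card_le_one]
      intro a ha b hb
      rw [mem_nb] at ha hb
      by_contra hab
      exact hdis a ha.1 b hb.1 hab t ht (hrt a ha.1 (h.rb.symm ha.2)) (hrt b hb.1 (h.rb.symm hb.2))
    have h4 : (nb bl x0 R).card ≤ 1 := by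
      rw [Finset.card_le_one]
      intro a ha b hb
      rw [mem_nb] at ha hb
      by_contra hab
      exact hdis a ha.1 b hb.1 hab x0 hx0F (h.bb.symm ha.2) (h.bb.symm hb.2)
    have h5 := Finset.card_le_card hcov
    have h6 := Finset.card_union_le (nb r x0 R) (nb bl x0 R)
    omega

/-- Blue paths on `d + 2` rows when all degrees are at most `d = (k - 1) / 2`. -/
lemma path_extra (h : Setup r bl A B X Y k c) {x0 : V} (hx0 : x0 ∈ X) {d : ℕ}
    (hd : ∀ y ∈ Y, (nb r y (evens k (fun i => c (i + 1)))).card ≤ d)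
    (hd0 : (nb r x0 (evens k c)).card = d) (hk : k = 2 * d + 1) (hd3 : 3 ≤ d) {Y0 : Finset V}
    (hY0 : Y0 ⊆ Y) (hY0c : d + 2 ≤ Y0.card) {y z : V} (hy : y ∈ Y0) (hz : z ∈ Y0) (hne : y ≠ z) :
    PathIn bl Y0 (insert x0 (evens k (fun i => c (i + 1)))) y z (d + 2) := by
  obtain ⟨l, hl, hlen, hw⟩ := h.path_succs hx0 hY0 hy hz hne (p := d + 1) (by omega) (by omega)
    (by omega) (by omega)
  set O := evens k (fun i => c (i + 1)) with hO
  have hsub : insert x0 (succs r k c x0) ⊆ insert x0 O := Finset.insert_subset_insert _ h.succs_sub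
  have hYB := hY0.trans h.YB
  have hb := h.bb.swap.rst hYB (h.insert_sub hx0)
  obtain ⟨c1, c2⟩ := hb.card_inter
    (hl.rst h.bb.swap hYB (h.insert_sub hx0) fun w hw' => Finset.mem_union.1 (hw w hw')) hw hy hlen
  obtain ⟨x, hx, hxl⟩ : ∃ x ∈ Y0, x ∉ l := by
    by_contra! hc
    have : Y0 ⊆ Y0 ∩ l.toFinset := fun y hy => by simp [hy, hc y hy]
    have := Finset.card_le_card this
    omega
  refine h.path_grow hx0 hd hd0 hk (by omega) hY0 hl
    (fun w hw' => Finset.union_subset_union subset_rfl hsub (hw w hw')) hlen hy hz hx hxl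
    (s := d - 1)
    (by omega) (by omega) ?_
  have h1 := card_le_of_eq (y := x) (r := r) (bl := bl)
      (T := insert x0 (succs r k c x0) ∩ l.toFinset)
    (fun t ht t' ht' => h.eq_of_red_succs hx0 (hY0 hx) t (Finset.mem_inter.1 ht).1 t'
      (Finset.mem_inter.1 ht').1)
    (h.totc (Finset.inter_subset_left.trans (h.insert_sub hx0)) (hYB hx))
  have h2 := Finset.card_le_card (nb_mono (r := bl) (y := x)
    (Finset.inter_subset_inter_right (u := l.toFinset) hsub))
  change d - 1 ≤ (nb bl x (insert x0 O ∩ l.toFinset)).card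
  omega

end Setup

namespace Setup

variable {V : Type} {r bl : V → V → Prop} {A B X Y : Finset V} {k : ℕ}
  {c : ℕ → V} [DecidableEq V]

lemma exists_blue_nbr (h : Setup r bl A B X Y 5 c) {x0 : V} (hx0 : x0 ∈ X)
    (hd : ∀ y ∈ Y, (nb r y (evens 5 (fun i => c (i + 1)))).card ≤ 2)
    (hd0 : (nb r x0 (evens 5 c)).card = 2)
    (hP : 4 ≤ (succs r 5 c x0 ∪ preds r 5 c x0).card ∨ ∀ y ∈ Y,
      (succs r 5 (fun i => c (i + 1)) y ∪ preds r 5 (fun i => c (i + 1)) y).card < 4)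
    {y : V} (hy : y ∈ Y) (t : V) : ∃ v ∈ succs r 5 c x0 ∪ preds r 5 c x0, v ≠ t ∧ bl y v := by
  have hPO : succs r 5 c x0 ∪ preds r 5 c x0 ⊆ evens 5 (fun i => c (i + 1)) :=
    Finset.union_subset h.succs_sub h.preds_sub
  by_contra! hcon
  have hred : ∀ v ∈ succs r 5 c x0 ∪ preds r 5 c x0, v ≠ t → r y v := fun v hv hvt =>
    (h.totc (hPO.trans h.odds_sub) (h.YB hy) v hv).resolve_right (hcon v hv hvt)
  have h1 : (succs r 5 c x0 ∪ preds r 5 c x0).erase t ⊆ nb r y (evens 5 (fun i => c (i + 1))) := by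
    intro v hv
    rw [Finset.mem_erase] at hv
    exact mem_nb.2 ⟨hPO hv.2, hred v hv.2 hv.1⟩
  have h2 := Finset.card_le_card h1
  have h3 := hd y hy
  have h4 := Finset.pred_card_le_card_erase (s := succs r 5 c x0 ∪ preds r 5 c x0) (a := t)
  have hP' := hP.resolve_left (by omega) y hy
  have e1 : t ∈ succs r 5 c x0 := by
    by_contra ht
    obtain ⟨a, ha, b, hb, hab⟩ := Finset.one_lt_card.1
      (show 1 < (succs r 5 c x0).card by rw [h.card_succs]; omega)
    exact hab (h.eq_of_red_succs hx0 hy a (Finset.mem_insert_of_mem ha) b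
      (Finset.mem_insert_of_mem hb)
      (hred a (Finset.mem_union_left _ ha) fun e => ht (e ▸ ha))
      (hred b (Finset.mem_union_left _ hb) fun e => ht (e ▸ hb)))
  have e2 : t ∈ preds r 5 c x0 := by
    by_contra ht
    obtain ⟨a, ha, b, hb, hab⟩ := Finset.one_lt_card.1
      (show 1 < (preds r 5 c x0).card by rw [h.card_preds]; omega)
    exact hab (h.eq_of_red_preds hx0 hy a (Finset.mem_insert_of_mem ha) b
      (Finset.mem_insert_of_mem hb)
      (hred a (Finset.mem_union_right _ ha) fun e => ht (e ▸ ha))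
      (hred b (Finset.mem_union_right _ hb) fun e => ht (e ▸ hb)))
  obtain ⟨i, g1, rfl⟩ := h.mem_succs.1 e1
  obtain ⟨j, g2, g3⟩ := h.mem_preds.1 e2
  have g4 : c (2 * j + 2) = c (2 * i + 2) := by
    rw [h.eq_iff] at g3 ⊢
    omega
  rw [g4] at g2
  have r1 : r y (c (2 * i + 3)) := by
    refine hred _ (Finset.mem_union_left _ (h.mem_succs.2 ⟨i + 1, g2, rfl⟩)) fun e => ?_
    rw [h.eq_iff] at e
    omega
  have r2 : r y (c (2 * i + 9)) := by
    refine hred _ (Finset.mem_union_right _ (h.mem_preds.2 ⟨i + 4, ?_, rfl⟩)) fun e => ?_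
    · rw [show 2 * (i + 4) + 2 = 2 * i + 2 * 5 by ring, h.per]
      exact g1
    · rw [h.eq_iff] at e
      omega
  have h5 : ({c (2 * i + 2), c (2 * i + 4), c (2 * i + 8), c (2 * i + 10)} : Finset V) ⊆
      succs r 5 (fun i => c (i + 1)) y ∪ preds r 5 (fun i => c (i + 1)) y := by
    intro v hv
    simp only [Finset.mem_insert, Finset.mem_singleton] at hv
    rw [Finset.mem_union, h.swap.mem_succs, h.swap.mem_preds]
    rcases hv with rfl | rfl | rfl | rfl
    · exact Or.inr ⟨i, r1, rfl⟩
    · exact Or.inl ⟨i + 1, r1, rfl⟩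
    · exact Or.inr ⟨i + 3, r2, rfl⟩
    · exact Or.inl ⟨i + 4, r2, rfl⟩
  have h6 := Finset.card_le_card h5
  rw [Finset.card_insert_of_notMem, Finset.card_insert_of_notMem, Finset.card_pair] at h6
  · omega
  · rw [Ne, h.eq_iff]
    omega
  · simp only [Finset.mem_insert, Finset.mem_singleton, h.eq_iff]
    omega
  · simp only [Finset.mem_insert, Finset.mem_singleton, h.eq_iff]
    omega

lemma path_four_of_common (h : Setup r bl A B X Y 5 c) {x0 : V} (hx0 : x0 ∈ X)
    (hd : ∀ y ∈ Y, (nb r y (evens 5 (fun i => c (i + 1)))).card ≤ 2)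
    (hd0 : (nb r x0 (evens 5 c)).card = 2) {y z u v t₁ t₂ : V} (hy : y ∈ Y) (hz : z ∈ Y)
    (hu : u ∈ Y) (hv : v ∈ Y) (hyz : y ≠ z) (hyu : y ≠ u) (hyv : y ≠ v) (hzu : z ≠ u) (hzv : z ≠ v)
    (huv : u ≠ v) (ht₁ : t₁ ∈ insert x0 (evens 5 (fun i => c (i + 1))))
    (ht₂ : t₂ ∈ insert x0 (evens 5 (fun i => c (i + 1)))) (ht : t₁ ≠ t₂) (e1 : bl y t₁)
    (e2 : bl z t₂) (e3 : bl u t₁) (e4 : bl u t₂) (e5 : bl v t₁) (e6 : bl v t₂) :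
    PathIn bl Y (insert x0 (evens 5 (fun i => c (i + 1)))) y z 4 := by
  have hTA : insert x0 (evens 5 (fun i => c (i + 1))) ⊆ A :=
    Finset.insert_subset (h.XA hx0) h.odds_sub
  have g : ∀ a ∈ Y, ∀ b ∈ insert x0 (evens 5 (fun i => c (i + 1))), a ≠ b :=
    fun a ha b hb => h.bb.swap.ne (h.YB ha) (hTA hb)
  have a1 := g y hy t₁ ht₁
  have a2 := g y hy t₂ ht₂
  have a3 := (g u hu t₁ ht₁).symm
  have a4 := g u hu t₂ ht₂
  have a5 := (g z hz t₁ ht₁).symm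
  have a6 := (g z hz t₂ ht₂).symm
  have a7 := g v hv t₁ ht₁
  have a8 := g v hv t₂ ht₂
  have hl : IsPth bl y z [y, t₁, u, t₂, z] :=
    ⟨by simp [*, hzu.symm], by simp [e1, h.bb.symm e3, e4, h.bb.symm e2], by simp, by simp⟩
  refine h.path_grow hx0 hd hd0 rfl (by omega) subset_rfl hl ?_ rfl hy hz hv ?_ (s := 2) le_rfl
    (by omega) ?_
  · simp only [List.mem_cons, List.not_mem_nil, or_false, Finset.mem_union]
    rintro w (rfl | rfl | rfl | rfl | rfl)
    exacts [Or.inl hy, Or.inr ht₁, Or.inl hu, Or.inr ht₂, Or.inl hz]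
  · simp [hyv.symm, a7, huv.symm, a8, hzv.symm]
  · rw [← Finset.card_pair ht]
    refine Finset.card_le_card fun t ht => ?_
    simp only [Finset.mem_insert, Finset.mem_singleton] at ht
    rw [mem_nb, Finset.mem_inter, List.mem_toFinset]
    rcases ht with rfl | rfl
    · exact ⟨⟨ht₁, by simp⟩, e5⟩
    · exact ⟨⟨ht₂, by simp⟩, e6⟩

lemma exists_common_red (h : Setup r bl A B X Y 5 c) {x0 : V} (hx0 : x0 ∈ X)
    (hd : ∀ y ∈ Y, (nb r y (evens 5 (fun i => c (i + 1)))).card ≤ 2)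
    (hd0 : (nb r x0 (evens 5 c)).card = 2) (hY : Y.card = 7) {y z : V} (hy : y ∈ Y) (hz : z ∈ Y)
    (hyz : y ≠ z) (hb : ¬ PathIn bl Y (insert x0 (evens 5 (fun i => c (i + 1)))) y z 4) :
    ∃ a ∈ insert x0 (succs r 5 c x0), r y a ∧ r z a := by
  set T := insert x0 (succs r 5 c x0) with hT
  have hTO : T ⊆ insert x0 (evens 5 (fun i => c (i + 1))) :=
    Finset.insert_subset_insert _ h.succs_sub
  have hTc : T.card = 3 := by rw [hT, h.card_insert_succs hx0, hd0]
  have tot : ∀ u ∈ Y, ∀ t ∈ T, r u t ∨ bl u t := fun u hu => h.totc (h.insert_sub hx0) (h.YB hu)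
  have huniq : ∀ u ∈ Y, ∀ t ∈ T, ∀ t' ∈ T, r u t → t ≠ t' → bl u t' := fun u hu t ht t' ht' e hne =>
    (tot u hu t' ht').resolve_left fun e' => hne (h.eq_of_red_succs hx0 hu t ht t' ht' e e')
  by_contra! hcon
  have hmiss : ∀ u ∈ Y, ∃ f ∈ T, ∀ t ∈ T, t ≠ f → bl u t := by
    intro u hu
    by_cases hr : ∃ f ∈ T, r u f
    · obtain ⟨f, hf, e⟩ := hr
      exact ⟨f, hf, fun t ht hne => huniq u hu f hf t ht e hne.symm⟩
    · push Not at hr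
      exact ⟨x0, Finset.mem_insert_self _ _, fun t ht _ => (tot u hu t ht).resolve_left (hr t ht)⟩
  choose! f hf hfb using hmiss
  have hYe : ((Y.erase y).erase z).card = 5 := by
    rw [Finset.card_erase_of_mem (Finset.mem_erase.2 ⟨hyz.symm, hz⟩), Finset.card_erase_of_mem hy,
      hY]
  obtain ⟨u, hu, v, hv, huv, huf⟩ := Finset.exists_ne_map_eq_of_card_lt_of_maps_to
    (s := (Y.erase y).erase z) (t := T) (f := f) (by omega) (by
      intro u hu
      exact hf u (Finset.mem_of_mem_erase (Finset.mem_of_mem_erase hu)))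
  simp only [Finset.mem_erase] at hu hv
  obtain ⟨t₁, ht₁, t₂, ht₂, ht⟩ := Finset.one_lt_card.1
    (show 1 < (T.erase (f u)).card by rw [Finset.card_erase_of_mem (hf u hu.2.2)]; omega)
  rw [Finset.mem_erase] at ht₁ ht₂
  have b1 := hfb u hu.2.2 t₁ ht₁.2 ht₁.1
  have b2 := hfb u hu.2.2 t₂ ht₂.2 ht₂.1
  have b3 := hfb v hv.2.2 t₁ ht₁.2 (huf ▸ ht₁.1)
  have b4 := hfb v hv.2.2 t₂ ht₂.2 (huf ▸ ht₂.1)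
  have fin : ∀ t₁ ∈ T, ∀ t₂ ∈ T, t₁ ≠ t₂ → bl u t₁ → bl u t₂ → bl v t₁ → bl v t₂ → bl y t₁ →
      ¬ bl z t₂ := fun t₁ ht₁ t₂ ht₂ ht b1 b2 b3 b4 e e' =>
    hb (h.path_four_of_common hx0 hd hd0 hy hz hu.2.2 hv.2.2 hyz (Ne.symm hu.2.1) (Ne.symm hv.2.1)
      (Ne.symm hu.1) (Ne.symm hv.1) huv (hTO ht₁) (hTO ht₂) ht e e' b1 b2 b3 b4)
  have f1 := fin t₁ ht₁.2 t₂ ht₂.2 ht b1 b2 b3 b4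
  have f2 := fin t₂ ht₂.2 t₁ ht₁.2 ht.symm b2 b1 b4 b3
  rcases tot y hy t₁ ht₁.2 with e | e
  · exact f2 (huniq y hy t₁ ht₁.2 t₂ ht₂.2 e ht)
      ((tot z hz t₁ ht₁.2).resolve_left (hcon t₁ ht₁.2 e))
  · have e1 := (tot z hz t₂ ht₂.2).resolve_right (f1 e)
    exact f2 ((tot y hy t₂ ht₂.2).resolve_left fun e2 => hcon t₂ ht₂.2 e2 e1)
      (huniq z hz t₂ ht₂.2 t₁ ht₁.2 e1 ht.symm)

/-- For degrees at most two and a red `C_10`, the pairs of rows not joined by a blue path on four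
rows form a matching. -/
lemma path_four_or (h : Setup r bl A B X Y 5 c) {x0 : V} (hx0 : x0 ∈ X)
    (hd : ∀ y ∈ Y, (nb r y (evens 5 (fun i => c (i + 1)))).card ≤ 2)
    (hd0 : (nb r x0 (evens 5 c)).card = 2) (hY : Y.card = 7)
    (hP : 4 ≤ (succs r 5 c x0 ∪ preds r 5 c x0).card ∨ ∀ y ∈ Y,
      (succs r 5 (fun i => c (i + 1)) y ∪ preds r 5 (fun i => c (i + 1)) y).card < 4)
    {y z w : V} (hy : y ∈ Y) (hz : z ∈ Y) (hw : w ∈ Y) (hyz : y ≠ z) (hzw : z ≠ w) (hyw : y ≠ w) :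
    PathIn bl Y (insert x0 (evens 5 (fun i => c (i + 1)))) y z 4 ∨
      PathIn bl Y (insert x0 (evens 5 (fun i => c (i + 1)))) y w 4 := by
  by_contra! ⟨hb, hb'⟩
  obtain ⟨a, ha, hya, hza⟩ := h.exists_common_red hx0 hd hd0 hY hy hz hyz hb
  obtain ⟨a', ha', hya', hwa⟩ := h.exists_common_red hx0 hd hd0 hY hy hw hyw hb'
  obtain rfl := h.eq_of_red_succs hx0 hy a ha a' ha' hya hya'
  set O := evens 5 (fun i => c (i + 1)) with hO
  set S := succs r 5 c x0 with hS
  set P := S ∪ preds r 5 c x0 with hPdef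
  have hSP : S ⊆ P := Finset.subset_union_left
  have hx0O : x0 ∉ O := h.off_odds (h.Xoff x0 hx0)
  have hPO : P ⊆ O := Finset.union_subset h.succs_sub h.preds_sub
  have hTO : insert x0 S ⊆ insert x0 O := Finset.insert_subset_insert _ h.succs_sub
  have hTA : insert x0 O ⊆ A := Finset.insert_subset (h.XA hx0) h.odds_sub
  have hTc : (insert x0 S).card = 3 := by rw [hS, h.card_insert_succs hx0, hd0]
  have tot : ∀ u ∈ Y, ∀ t ∈ insert x0 O, r u t ∨ bl u t := fun u hu => h.totc hTA (h.YB hu)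
  have huniq : ∀ u ∈ Y, ∀ t ∈ insert x0 S, ∀ t' ∈ insert x0 S, r u t → t ≠ t' → bl u t' :=
    fun u hu t ht t' ht' e hne => (tot u hu t' (hTO ht')).resolve_left
      fun e' => hne (h.eq_of_red_succs hx0 hu t ht t' ht' e e')
  have hblP : ∀ u ∈ Y, r u x0 → ∀ t ∈ P, bl u t := by
    intro u hu e t ht
    refine (tot u hu t (Finset.mem_insert_of_mem (hPO ht))).resolve_left ?_
    rcases Finset.mem_union.1 ht with ht | ht
    · exact h.no_red_succs hx0 hu (h.rb.symm e) t ht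
    · exact h.no_red_preds hx0 hu (h.rb.symm e) t ht
  have hW : ∀ u ∈ Y, ∀ t, ∃ v ∈ P, v ≠ t ∧ bl u v := fun u hu t =>
    h.exists_blue_nbr hx0 hd hd0 hP hu t
  have hthird : ∀ u ∈ Y, u ≠ y → u ≠ z → u ≠ w → ∀ b ∈ insert x0 S, ∀ b' ∈ insert x0 S, b ≠ b' →
      b ≠ a → b' ≠ a → r u b ∨ r u b' := by
    intro u hu huy huz huw b hb1 b' hb1' hbb hba hba'
    by_contra! hcon
    exact hb (h.path_four_of_common hx0 hd hd0 hy hz hw hu hyz hyw huy.symm hzw huz.symm huw.symm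
      (hTO hb1) (hTO hb1') hbb (huniq y hy a ha b hb1 hya hba.symm)
      (huniq z hz a ha b' hb1' hza hba'.symm) (huniq w hw a ha b hb1 hwa hba.symm)
      (huniq w hw a ha b' hb1' hwa hba'.symm)
      ((tot u hu b (hTO hb1)).resolve_left hcon.1) ((tot u hu b' (hTO hb1')).resolve_left hcon.2))
  have hother : 1 < (((Y.erase y).erase z).erase w).card := by
    have h1 := Finset.pred_card_le_card_erase (s := (Y.erase y).erase z) (a := w)
    have h2 := Finset.pred_card_le_card_erase (s := Y.erase y) (a := z)
    have h3 := Finset.pred_card_le_card_erase (s := Y) (a := y)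
    omega
  obtain ⟨u, hu, v, hv, huv⟩ := Finset.one_lt_card.1 hother
  simp only [Finset.mem_erase] at hu hv
  obtain ⟨huw, huz, huy, huY⟩ := hu
  obtain ⟨hvw, hvz, hvy, hvY⟩ := hv
  have hxne : ∀ t ∈ P, t ≠ x0 := fun t ht e => hx0O (e ▸ hPO ht)
  have hx0T : x0 ∈ insert x0 S := Finset.mem_insert_self _ _
  have hx0T' : x0 ∈ insert x0 O := Finset.mem_insert_self _ _
  have memO : ∀ {t}, t ∈ P → t ∈ insert x0 O := fun ht => Finset.mem_insert_of_mem (hPO ht)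
  rcases Finset.mem_insert.1 ha with rfl | haS
  · obtain ⟨b, hb1, b', hb1', hbb⟩ := Finset.one_lt_card.1
      (show 1 < S.card by rw [hS, h.card_succs]; omega)
    have key : ∀ u ∈ Y, u ≠ y → u ≠ z → u ≠ w → bl u a ∧ ∃ t ∈ P, bl u t := by
      intro u hu huy huz huw
      have hbT : b ∈ insert a S := Finset.mem_insert_of_mem hb1
      have hbT' : b' ∈ insert a S := Finset.mem_insert_of_mem hb1'
      rcases hthird u hu huy huz huw b hbT b' hbT' hbb
        (hxne b (hSP hb1)) (hxne b' (hSP hb1')) with e | e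
      · exact ⟨huniq u hu b hbT a hx0T e (hxne b (hSP hb1)), b', hSP hb1',
          huniq u hu b hbT b' hbT' e hbb⟩
      · exact ⟨huniq u hu b' hbT' a hx0T e (hxne b' (hSP hb1')), b, hSP hb1,
          huniq u hu b' hbT' b hbT e hbb.symm⟩
    obtain ⟨hua, -⟩ := key u huY huy huz huw
    obtain ⟨hva, t₃, ht₃, hvt⟩ := key v hvY hvy hvz hvw
    obtain ⟨t₁, ht₁, hne, hut⟩ := hW u huY t₃
    exact hb (PathIn.four h.bb.swap h.YB hTA hy huY hvY hz huy.symm hvy.symm hyz huv huz hvz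
      (memO ht₁) hx0T' (memO ht₃) (hxne _ ht₁) hne (hxne _ ht₃).symm (hblP y hy hya _ ht₁) hut hua
      hva hvt (hblP z hz hza _ ht₃))
  · have hax : a ≠ x0 := hxne a (hSP haS)
    obtain ⟨s, hs, hsa⟩ := Finset.exists_mem_ne (show 1 < S.card by rw [hS, h.card_succs]; omega) a
    have hsx : s ≠ x0 := hxne s (hSP hs)
    have hsT : s ∈ insert x0 S := Finset.mem_insert_of_mem hs
    have hys := huniq y hy a ha s hsT hya hsa.symm
    have hws := huniq w hw a ha s hsT hwa hsa.symm
    have hwx := huniq w hw a ha x0 hx0T hwa hax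
    rcases hthird u huY huy huz huw s hsT x0 hx0T hsx hsa hax.symm with e | e
    · have hux := huniq u huY s hsT x0 hx0T e hsx
      obtain ⟨t₃, ht₃, hut, hzt⟩ : ∃ t ∈ O, bl u t ∧ bl z t := by
        refine exists_common ?_
        have c1 := h.blue_odds huY
        have c2 := h.blue_odds hz
        have c3 := hd u huY
        have c4 := hd z hz
        have c5 : O.card = 5 := h.card_odds
        change 5 ≤ (nb r u O).card + (nb bl u O).card at c1
        change 5 ≤ (nb r z O).card + (nb bl z O).card at c2
        omega
      exact hb (PathIn.four h.bb.swap h.YB hTA hy hw huY hz hyw huy.symm hyz huw.symm hzw.symm huz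
        (hTO hsT) hx0T' (Finset.mem_insert_of_mem ht₃) hsx (fun e' => h.excl e (e' ▸ hut))
        (fun e' => hx0O (e' ▸ ht₃)) hys hws hwx hux hut hzt)
    · obtain ⟨t₃, ht₃, hne, hzt⟩ := hW z hz s
      exact hb (PathIn.four h.bb.swap h.YB hTA hy hw huY hz hyw huy.symm hyz huw.symm hzw.symm huz
        hx0T' (hTO hsT) (memO ht₃) hsx.symm (hxne _ ht₃).symm hne.symm
        (huniq y hy a ha x0 hx0T hya hax) hwx hws (hblP u huY e s (hSP hs)) (hblP u huY e _ ht₃)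
          hzt)

end Setup

namespace Setup

variable {V : Type} {r bl : V → V → Prop} {A B X Y : Finset V} {k : ℕ}
  {c : ℕ → V} [DecidableEq V]

lemma bad_absurd (h : Setup r bl A B X Y k c) (hk : 4 ≤ k) (hX : X.card = k + 2)
    (hY : Y.card = k + 2) (hb : ¬ HasCyc bl (2 * (k + 1))) {X0 Y0 : Finset V} (hX0 : X0 ⊆ X)
    (hY0 : Y0 ⊆ Y) (hXc : k + 1 ≤ X0.card) (hYc : k + 1 ≤ Y0.card) {m m' : V → V → Prop}
    (hs : ∀ a b, m a b → m b a) (hu : ∀ a b c, m a b → m a c → b = c)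
    (hs' : ∀ a b, m' a b → m' b a) (hu' : ∀ a b c, m' a b → m' a c → b = c)
    (hst : ∀ x ∈ X0, ∀ x' ∈ X0, ∀ y ∈ Y0, ∀ y' ∈ Y0, x ≠ x' → y ≠ y' → bl x y → bl x' y' →
      m x x' ∨ m' y y') : False := by
  rcases red_of_bad (h.totXY hX0 hY0) hs hu hs' hu' hst with ⟨X1, h1, h2, h3⟩ | ⟨Y1, h1, h2, h3⟩
  · exact h.no_red_complete_two hk hX hY hb (h1.trans hX0) hY0 (by omega) hYc h3
  · exact h.swap.no_red_complete_two hk hY hX hb (h1.trans hY0) hX0 (by omega) hXc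
      (fun y hy x hx => h.rb.symm (h3 x hx y hy))

lemma bad_succs (h : Setup r bl A B X Y k c) {x : V} (hx : x ∈ X) {Y0 : Finset V} (hY0 : Y0 ⊆ Y)
    {p : ℕ} (hp : 2 ≤ p) (hpY : p ≤ Y0.card) (hpd : p ≤ (nb r x (evens k c)).card + 1)
    (hd : 2 ≤ (nb r x (evens k c)).card) (u v w : V)
    (h1 : BadPair bl Y0 (insert x (succs r k c x)) p u v)
    (h2 : BadPair bl Y0 (insert x (succs r k c x)) p u w) : v = w := by
  refine h1.unique (fun y z w hy hz hw g1 g2 g3 => ?_) h2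
  rcases Nat.lt_or_ge (nb r x (evens k c)).card 3 with h3 | h3
  · rcases Nat.lt_or_ge p 3 with h4 | h4
    · exact Or.inl (h.path_succs hx hY0 hy hz g1 hp hpY hpd (Or.inr ⟨by omega, hd⟩))
    · obtain rfl : p = 3 := by omega
      exact h.path_succs_or hx hY0 (by omega) hy hz hw g1 g2 g3
  · exact Or.inl (h.path_succs hx hY0 hy hz g1 hp hpY hpd (Or.inl h3))

lemma absurd_of_zero (h : Setup r bl A B X Y k c) (hX : k + 1 ≤ X.card) (hY : k + 2 ≤ Y.card)
    (hY5 : 5 ≤ Y.card) (hb : ¬ HasCyc bl (2 * (k + 1)))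
    (hd : ∀ y ∈ Y, (nb r y (evens k (fun i => c (i + 1)))).card ≤ 0) : False := by
  have hk := h.kpos
  refine h.nored (h.rb.cyc h.XA h.YB (K := Y.card - 1) (fun x hx => ?_) (by omega) (p := k + 1)
    (by omega) hX (by omega)).hasCyc
  have h1 : (nb bl x Y).card ≤ 1 := by
    rw [Finset.card_le_one]
    intro y hy y' hy'
    rw [mem_nb] at hy hy'
    by_contra hne
    exact hb (h.join_paths subset_rfl subset_rfl h.odds_sub (Finset.empty_subset _)
      (Finset.disjoint_empty_right _) (h.disj_odds subset_rfl)
      (h.path_odds subset_rfl hd hy.1 hy'.1 hne (p := k + 1) (by omega) (by omega) (by omega)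
        (by omega)) (PathIn.one hx) hy.2 hy'.2 rfl)
  have := card_le_add (y := x) (T := Y) (fun y hy => h.tot x (h.XA hx) y (h.YB hy))
  omega

lemma absurd_of_one (h : Setup r bl A B X Y k c) (hk : 4 ≤ k) (hX : X.card = k + 2)
    (hY : Y.card = k + 2) (hb : ¬ HasCyc bl (2 * (k + 1)))
    (hd : ∀ y ∈ Y, (nb r y (evens k (fun i => c (i + 1)))).card ≤ 1) {y0 : V} (hy0 : y0 ∈ Y)
    (hyd : (nb r y0 (evens k (fun i => c (i + 1)))).card = 1) : False := by
  classical
  have hsub := Finset.erase_subset y0 Y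
  have hYe : (Y.erase y0).card = k + 1 := by
    rw [Finset.card_erase_of_mem hy0, hY]
    rfl
  obtain ⟨t, ht⟩ := Finset.card_pos.1
    (show 0 < (succs r k (fun i => c (i + 1)) y0).card by rw [h.swap.card_succs]; omega)
  have hte : t ∈ evens k c := h.sub_odds_swap ht
  have star : ∀ X' ⊆ X, ∀ t ∈ B, t ∉ Y.erase y0 → (∀ x ∈ X', bl x t) →
      (∃ X1 ⊆ X', X'.card ≤ X1.card + 1 ∧ ∀ x ∈ X1, ∀ y ∈ Y.erase y0, r x y) ∨
      ∃ Y1 ⊆ Y.erase y0, (Y.erase y0).card ≤ Y1.card + 1 ∧ ∀ x ∈ X', ∀ y ∈ Y1, r x y := by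
    intro X' hX' t ht htY hbl
    refine red_of_star (h.totXY hX' hsub) ?_
    intro x hx x' hx' y hy y' hy' hxx hyy e e'
    have htB : {t} ⊆ B := Finset.singleton_subset_iff.2 ht
    refine hb (h.join_paths (T' := {t}) (q := 2) hsub hX' h.odds_sub htB
      (Finset.disjoint_singleton_right.2 htY) (h.disj_odds hX')
      (h.path_odds hsub (fun y hy => hd y (hsub hy)) hy hy' hyy (p := k) (by omega) (by omega)
        (by omega) (by omega))
      (PathIn.two h.bb (hX'.trans h.XA) htB hx hx' hxx (Finset.mem_singleton_self t) (hbl x hx)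
        (hbl x' hx')) e e' (by omega))
  have hcard := Finset.card_filter_add_card_filter_not (s := X) (fun x => r x y0)
  have hdis := Finset.disjoint_filter_filter_not X X (fun x => r x y0)
  set Xr := X.filter fun x => r x y0 with hXr
  set Xb := X.filter fun x => ¬ r x y0 with hXb
  have hXrX : Xr ⊆ X := Finset.filter_subset _ _
  have hXbX : Xb ⊆ X := Finset.filter_subset _ _
  have s1 := star Xr hXrX t (h.evens_sub hte)
    (fun ht' => h.off_evens (h.Yoff t (hsub ht')) hte) (by
      intro x hx
      rw [hXr, Finset.mem_filter] at hx
      exact (h.tot x (h.XA hx.1) t (h.evens_sub hte)).resolve_left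
        (h.swap.no_red_succs hy0 hx.1 (h.rb.symm hx.2) t ht))
  have s2 := star Xb hXbX y0 (h.YB hy0) (by simp) (by
      intro x hx
      rw [hXb, Finset.mem_filter] at hx
      exact (h.tot x (h.XA hx.1) y0 (h.YB hy0)).resolve_left hx.2)
  rcases s1 with ⟨X1, a1, a2, a3⟩ | ⟨Y1, a1, a2, a3⟩ <;>
    rcases s2 with ⟨X2, b1, b2, b3⟩ | ⟨Y2, b1, b2, b3⟩
  · have hc := Finset.card_union_of_disjoint (hdis.mono a1 b1)
    exact h.no_red_complete_two hk hX hY hb (X1 := X1 ∪ X2)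
      (Finset.union_subset (a1.trans hXrX) (b1.trans hXbX)) hsub (by omega) (by omega)
      (fun x hx y hy => (Finset.mem_union.1 hx).elim (fun g => a3 x g y hy) (fun g => b3 x g y hy))
  · have hc := Finset.card_union_of_disjoint (hdis.mono a1 (subset_refl Xb))
    exact h.swap.no_red_complete_two hk hY hX hb (b1.trans hsub) (Y1 := X1 ∪ Xb)
      (Finset.union_subset (a1.trans hXrX) hXbX) (by omega) (by omega)
      (fun y hy x hx => h.rb.symm ((Finset.mem_union.1 hx).elim (fun g => a3 x g y (b1 hy))
        (fun g => b3 x g y hy)))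
  · have hc := Finset.card_union_of_disjoint (hdis.mono (subset_refl Xr) b1)
    exact h.swap.no_red_complete_two hk hY hX hb (a1.trans hsub) (Y1 := Xr ∪ X2)
      (Finset.union_subset hXrX (b1.trans hXbX)) (by omega) (by omega)
      (fun y hy x hx => h.rb.symm ((Finset.mem_union.1 hx).elim (fun g => a3 x g y hy)
        (fun g => b3 x g y (a1 hy))))
  · have hc := Finset.card_union_of_disjoint hdis
    have hi := Finset.card_union_add_card_inter Y1 Y2
    have hl := Finset.card_le_card (Finset.union_subset a1 b1)
    exact h.swap.no_red_complete_two hk hY hX hb (X1 := Y1 ∩ Y2)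
      (Finset.inter_subset_left.trans (a1.trans hsub)) (Y1 := Xr ∪ Xb)
      (Finset.union_subset hXrX hXbX) (by omega) (by omega)
      (fun y hy x hx => h.rb.symm ((Finset.mem_union.1 hx).elim
        (fun g => a3 x g y (Finset.mem_inter.1 hy).1)
        (fun g => b3 x g y (Finset.mem_inter.1 hy).2)))

lemma absurd_of_small (h : Setup r bl A B X Y k c) (hk : 4 ≤ k) (hX : X.card = k + 2)
    (hY : Y.card = k + 2) (hb : ¬ HasCyc bl (2 * (k + 1))) {d : ℕ}
    (hd : ∀ y ∈ Y, (nb r y (evens k (fun i => c (i + 1)))).card ≤ d) {y0 : V} (hy0 : y0 ∈ Y)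
    (hyd : (nb r y0 (evens k (fun i => c (i + 1)))).card = d) (hdk : 2 * d + 2 ≤ k) : False := by
  rcases Nat.lt_or_ge d 2 with hd2 | hd2
  · obtain rfl | rfl : d = 0 ∨ d = 1 := by omega
    · exact h.absurd_of_zero (by omega) (by omega) (by omega) hb hd
    · exact h.absurd_of_one hk hX hY hb hd hy0 hyd
  · have hsub := Finset.erase_subset y0 Y
    have hYe : (Y.erase y0).card = k + 2 - 1 := by rw [Finset.card_erase_of_mem hy0, hY]
    refine h.bad_absurd hk hX hY hb subset_rfl hsub (by omega) (by omega)
      (m := BadPair bl X (insert y0 (succs r k (fun i => c (i + 1)) y0)) (d + 1))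
      (m' := fun _ _ => False) (fun a b hab => hab.symm h.bb.symm)
      (h.swap.bad_succs hy0 subset_rfl (by omega) (by omega) (by rw [hyd])
        (by rw [hyd]; exact hd2)) (fun _ _ e => e.elim)
      (fun _ _ _ e => e.elim) ?_
    intro x hx x' hx' y hy y' hy' hxx hyy e e'
    left
    by_contra hcon
    exact hb (h.join_paths hsub subset_rfl h.odds_sub (h.swap.insert_sub hy0)
      (h.swap.disj_succs hsub (by simp)) (h.disj_odds subset_rfl)
      (h.path_odds hsub (fun y hy => hd y (hsub hy)) hy hy' hyy (p := k + 1 - d) (by omega)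
        (by omega) (by omega) (by omega)) (BadPair.path hcon hx hx' hxx) e e' (by omega))

lemma absurd_of_large (h : Setup r bl A B X Y k c) (hk : 4 ≤ k) (hX : X.card = k + 2)
    (hY : Y.card = k + 2) (hb : ¬ HasCyc bl (2 * (k + 1))) {d d' : ℕ} {x0 y0 : V} (hx0 : x0 ∈ X)
    (hy0 : y0 ∈ Y) (hxd : (nb r x0 (evens k c)).card = d)
    (hyd : (nb r y0 (evens k (fun i => c (i + 1)))).card = d') (hd2 : 2 ≤ d) (hd2' : 2 ≤ d')
    (hdd : k ≤ d + d') : False := by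
  have hsX := Finset.erase_subset x0 X
  have hsY := Finset.erase_subset y0 Y
  have hXe : (X.erase x0).card = k + 2 - 1 := by rw [Finset.card_erase_of_mem hx0, hX]
  have hYe : (Y.erase y0).card = k + 2 - 1 := by rw [Finset.card_erase_of_mem hy0, hY]
  obtain ⟨p, q, hp, hq, hpq, hpd, hqd⟩ : ∃ p q, 2 ≤ p ∧ 2 ≤ q ∧ p + q = k + 1 + 1 ∧ p ≤ d + 1 ∧
      q ≤ d' + 1 := by
    rcases le_total (d + 1) k with h1 | h1
    · exact ⟨d + 1, k + 1 - d, by omega, by omega, by omega, by omega, by omega⟩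
    · exact ⟨k, 2, by omega, by omega, by omega, by omega, by omega⟩
  refine h.bad_absurd hk hX hY hb hsX hsY (by omega) (by omega)
    (m := BadPair bl (X.erase x0) (insert y0 (succs r k (fun i => c (i + 1)) y0)) q)
    (m' := BadPair bl (Y.erase y0) (insert x0 (succs r k c x0)) p)
    (fun a b hab => hab.symm h.bb.symm)
    (h.swap.bad_succs hy0 hsX (by omega) (by omega) (by rw [hyd]; exact hqd)
      (by rw [hyd]; exact hd2')) (fun a b hab => hab.symm h.bb.symm)
    (h.bad_succs hx0 hsY (by omega) (by omega) (by rw [hxd]; exact hpd) (by rw [hxd]; exact hd2)) ?_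
  intro x hx x' hx' y hy y' hy' hxx hyy e e'
  by_contra hcon
  rw [not_or] at hcon
  exact hb (h.join_paths hsY hsX (h.insert_sub hx0) (h.swap.insert_sub hy0)
    (h.swap.disj_succs hsY (by simp)) (h.disj_succs hsX (by simp)) (BadPair.path hcon.2 hy hy' hyy)
    (BadPair.path hcon.1 hx hx' hxx) e e' hpq)

lemma disj_insert_odds (h : Setup r bl A B X Y k c) {X0 : Finset V} (hX0 : X0 ⊆ X) {x : V}
    (hx : x ∉ X0) : Disjoint X0 (insert x (evens k (fun i => c (i + 1)))) :=
  Finset.disjoint_insert_right.2 ⟨hx, h.disj_odds hX0⟩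

lemma absurd_of_half (h : Setup r bl A B X Y k c) {d : ℕ} (hkd : k = 2 * d + 1) (hd3 : 3 ≤ d)
    (hX : X.card = k + 2) (hY : Y.card = k + 2) (hb : ¬ HasCyc bl (2 * (k + 1)))
    (hd : ∀ y ∈ Y, (nb r y (evens k (fun i => c (i + 1)))).card ≤ d) {x0 y0 : V} (hx0 : x0 ∈ X)
    (hy0 : y0 ∈ Y) (hxd : (nb r x0 (evens k c)).card = d)
    (hyd : (nb r y0 (evens k (fun i => c (i + 1)))).card = d) : False := by
  have hsX := Finset.erase_subset x0 X
  have hsY := Finset.erase_subset y0 Y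
  have hXe : (X.erase x0).card = k + 2 - 1 := by rw [Finset.card_erase_of_mem hx0, hX]
  have hYe : (Y.erase y0).card = k + 2 - 1 := by rw [Finset.card_erase_of_mem hy0, hY]
  refine h.bad_absurd (by omega) hX hY hb hsX hsY (by omega) (by omega)
    (m := BadPair bl (X.erase x0) (insert y0 (succs r k (fun i => c (i + 1)) y0)) (d + 1))
    (m' := fun _ _ => False) (fun a b hab => hab.symm h.bb.symm)
    (h.swap.bad_succs hy0 hsX (by omega) (by omega) (by rw [hyd])
      (by rw [hyd]; omega)) (fun _ _ e => e.elim) (fun _ _ _ e => e.elim) ?_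
  intro x hx x' hx' y hy y' hy' hxx hyy e e'
  left
  by_contra hcon
  exact hb (h.join_paths hsY hsX (Finset.insert_subset (h.XA hx0) h.odds_sub)
    (h.swap.insert_sub hy0) (h.swap.disj_succs hsY (by simp)) (h.disj_insert_odds hsX (by simp))
    (h.path_extra hx0 hd hxd hkd hd3 hsY (by omega) hy hy' hyy) (BadPair.path hcon hx hx' hxx)
    e e' (by omega))

lemma absurd_of_five (h : Setup r bl A B X Y 5 c) (hX : X.card = 7) (hY : Y.card = 7)
    (hb : ¬ HasCyc bl 12) (hdx : ∀ x ∈ X, (nb r x (evens 5 c)).card ≤ 2)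
    (hd : ∀ y ∈ Y, (nb r y (evens 5 (fun i => c (i + 1)))).card ≤ 2) {x0 : V} (hx0 : x0 ∈ X)
    (hxd : (nb r x0 (evens 5 c)).card = 2)
    (hP : 4 ≤ (succs r 5 c x0 ∪ preds r 5 c x0).card ∨ ∀ y ∈ Y,
      (succs r 5 (fun i => c (i + 1)) y ∪ preds r 5 (fun i => c (i + 1)) y).card < 4) : False := by
  have e1 := h.evens_shift
  have hsX := Finset.erase_subset x0 X
  have hXe : (X.erase x0).card = 7 - 1 := by rw [Finset.card_erase_of_mem hx0, hX]
  refine h.bad_absurd (by omega) hX hY hb hsX subset_rfl (by omega) (by omega)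
    (m := BadPair bl (X.erase x0) (evens 5 c) 3)
    (m' := BadPair bl Y (insert x0 (evens 5 fun i => c (i + 1))) 4)
    (fun a b hab => hab.symm h.bb.symm)
    (fun a b c' hab hac => hab.unique (fun y z w hy hz hw g1 g2 g3 => by
      have := h.swap.path_odds_or (d := 2) hsX (by rw [e1]; exact fun x hx => hdx x (hsX hx))
        (by omega) (by omega) hy hz hw g1 g2 g3
      rwa [e1] at this) hac)
    (fun a b hab => hab.symm h.bb.symm)
    (fun a b c' hab hac => hab.unique (fun y z w hy hz hw g1 g2 g3 =>
      h.path_four_or hx0 hd hxd hY hP hy hz hw g1 g2 g3) hac) ?_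
  intro x hx x' hx' y hy y' hy' hxx hyy e e'
  by_contra hcon
  rw [not_or] at hcon
  refine hb (h.join_paths (n := 6) subset_rfl hsX (Finset.insert_subset (h.XA hx0) h.odds_sub)
    h.evens_sub ?_ (h.disj_insert_odds hsX (by simp)) (BadPair.path hcon.2 hy hy' hyy)
    (BadPair.path hcon.1 hx hx' hxx) e e' rfl)
  have := h.swap.disj_odds (X0 := Y) subset_rfl
  rwa [e1] at this

theorem core_two (h : Setup r bl A B X Y k c) (hk : 4 ≤ k) (hX : X.card = k + 2)
    (hY : Y.card = k + 2) : HasCyc bl (2 * (k + 1)) := by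
  by_contra hb
  have e1 := h.evens_shift
  obtain ⟨x0, hx0, hxm⟩ := Finset.exists_max_image X (fun x => (nb r x (evens k c)).card)
    (Finset.card_pos.1 (by omega))
  obtain ⟨y0, hy0, hym⟩ := Finset.exists_max_image Y
    (fun y => (nb r y (evens k (fun i => c (i + 1)))).card) (Finset.card_pos.1 (by omega))
  generalize hd' : (nb r y0 (evens k (fun i => c (i + 1)))).card = d' at *
  generalize hd : (nb r x0 (evens k c)).card = d at *
  by_cases c1 : 2 * d' + 2 ≤ k
  · exact h.absurd_of_small hk hX hY hb hym hy0 hd' c1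
  by_cases c2 : 2 * d + 2 ≤ k
  · exact h.swap.absurd_of_small hk hY hX hb (by rw [e1]; exact hxm) hx0 (by rw [e1]; exact hd) c2
  by_cases c3 : k ≤ d + d'
  · exact h.absurd_of_large hk hX hY hb hx0 hy0 hd hd' (by omega) (by omega) c3
  obtain rfl : d' = d := by omega
  by_cases c4 : 3 ≤ d'
  · exact h.absurd_of_half (by omega) c4 hX hY hb hym hx0 hy0 hd hd'
  obtain rfl : d' = 2 := by omega
  obtain rfl : k = 5 := by omega
  by_cases f1 : ∃ x ∈ X, (nb r x (evens 5 c)).card = 2 ∧ 4 ≤ (succs r 5 c x ∪ preds r 5 c x).card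
  · obtain ⟨x, hx, g1, g2⟩ := f1
    exact h.absurd_of_five hX hY hb hxm hym hx g1 (Or.inl g2)
  by_cases f2 : ∃ y ∈ Y, (nb r y (evens 5 (fun i => c (i + 1)))).card = 2 ∧
      4 ≤ (succs r 5 (fun i => c (i + 1)) y ∪ preds r 5 (fun i => c (i + 1)) y).card
  · obtain ⟨y, hy, g1, g2⟩ := f2
    exact h.swap.absurd_of_five hY hX hb hym (by rw [e1]; exact hxm) hy g1 (Or.inl g2)
  refine h.absurd_of_five hX hY hb hxm hym hx0 hd (Or.inr fun y hy => ?_)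
  by_contra hlt
  refine f2 ⟨y, hy, ?_, by omega⟩
  have g1 := Finset.card_union_le (succs r 5 (fun i => c (i + 1)) y)
    (preds r 5 (fun i => c (i + 1)) y)
  rw [h.swap.card_succs, h.swap.card_preds] at g1
  have g2 := hym y hy
  omega

end Setup

section Small

variable {V : Type} [DecidableEq V] {r bl : V → V → Prop} {A B X Y : Finset V}

lemma red_of_bad_one {m' : V → V → Prop} (htot : ∀ x ∈ X, ∀ y ∈ Y, r x y ∨ bl x y)
    (hs' : ∀ a b, m' a b → m' b a) (hu' : ∀ a b c, m' a b → m' a c → b = c)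
    (hst : ∀ x ∈ X, ∀ x' ∈ X, ∀ y ∈ Y, ∀ y' ∈ Y, x ≠ x' → y ≠ y' → bl x y → bl x' y' → m' y y') :
    (∃ X1 ⊆ X, X.card ≤ X1.card + 1 ∧ ∀ x ∈ X1, ∀ y ∈ Y, r x y) ∨
      ∃ Y1 ⊆ Y, Y.card ≤ Y1.card + 2 ∧ ∀ x ∈ X, ∀ y ∈ Y1, r x y := by
  rcases cover_one_two (fun x y => x ∈ X ∧ y ∈ Y ∧ bl x y) m' hs' hu'
    (fun x x' y y' h1 h2 h3 h4 => hst x h3.1 x' h4.1 y h3.2.1 y' h4.2.1 h1 h2 h3.2.2 h4.2.2)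
    with ⟨W, hW, hE⟩ | ⟨W, hW, hE⟩
  · refine Or.inl ⟨X \ W, Finset.sdiff_subset, ?_, ?_⟩
    · have := Finset.le_card_sdiff W X
      omega
    · intro x hx y hy
      rw [Finset.mem_sdiff] at hx
      exact (htot x hx.1 y hy).resolve_right fun hb => hx.2 (hE x y ⟨hx.1, hy, hb⟩)
  · refine Or.inr ⟨Y \ W, Finset.sdiff_subset, ?_, ?_⟩
    · have := Finset.le_card_sdiff W Y
      omega
    · intro x hx y hy
      rw [Finset.mem_sdiff] at hy
      exact (htot x hx y hy.1).resolve_right fun hb => hy.2 (hE x y ⟨hx, hy.1, hb⟩)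

lemma Bip.cyc_of_complete (h : Bip r A B) (hX : X ⊆ A) (hY : Y ⊆ B) {n : ℕ} (hn : 3 ≤ n)
    (hXn : n ≤ X.card) (hYn : n ≤ Y.card) (hc : ∀ x ∈ X, ∀ y ∈ Y, r x y) : HasCyc r (2 * n) := by
  obtain ⟨Y', hY', hYc⟩ := Finset.exists_subset_card_eq hYn
  exact (h.ham_complete hX (hY'.trans hY) hn hXn hYc
    fun x hx y hy => hc x hx y (hY' hy)).hasCyc

/-- A red `K_{3,5}` in `K_{10,10}` forces a monochromatic `C_8`. -/
lemma no_red_three_five (hr : Bip r A B) (hbl : Bip bl A B)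
    (htot : ∀ a ∈ A, ∀ b ∈ B, r a b ∨ bl a b)
    (hA : A.card = 10) (h8 : ¬ HasCyc r 8) (h8' : ¬ HasCyc bl 8) (hX : X ⊆ A) (hY : Y ⊆ B)
    (hXc : 3 ≤ X.card) (hYc : 5 ≤ Y.card) (hc : ∀ x ∈ X, ∀ y ∈ Y, r x y) : False := by
  wlog hX3 : X.card = 3 generalizing X
  · obtain ⟨X2, hX2, hX2c⟩ := Finset.exists_subset_card_eq hXc
    exact this (hX2.trans hX) hX2c.ge (fun x hx => hc x (hX2 hx)) hX2c
  wlog hY5 : Y.card = 5 generalizing Y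
  · obtain ⟨Y2, hY2, hY2c⟩ := Finset.exists_subset_card_eq hYc
    exact this (hY2.trans hY) hY2c.ge (fun x hx y hy => hc x hx y (hY2 hy)) hY2c
  have hXs := Finset.le_card_sdiff X A
  refine h8' (hbl.cyc (Y := A \ X) Finset.sdiff_subset hY (K := 4) (fun z hz => ?_) (by omega)
      (p := 4)
    (by omega) (by omega) le_rfl).hasCyc
  rw [Finset.mem_sdiff] at hz
  have h1 : (nb r z Y).card ≤ 1 := by
    by_contra hlt
    obtain ⟨S, hS, hSc⟩ := Finset.exists_subset_card_eq (show 2 ≤ (nb r z Y).card by omega)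
    obtain ⟨T, hST, hT, hTc⟩ := Finset.exists_subsuperset_card_eq (hS.trans nb_subset)
      (n := 4) (by omega) (by omega)
    refine h8 (hr.ham_one_extra (n := 4) hX (hT.trans hY) (by omega) (by omega) hTc
      (fun x hx t ht => hc x hx t (hT ht)) hz.1 hz.2 ?_)
    rw [← hSc]
    exact Finset.card_le_card fun t ht => mem_nb.2 ⟨hST ht, (mem_nb.1 (hS ht)).2⟩
  have := card_le_add (y := z) (T := Y) (fun y hy => htot z hz.1 y (hY hy))
  omega

end Small

namespace Setup

variable {V : Type} {r bl : V → V → Prop} {A B X Y : Finset V} {k : ℕ}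
  {c : ℕ → V} [DecidableEq V]

/-- Half of the rows have a common blue column. -/
lemma exists_class (h : Setup r bl A B X Y k c) {x0 : V} (hx0 : x0 ∈ X)
    (hd : 0 < (nb r x0 (evens k c)).card) {Y0 : Finset V} (hY0 : Y0 ⊆ Y) :
    ∃ Y1 ⊆ Y0, Y0.card ≤ 2 * Y1.card ∧ ∃ t ∈ insert x0 (evens k (fun i => c (i + 1))),
      ∀ y ∈ Y1, bl y t := by
  classical
  obtain ⟨t, ht⟩ := Finset.card_pos.1 (show 0 < (succs r k c x0).card by rw [h.card_succs]; omega)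
  have htO : t ∈ evens k (fun i => c (i + 1)) := h.succs_sub ht
  have hcard := Finset.card_filter_add_card_filter_not (s := Y0) (fun y => r y x0)
  rcases le_total (Y0.filter fun y => r y x0).card (Y0.filter fun y => ¬ r y x0).card with h1 | h1
  · refine ⟨_, Finset.filter_subset (fun y => ¬ r y x0) Y0, by omega, x0,
      Finset.mem_insert_self _ _, fun y hy => ?_⟩
    rw [Finset.mem_filter] at hy
    exact h.bb.symm ((h.tot x0 (h.XA hx0) y (h.YB (hY0 hy.1))).resolve_left
      fun e => hy.2 (h.rb.symm e))
  · refine ⟨_, Finset.filter_subset (fun y => r y x0) Y0, by omega, t,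
      Finset.mem_insert_of_mem htO, fun y hy => ?_⟩
    rw [Finset.mem_filter] at hy
    exact (h.totc h.odds_sub (h.YB (hY0 hy.1)) t htO).resolve_left
      (h.no_red_succs hx0 (hY0 hy.1) (h.rb.symm hy.2) t ht)

theorem hexagon (h : Setup r bl A B X Y 2 c) (hX : X.card = 8) (hY : Y.card = 8) : HasCyc bl 6 := by
  by_contra hb
  have e1 := h.evens_shift
  by_cases c1 : ∀ y ∈ Y, (nb r y (evens 2 (fun i => c (i + 1)))).card ≤ 0
  · exact h.absurd_of_zero (by omega) (by omega) (by omega) hb c1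
  by_cases c2 : ∀ x ∈ X, (nb r x (evens 2 c)).card ≤ 0
  · exact h.swap.absurd_of_zero (by omega) (by omega) (by omega) hb (by rw [e1]; exact c2)
  push Not at c1 c2
  obtain ⟨y0, hy0, hyd⟩ := c1
  obtain ⟨x0, hx0, hxd⟩ := c2
  have hsX := Finset.erase_subset x0 X
  have hsY := Finset.erase_subset y0 Y
  have hXe : (X.erase x0).card = 8 - 1 := by rw [Finset.card_erase_of_mem hx0, hX]
  have hYe : (Y.erase y0).card = 8 - 1 := by rw [Finset.card_erase_of_mem hy0, hY]
  obtain ⟨Y1, hY1, hY1c, t, ht, hbt⟩ := h.exists_class hx0 hxd hsY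
  obtain ⟨X1, hX1, hX1c, s, hs, hbs⟩ := h.swap.exists_class hy0 hyd hsX
  rw [e1] at hs
  have htA : {t} ⊆ A := Finset.singleton_subset_iff.2
    (Finset.insert_subset (h.XA hx0) h.odds_sub ht)
  have hsB : {s} ⊆ B := Finset.singleton_subset_iff.2
    (Finset.insert_subset (h.YB hy0) h.evens_sub hs)
  have d1 := (h.disj_insert_odds hsX (x := x0) (by simp)).mono hX1
      (Finset.singleton_subset_iff.2 ht)
  have d2 := h.swap.disj_insert_odds hsY (x := y0) (by simp)
  rw [e1] at d2
  replace d2 := d2.mono hY1 (Finset.singleton_subset_iff.2 hs)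
  have hXX := hX1.trans hsX
  have hYY := hY1.trans hsY
  rcases red_of_star (h.totXY hXX hYY) (by
    intro x hx x' hx' y hy y' hy' hxx hyy e e'
    exact hb (h.join_paths (n := 3) hYY hXX htA hsB d2 d1
      (PathIn.two h.bb.swap (hYY.trans h.YB) htA hy hy' hyy (Finset.mem_singleton_self t) (hbt y hy)
        (hbt y' hy'))
      (PathIn.two h.bb (hXX.trans h.XA) hsB hx hx' hxx (Finset.mem_singleton_self s) (hbs x hx)
        (hbs x' hx')) e e' rfl)) with ⟨X2, g1, g2, g3⟩ | ⟨Y2, g1, g2, g3⟩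
  · exact h.nored (h.rb.cyc_of_complete (n := 3) (g1.trans (hXX.trans h.XA)) (hYY.trans h.YB) le_rfl
      (by omega) (by omega) g3)
  · exact h.nored (h.rb.cyc_of_complete (n := 3) (hXX.trans h.XA) (g1.trans (hYY.trans h.YB)) le_rfl
      (by omega) (by omega) g3)

lemma octagon_of_one (h : Setup r bl A B X Y 3 c) (hX : X.card = 7) (hY : Y.card = 7)
    (hb : ¬ HasCyc bl 8) {y0 : V} (hy0 : y0 ∈ Y)
    (hd : ∀ y ∈ Y, (nb r y (evens 3 (fun i => c (i + 1)))).card ≤ 1)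
    (hyd : (nb r y0 (evens 3 (fun i => c (i + 1)))).card = 1) : False := by
  have e1 := h.evens_shift
  have hsY := Finset.erase_subset y0 Y
  have hYe : (Y.erase y0).card = 7 - 1 := by rw [Finset.card_erase_of_mem hy0, hY]
  obtain ⟨X1, hX1, hX1c, s, hs, hbs⟩ := h.swap.exists_class hy0
    (show 0 < (nb r y0 (evens 3 (fun i => c (i + 1)))).card by omega) (subset_refl X)
  rw [e1] at hs
  have hsB : {s} ⊆ B := Finset.singleton_subset_iff.2
    (Finset.insert_subset (h.YB hy0) h.evens_sub hs)
  have d2 := h.swap.disj_insert_odds hsY (x := y0) (by simp)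
  rw [e1] at d2
  replace d2 := d2.mono_right (Finset.singleton_subset_iff.2 hs)
  have hcA : A.card = 10 := by rw [h.swap.card_B, hX]
  rcases red_of_bad_one (h.totXY hX1 hsY)
      (m' := BadPair bl (Y.erase y0) (evens 3 fun i => c (i + 1)) 3)
    (fun a b hab => hab.symm h.bb.symm)
    (fun a b c' hab hac => hab.unique (fun y z w hy hz hw g1 g2 g3 =>
      h.path_odds_or (d := 1) hsY (fun y hy => hd y (hsY hy)) (by omega) (by omega) hy hz hw g1 g2
        g3)
      hac) (by
    intro x hx x' hx' y hy y' hy' hxx hyy e e'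
    by_contra hcon
    exact hb (h.join_paths (n := 4) hsY hX1 h.odds_sub hsB d2 (h.disj_odds hX1)
      (BadPair.path hcon hy hy' hyy)
      (PathIn.two h.bb (hX1.trans h.XA) hsB hx hx' hxx (Finset.mem_singleton_self s) (hbs x hx)
        (hbs x' hx')) e e' rfl)) with ⟨X2, g1, g2, g3⟩ | ⟨Y2, g1, g2, g3⟩
  · exact no_red_three_five h.rb h.bb h.tot hcA h.nored hb (g1.trans (hX1.trans h.XA))
      (hsY.trans h.YB) (by omega) (by omega) g3
  · exact h.nored (h.rb.cyc_of_complete (n := 4) (hX1.trans h.XA) (g1.trans (hsY.trans h.YB))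
      (by omega) (by omega) (by omega) g3)

theorem octagon (h : Setup r bl A B X Y 3 c) (hX : X.card = 7) (hY : Y.card = 7) : HasCyc bl 8 := by
  by_contra hb
  have e1 := h.evens_shift
  obtain ⟨x0, hx0, hxm⟩ := Finset.exists_max_image X (fun x => (nb r x (evens 3 c)).card)
    (Finset.card_pos.1 (by omega))
  obtain ⟨y0, hy0, hym⟩ := Finset.exists_max_image Y
    (fun y => (nb r y (evens 3 (fun i => c (i + 1)))).card) (Finset.card_pos.1 (by omega))
  generalize hd' : (nb r y0 (evens 3 (fun i => c (i + 1)))).card = d' at *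
  generalize hd : (nb r x0 (evens 3 c)).card = d at *
  by_cases c1 : d' = 0
  · subst c1
    exact h.absurd_of_zero (by omega) (by omega) (by omega) hb hym
  by_cases c2 : d = 0
  · subst c2
    exact h.swap.absurd_of_zero (by omega) (by omega) (by omega) hb (by rw [e1]; exact hxm)
  by_cases c3 : d' = 1
  · subst c3
    exact h.octagon_of_one hX hY hb hy0 hym hd'
  by_cases c4 : d = 1
  · subst c4
    exact h.swap.octagon_of_one hY hX hb hx0 (by rw [e1]; exact hxm) (by rw [e1]; exact hd)
  have hsX := Finset.erase_subset x0 X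
  have hsY := Finset.erase_subset y0 Y
  have hXe : (X.erase x0).card = 7 - 1 := by rw [Finset.card_erase_of_mem hx0, hX]
  have hYe : (Y.erase y0).card = 7 - 1 := by rw [Finset.card_erase_of_mem hy0, hY]
  rcases red_of_bad_one (h.totXY hsX hsY)
      (m' := BadPair bl (Y.erase y0) (insert x0 (succs r 3 c x0)) 3)
    (fun a b hab => hab.symm h.bb.symm)
    (h.bad_succs hx0 hsY (by omega) (by omega) (by omega) (by omega)) (by
    intro x hx x' hx' y hy y' hy' hxx hyy e e'
    by_contra hcon
    exact hb (h.join_paths (n := 4) hsY hsX (h.insert_sub hx0) (h.swap.insert_sub hy0)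
      (h.swap.disj_succs hsY (by simp)) (h.disj_succs hsX (by simp)) (BadPair.path hcon hy hy' hyy)
      (h.swap.path_succs hy0 hsX hx hx' hxx le_rfl (by omega) (by omega)
        (Or.inr ⟨rfl, by omega⟩)) e e' rfl)) with ⟨X2, g1, g2, g3⟩ | ⟨Y2, g1, g2, g3⟩
  · exact h.nored (h.rb.cyc_of_complete (n := 4) (g1.trans (hsX.trans h.XA)) (hsY.trans h.YB)
      (by omega) (by omega) (by omega) g3)
  · exact h.nored (h.rb.cyc_of_complete (n := 4) (hsX.trans h.XA) (g1.trans (hsY.trans h.YB))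
      (by omega) (by omega) (by omega) g3)

end Setup

/-- A red-blue colouring of a complete bipartite graph with parts `A` and `B` of size `N`. -/
structure Col {V : Type} (r bl : V → V → Prop) (A B : Finset V) (N : ℕ) : Prop where
  rb : Bip r A B
  bb : Bip bl A B
  tot : ∀ a ∈ A, ∀ b ∈ B, r a b ∨ bl a b
  excl : ∀ {u v}, r u v → ¬ bl u v
  rmem : ∀ {u v}, r u v → u ∈ A ∨ u ∈ B
  bmem : ∀ {u v}, bl u v → u ∈ A ∨ u ∈ B
  cardA : A.card = N
  cardB : B.card = N

namespace Col

variable {V : Type} {r bl : V → V → Prop} {A B : Finset V} {N : ℕ}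

lemma flip (h : Col r bl A B N) : Col bl r A B N where
  rb := h.bb
  bb := h.rb
  tot a ha b hb := (h.tot a ha b hb).symm
  excl e e' := h.excl e' e
  rmem := h.bmem
  bmem := h.rmem
  cardA := h.cardA
  cardB := h.cardB

lemma restrict (h : Col r bl A B (N + 1)) :
    ∃ r' bl' : V → V → Prop, ∃ A' B' : Finset V, Col r' bl' A' B' N ∧
      (∀ u v, r' u v → r u v) ∧ ∀ u v, bl' u v → bl u v := by
  obtain ⟨A', hA, hA'⟩ := Finset.exists_subset_card_eq (s := A) (n := N) (by rw [h.cardA]; omega)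
  obtain ⟨B', hB, hB'⟩ := Finset.exists_subset_card_eq (s := B) (n := N) (by rw [h.cardB]; omega)
  refine ⟨Rst r A' B', Rst bl A' B', A', B',
      ⟨h.rb.rst hA hB, h.bb.rst hA hB, ?_, ?_, ?_, ?_, hA', hB'⟩,
    fun u v e => e.1, fun u v e => e.1⟩
  · intro a ha b hb
    exact (h.tot a (hA ha) b (hB hb)).imp (fun e => ⟨e, Or.inl ⟨ha, hb⟩⟩)
      fun e => ⟨e, Or.inl ⟨ha, hb⟩⟩
  · exact fun e e' => h.excl e.1 e'.1
  · exact fun e => e.2.imp And.left And.left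
  · exact fun e => e.2.imp And.left And.left

lemma exists_cyc_head (h : Col r bl A B N) {k : ℕ} (hk : 1 ≤ k) (hc : HasCyc r (2 * k)) :
    ∃ l, IsCyc r l ∧ l.length = 2 * k ∧ ∀ v ∈ l.head?, v ∈ B := by
  obtain ⟨l, hl, hlen⟩ := hc
  match l, hl, hlen with
  | [], _, hlen => simp at hlen; omega
  | [_], _, hlen => simp at hlen; omega
  | a :: b :: l, hl, hlen =>
    have hab : r a b := (List.isChain_cons_cons.1 hl.chain).1
    rcases h.rmem hab with ha | ha
    · refine ⟨(b :: l) ++ [a], IsCyc.rotate (l := [a]) hl, by simpa using hlen, ?_⟩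
      intro v hv
      simp at hv
      exact hv ▸ h.rb.lr hab ha
    · refine ⟨a :: b :: l, hl, hlen, ?_⟩
      intro v hv
      simp at hv
      exact hv ▸ ha

lemma exists_setup [DecidableEq V] (h : Col r bl A B N) {k : ℕ} (hk : 2 ≤ k)
    (hc : HasCyc r (2 * k)) (hn : ¬ HasCyc r (2 * k + 2)) :
    ∃ X Y c, Setup r bl A B X Y k c ∧ X.card + k = N ∧ Y.card + k = N := by
  obtain ⟨l, hl, hlen, hhead⟩ := h.exists_cyc_head (by omega) hc
  have hlt : ∀ i, i % (2 * k) < l.length := fun i => by rw [hlen]; exact Nat.mod_lt _ (by omega)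
  set c : ℕ → V := fun i => l[i % (2 * k)]'(hlt i) with hcdef
  have hadj : ∀ i, r (c i) (c (i + 1)) := by
    intro i
    simp only [hcdef]
    have h1 := hlt i
    rcases Nat.lt_or_ge (i % (2 * k) + 1) (2 * k) with h2 | h2
    · have h3 : (i + 1) % (2 * k) = i % (2 * k) + 1 := by
        rw [Nat.add_mod, Nat.mod_eq_of_lt (a := 1) (by omega), Nat.mod_eq_of_lt h2]
      simp only [h3]
      exact List.isChain_iff_getElem.1 hl.chain _ _
    · have h3 : (i + 1) % (2 * k) = 0 := by
        rw [Nat.add_mod, Nat.mod_eq_of_lt (a := 1) (by omega),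
          show i % (2 * k) + 1 = 2 * k by omega, Nat.mod_self]
      simp only [h3]
      apply hl.close
      · rw [List.getLast?_eq_getElem?, List.getElem?_eq_getElem (by omega)]
        simp only [Option.mem_def, Option.some.injEq]
        congr 1
        omega
      · rw [List.head?_eq_getElem?, List.getElem?_eq_getElem (by omega)]
        rfl
  have hpar : ∀ i, c (2 * i) ∈ B ∧ c (2 * i + 1) ∈ A := by
    intro i
    induction i with
    | zero =>
      have : c 0 ∈ B := by
        apply hhead
        rw [List.head?_eq_getElem?, List.getElem?_eq_getElem (by omega)]
        simp [hcdef]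
      exact ⟨this, h.rb.rl (hadj 0) this⟩
    | succ i ih =>
      have h1 : c (2 * (i + 1)) ∈ B := h.rb.lr (hadj (2 * i + 1)) ih.2
      exact ⟨h1, h.rb.rl (hadj _) h1⟩
  have hmem : ∀ i, c i ∈ l := fun i => List.getElem_mem _
  have hsurj : ∀ v ∈ l, ∃ i, c i = v := by
    intro v hv
    obtain ⟨i, hi, e⟩ := List.getElem_of_mem hv
    refine ⟨i, ?_⟩
    simp only [hcdef, Nat.mod_eq_of_lt (hlen ▸ hi)]
    exact e
  have hS : Setup r bl A B (A \ l.toFinset) (B \ l.toFinset) k c :=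
    { rb := h.rb
      bb := h.bb
      tot := h.tot
      kpos := hk
      per := fun i => by simp [hcdef]
      inj := fun i hi j hj e => by
        simp only [hcdef, Nat.mod_eq_of_lt hi, Nat.mod_eq_of_lt hj] at e
        exact (hl.nodup.getElem_inj_iff).1 e
      adj := hadj
      even := fun i => (hpar i).1
      odd := fun i => (hpar i).2
      XA := Finset.sdiff_subset
      YB := Finset.sdiff_subset
      Xoff := fun x hx i e => (Finset.mem_sdiff.1 hx).2 (by rw [← e]; simp [hmem])
      Yoff := fun x hx i e => (Finset.mem_sdiff.1 hx).2 (by rw [← e]; simp [hmem])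
      AX := fun a ha => by
        by_cases hm : a ∈ l
        · exact Or.inr (hsurj a hm)
        · exact Or.inl (by simp [ha, hm])
      BY := fun a ha => by
        by_cases hm : a ∈ l
        · exact Or.inr (hsurj a hm)
        · exact Or.inl (by simp [ha, hm])
      nored := hn
      excl := h.excl }
  exact ⟨_, _, c, hS, by rw [← hS.swap.card_B, h.cardA], by rw [← hS.card_B, h.cardB]⟩

lemma square_of_common {s : V → V → Prop} (h : Bip s A B) {a a' b b' : V} (ha : a ∈ A)
    (ha' : a' ∈ A)
    (hb : b ∈ B) (hb' : b' ∈ B) (hna : a ≠ a') (hnb : b ≠ b') (h1 : s a b) (h2 : s a' b)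
    (h3 : s a b') (h4 : s a' b') : HasCyc s (2 * 2) := by
  refine ⟨[a, b, a', b'], ⟨?_, ?_, ?_⟩, rfl⟩
  · have := h.ne ha hb
    have := h.ne ha hb'
    have := h.ne ha' hb
    have := h.ne ha' hb'
    simp only [List.nodup_cons, List.mem_cons, List.not_mem_nil, or_false, not_or,
      not_false_eq_true, List.nodup_nil, and_true]
    grind
  · simp [h1, h.symm h2, h4]
  · simpa using h.symm h3

lemma square (h : Col r bl A B 10) : HasCyc r (2 * 2) ∨ HasCyc bl (2 * 2) := by
  obtain ⟨x, y, z, hx, hy, hz, hxy, hxz, hyz⟩ :=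
    Finset.two_lt_card_iff.1 (show 2 < A.card by rw [h.cardA]; omega)
  let P : Fin 3 → V × V := ![(x, y), (x, z), (y, z)]
  let S : Bool → V → V → Prop := fun i => if i then r else bl
  have key : ∀ b : V, ∃ i : Fin 3 × Bool, b ∈ B → S i.2 (P i.1).1 b ∧ S i.2 (P i.1).2 b := by
    intro b
    by_cases hb : b ∈ B
    · rcases h.tot x hx b hb with e1 | e1 <;> rcases h.tot y hy b hb with e2 | e2 <;>
        rcases h.tot z hz b hb with e3 | e3
      · exact ⟨(0, true), fun _ => ⟨e1, e2⟩⟩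
      · exact ⟨(0, true), fun _ => ⟨e1, e2⟩⟩
      · exact ⟨(1, true), fun _ => ⟨e1, e3⟩⟩
      · exact ⟨(2, false), fun _ => ⟨e2, e3⟩⟩
      · exact ⟨(2, true), fun _ => ⟨e2, e3⟩⟩
      · exact ⟨(1, false), fun _ => ⟨e1, e3⟩⟩
      · exact ⟨(0, false), fun _ => ⟨e1, e2⟩⟩
      · exact ⟨(0, false), fun _ => ⟨e1, e2⟩⟩
    · exact ⟨(0, true), fun e => (hb e).elim⟩
  choose f hf using key
  obtain ⟨b, hb, b', hb', hne, e⟩ := Finset.exists_ne_map_eq_of_card_lt_of_maps_to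
    (s := B) (t := Finset.univ) (f := f) (by rw [h.cardB]; decide) (fun _ _ => Finset.mem_univ _)
  have h1 := hf b hb
  have h2 := hf b' hb'
  rw [← e] at h2
  have hP : ∀ i, (P i).1 ∈ A ∧ (P i).2 ∈ A ∧ (P i).1 ≠ (P i).2 := by
    intro i
    fin_cases i
    · exact ⟨hx, hy, hxy⟩
    · exact ⟨hx, hz, hxz⟩
    · exact ⟨hy, hz, hyz⟩
  obtain ⟨p1, p2, p3⟩ := hP (f b).1
  generalize f b = q at *
  obtain ⟨q, _ | _⟩ := q
  · exact Or.inr (square_of_common h.bb p1 p2 hb hb' p3 hne h1.1 h1.2 h2.1 h2.2)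
  · exact Or.inl (square_of_common h.rb p1 p2 hb hb' p3 hne h1.1 h1.2 h2.1 h2.2)

/-- In a colouring with parts of size `10` one of the colours has a cycle of length `10`. -/
lemma ten [DecidableEq V] (h : Col r bl A B 10) : HasCyc r (2 * 5) ∨ HasCyc bl (2 * 5) := by
  have step : ∀ k, 2 ≤ k → (∀ r bl : V → V → Prop, ∀ X Y c, Setup r bl A B X Y k c →
      X.card + k = 10 → Y.card + k = 10 → HasCyc bl (2 * (k + 1))) →
      HasCyc r (2 * k) ∨ HasCyc bl (2 * k) → HasCyc r (2 * (k + 1)) ∨ HasCyc bl (2 * (k + 1)) := by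
    intro k hk hS hm
    rcases hm with hm | hm
    · by_contra! hno
      obtain ⟨X, Y, c, h1, h2, h3⟩ := h.exists_setup hk hm hno.1
      exact hno.2 (hS _ _ _ _ _ h1 h2 h3)
    · by_contra! hno
      obtain ⟨X, Y, c, h1, h2, h3⟩ := h.flip.exists_setup hk hm hno.2
      exact hno.1 (hS _ _ _ _ _ h1 h2 h3)
  refine step 4 (by omega) (fun _ _ _ _ _ hS h1 h2 => hS.core_two (by omega) (by omega) (by omega))
    (step 3 (by omega) (fun _ _ _ _ _ hS h1 h2 => hS.octagon (by omega) (by omega))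
      (step 2 (by omega) (fun _ _ _ _ _ hS h1 h2 => hS.hexagon (by omega) (by omega)) h.square))

end Col

/-- Every colouring with parts of size `N` has a red `C_{2m}` or a blue `C_{2n}`. -/
def Arr (V : Type) (N m n : ℕ) : Prop :=
  ∀ (r bl : V → V → Prop) (A B : Finset V), Col r bl A B N → HasCyc r (2 * m) ∨ HasCyc bl (2 * n)

section Arrow

variable {V : Type}

lemma Arr.succ {N m n : ℕ} (h : Arr V N m n) : Arr V (N + 1) m n := by
  intro r bl A B hc
  obtain ⟨r', bl', A', B', hc', h1, h2⟩ := hc.restrict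
  exact (h r' bl' A' B' hc').imp (fun e => e.imp h1) fun e => e.imp h2

variable [DecidableEq V]

lemma Arr.step {N m n : ℕ} (h : Arr V N m n) (hn : 5 ≤ n) (hmn : n ≤ m) (hN : N = m + n) :
    Arr V N (m + 1) n := by
  intro r bl A B hc
  by_contra! hno
  obtain ⟨X, Y, c, hS, h1, h2⟩ := hc.exists_setup (by omega)
    ((h r bl A B hc).resolve_right hno.2) hno.1
  exact hno.2 (hS.core hn hmn (by omega) (by omega))

lemma Arr.step_diag {n : ℕ} (h : Arr V (2 * n + 2) (n + 1) n) (hn : 4 ≤ n) :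
    Arr V (2 * n + 2) (n + 1) (n + 1) := by
  intro r bl A B hc
  by_contra! hno
  obtain ⟨X, Y, c, hS, h1, h2⟩ := hc.flip.exists_setup (by omega)
    ((h r bl A B hc).resolve_left hno.1) hno.2
  exact hno.1 (hS.core_two hn (by omega) (by omega))

lemma arr_of_diag {n : ℕ} (h : Arr V (2 * n) n n) (hn : 5 ≤ n) :
    ∀ d, Arr V (2 * n + d) (n + d + 1) n
  | 0 => Arr.step h hn le_rfl (by omega)
  | d + 1 => Arr.step (m := n + d + 1) (arr_of_diag h hn d).succ hn (by omega) (by omega)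

lemma arr_diag : ∀ d, Arr V (2 * (5 + d)) (5 + d) (5 + d)
  | 0 => fun _ _ _ _ h => h.ten
  | d + 1 => Arr.step_diag (n := 5 + d)
      (by simpa using (arr_of_diag (arr_diag d) (by omega) 0).succ.succ) (by omega)

lemma arr {m n : ℕ} (hn : 5 ≤ n) (hmn : n < m) : Arr V (m + n - 1) m n := by
  obtain ⟨d, rfl⟩ := Nat.exists_eq_add_of_le hn
  obtain ⟨e, rfl⟩ := Nat.exists_eq_add_of_lt hmn
  have := arr_of_diag (V := V) (arr_diag d) hn e
  rwa [show 5 + d + e + 1 + (5 + d) - 1 = 2 * (5 + d) + e by omega]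

end Arrow

lemma HasCyc.exists_walk {V : Type} {G : SimpleGraph V} {k : ℕ} (h : HasCyc G.Adj k) (hk : 3 ≤ k) :
    ∃ v, ∃ w : G.Walk v v, w.IsCycle ∧ w.length = k := by
  obtain ⟨l, hl, hlen⟩ := h
  have hne : l ≠ [] := by rintro rfl; simp at hlen; omega
  have hadj : G.Adj (l.getLast hne) (l.head hne) :=
    hl.close _ (List.getLast_mem_getLast? hne) _ (List.head_mem_head? hne)
  refine ⟨_, Walk.cons hadj (Walk.ofSupport l hne hl.chain), ?_, ?_⟩
  · rw [Walk.isCycle_iff_isPath_tail_and_le_length]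
    constructor
    · rw [Walk.isPath_def]
      simp [hl.nodup]
    · rw [Walk.length_cons, Walk.length_ofSupport]
      omega
  · rw [Walk.length_cons, Walk.length_ofSupport]
    omega

lemma Bip.le_card_of_isCycle {V : Type} [DecidableEq V] {G : SimpleGraph V} {Y T : Finset V}
    (h : Bip G.Adj Y T) (hm : ∀ u v, G.Adj u v → u ∈ Y ∪ T) {v : V} {w : G.Walk v v}
    (hw : w.IsCycle) {m : ℕ} (hl : w.length = 2 * m) : m ≤ T.card := by
  have hn := hw.support_nodup
  have hlen : w.support.tail.length = 2 * m := by simp [hl]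
  have hch : w.support.tail.IsChain G.Adj := w.isChain_adj_support.tail
  have hmem : ∀ u ∈ w.support.tail, u ∈ Y ∪ T := by
    intro u hu
    rw [← w.map_snd_darts] at hu
    obtain ⟨d, -, rfl⟩ := List.mem_map.1 hu
    exact hm _ _ d.adj.symm
  generalize w.support.tail = l at *
  have hT : (l.filter (· ∈ T)).length ≤ T.card := by
    rw [← List.toFinset_card_of_nodup (hn.filter _)]
    refine Finset.card_le_card fun u hu => ?_
    simp at hu
    exact hu.2
  by_cases hY : ∀ u ∈ l.head?, u ∈ Y
  · have := h.length_filter l hch hmem hY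
    omega
  · have hTh : ∀ u ∈ l.head?, u ∈ T := by
      push Not at hY
      obtain ⟨u, hu, hu'⟩ := hY
      intro u' hu2
      obtain rfl := Option.mem_unique hu hu2
      exact (Finset.mem_union.1 (hmem u (List.mem_of_mem_head? hu))).resolve_left hu'
    have h1 := h.swap.length_filter l hch (fun u hu => by
      rw [Finset.union_comm]
      exact hmem u hu) hTh
    have h2 := l.length_eq_length_filter_add (· ∈ Y)
    have h3 : l.filter (fun u => !decide (u ∈ Y)) = l.filter (· ∈ T) := by
      refine List.filter_congr ?_
      intro u hu
      have h4 := Finset.mem_union.1 (hmem u hu)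
      have h5 : u ∈ Y → u ∉ T := fun e => Finset.disjoint_left.1 h.disj e
      by_cases hu' : u ∈ Y
      · simp [hu', h5 hu']
      · simp [hu', h4.resolve_left hu']
    rw [h3] at h2
    omega

/-- The complete bipartite graph between the left vertices satisfying `p` and all right vertices. -/
def leftPart {N : ℕ} (p : Fin N → Prop) : SimpleGraph (Fin N ⊕ Fin N) where
  Adj u v := ∃ i j, p i ∧ (u = Sum.inl i ∧ v = Sum.inr j ∨ u = Sum.inr j ∧ v = Sum.inl i)
  symm := ⟨fun _ _ ⟨i, j, h, e⟩ => ⟨i, j, h, e.symm.imp And.symm And.symm⟩⟩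
  loopless := ⟨by
    rintro _ ⟨i, j, _, ⟨rfl, e⟩ | ⟨rfl, e⟩⟩
    · cases e
    · cases e⟩

lemma le_card_of_isCycle_leftPart {N : ℕ} {p : Fin N → Prop} [DecidablePred p]
    {v : Fin N ⊕ Fin N} {w : (leftPart p).Walk v v} (hw : w.IsCycle) {m : ℕ}
    (hl : w.length = 2 * m) : m ≤ (Finset.univ.filter p).card := by
  have hB : Bip (leftPart p).Adj (Finset.univ.image Sum.inr)
      ((Finset.univ.filter p).image Sum.inl) := by
    refine ⟨?_, fun e => e.symm, ?_, ?_⟩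
    · rw [Finset.disjoint_left]
      simp
    · rintro _ _ ⟨i, j, hi, ⟨rfl, rfl⟩ | ⟨rfl, rfl⟩⟩ <;> simp [hi]
    · rintro _ _ ⟨i, j, hi, ⟨rfl, rfl⟩ | ⟨rfl, rfl⟩⟩ <;> simp
  refine (hB.le_card_of_isCycle ?_ hw hl).trans Finset.card_image_le
  rintro _ _ ⟨i, j, hi, ⟨rfl, rfl⟩ | ⟨rfl, rfl⟩⟩ <;> simp [hi]

lemma col_of_graphs {N : ℕ} {R B : SimpleGraph (Fin N ⊕ Fin N)} (hd : Disjoint R B)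
    (hu : R ⊔ B = completeBipartiteGraph (Fin N) (Fin N)) :
    Col R.Adj B.Adj (Finset.univ.image Sum.inl) (Finset.univ.image Sum.inr) N := by
  have key : ∀ u v, R.Adj u v ∨ B.Adj u v ↔ u.isLeft ∧ v.isRight ∨ u.isRight ∧ v.isLeft := by
    intro u v
    rw [← SimpleGraph.sup_adj, hu]
    rfl
  have bip : ∀ G : SimpleGraph (Fin N ⊕ Fin N),
      (∀ u v, G.Adj u v → u.isLeft ∧ v.isRight ∨ u.isRight ∧ v.isLeft) →
      Bip G.Adj (Finset.univ.image Sum.inl) (Finset.univ.image Sum.inr) := by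
    intro G hG
    refine ⟨?_, fun e => e.symm, ?_, ?_⟩
    · rw [Finset.disjoint_left]
      simp
    · rintro (u | u) (v | v) e he <;> have := hG _ _ e <;> simp at this he ⊢
    · rintro (u | u) (v | v) e he <;> have := hG _ _ e <;> simp at this he ⊢
  have mem : ∀ u : Fin N ⊕ Fin N,
      u ∈ Finset.univ.image (Sum.inl (β := Fin N)) ∨
        u ∈ Finset.univ.image (Sum.inr (α := Fin N)) := by
    rintro (u | u) <;> simp
  refine ⟨bip R fun u v e => (key u v).1 (Or.inl e), bip B fun u v e => (key u v).1 (Or.inr e),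
    ?_, ?_, fun _ => mem _, fun _ => mem _, ?_, ?_⟩
  · intro a ha b hb
    simp only [Finset.mem_image, Finset.mem_univ, true_and] at ha hb
    obtain ⟨i, rfl⟩ := ha
    obtain ⟨j, rfl⟩ := hb
    exact (key _ _).2 (Or.inl ⟨rfl, rfl⟩)
  · intro u v e e'
    exact (SimpleGraph.disjoint_left.1 hd) u v e e'
  · rw [Finset.card_image_of_injective _ Sum.inl_injective, Finset.card_univ, Fintype.card_fin]
  · rw [Finset.card_image_of_injective _ Sum.inr_injective, Finset.card_univ, Fintype.card_fin]

theorem stmt_12 (m n : ℕ) (hn : 5 ≤ n) (hmn : n < m) :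
    -- every red-blue coloring of K_{m+n-1, m+n-1} has a red C_{2m} or a blue C_{2n}
    (∀ R B : SimpleGraph (Fin (m + n - 1) ⊕ Fin (m + n - 1)),
      Disjoint R B →
      R ⊔ B = completeBipartiteGraph (Fin (m + n - 1)) (Fin (m + n - 1)) →
      (∃ v, ∃ w : R.Walk v v, w.IsCycle ∧ w.length = 2 * m) ∨
      (∃ v, ∃ w : B.Walk v v, w.IsCycle ∧ w.length = 2 * n)) ∧
    -- and this fails for K_{m+n-2, m+n-2}
    (∃ R B : SimpleGraph (Fin (m + n - 2) ⊕ Fin (m + n - 2)),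
      Disjoint R B ∧
      R ⊔ B = completeBipartiteGraph (Fin (m + n - 2)) (Fin (m + n - 2)) ∧
      ¬ (∃ v, ∃ w : R.Walk v v, w.IsCycle ∧ w.length = 2 * m) ∧
      ¬ (∃ v, ∃ w : B.Walk v v, w.IsCycle ∧ w.length = 2 * n)) := by
  refine ⟨fun R B hd hu => ?_, leftPart fun i => i.1 < m - 1, leftPart fun i => ¬ i.1 < m - 1,
    ?_, ?_, ?_, ?_⟩
  · exact (arr hn hmn _ _ _ _ (col_of_graphs hd hu)).imp (fun e => e.exists_walk (by omega))
      fun e => e.exists_walk (by omega)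
  · rw [SimpleGraph.disjoint_left]
    rintro _ _ ⟨i, j, hi, ⟨rfl, rfl⟩ | ⟨rfl, rfl⟩⟩ ⟨i', j', hi', e⟩ <;> simp at e
    · exact hi' (e.1 ▸ hi)
    · exact hi' (e.2 ▸ hi)
  · ext (u | u) (v | v)
    · simp [leftPart]
    · simp [leftPart]
      omega
    · simp [leftPart]
      omega
    · simp [leftPart]
  · rintro ⟨v, w, hw, hl⟩
    have h1 := le_card_of_isCycle_leftPart hw hl
    have h2 : (Finset.univ.filter fun i : Fin (m + n - 2) => i.1 < m - 1).card = m - 1 := by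
      rw [Fin.card_filter_val_lt]
      omega
    omega
  · rintro ⟨v, w, hw, hl⟩
    have h1 := le_card_of_isCycle_leftPart hw hl
    have h2 : (Finset.univ.filter fun i : Fin (m + n - 2) => i.1 < m - 1).card = m - 1 := by
      rw [Fin.card_filter_val_lt]
      omega
    have h3 := Finset.card_filter_add_card_filter_not (s := Finset.univ)
      fun i : Fin (m + n - 2) => i.1 < m - 1
    rw [Finset.card_univ, Fintype.card_fin] at h3
    omega
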